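/- arXiv:2403.05737 — 3 statements merged into one kernel-verified Lean document; each statement's English description precedes it below -/
import Mathlib

section
/- There exists a universal constant C > 0 such that for all positive integers k and t, every finite simple graph G with at least one vertex and average degree at least k^(C·t³) either contains the complete bipartite graph K_{t,t} as a (not necessarily induced) subgraph, or has a nonempty induced subgraph H that contains no subgraph isomorphic to the 4-cycle C₄ and has average degree at least k. -/
open SimpleGraph
open scoped Classical

noncomputable section

/-- Average degree of a finite simple graph. -/
def avgDeg {V : Type} [Fintype V] (G : SimpleGraph V) : ℝ :=
  (∑ v, (G.degree v : ℝ)) / (Fintype.card V)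

/-- `G` contains `K_{t,t}` as a (not necessarily induced) subgraph. -/
def HasBicliqueSub {V : Type} (G : SimpleGraph V) (t : ℕ) : Prop :=
  ∃ A B : Finset V, Disjoint A B ∧ A.card = t ∧ B.card = t ∧
    ∀ a ∈ A, ∀ b ∈ B, G.Adj a b

/-- `G` contains `H` as a (not necessarily induced) subgraph. -/
def ContainsSub {V W : Type} (H : SimpleGraph V) (G : SimpleGraph W) : Prop :=
  ∃ f : V → W, Function.Injective f ∧ ∀ ⦃a b : V⦄, H.Adj a b → G.Adj (f a) (f b)

/-- The 4-cycle. -/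
def C4 : SimpleGraph (Fin 4) := SimpleGraph.fromRel fun i j => j = i + 1

/-! ### Working versions of the notions -/

/-- `G` is `K_{t,t}`-free (disjointness of the sides is automatic). -/
def KFree {V : Type} (G : SimpleGraph V) (t : ℕ) : Prop :=
  ∀ A B : Finset V, A.card = t → B.card = t → ¬ (∀ a ∈ A, ∀ b ∈ B, G.Adj a b)

/-- There is a nonempty finite `S` spanning an induced `C₄`-free subgraph of
average degree at least `k`. -/
def Goal {V : Type} (G : SimpleGraph V) (k : ℕ) : Prop :=
  ∃ S : Finset V, S.Nonempty ∧
    (∀ a ∈ S, ∀ b ∈ S, ∀ c ∈ S, ∀ d ∈ S, G.Adj a b → G.Adj b c → G.Adj c d → G.Adj d a →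
      a ≠ c → b ≠ d → False) ∧
    (k : ℝ) * S.card ≤ ∑ v ∈ S, ((S.filter (G.Adj v)).card : ℝ)

/-- Greedy independent sets. -/
lemma exists_indep {α : Type*} (R : α → α → Prop) (hR : ∀ u v, R u v → R v u)
    (S : Finset α) (D : ℕ) (h : ∀ v ∈ S, (S.filter (R v)).card < D) :
    ∃ I ⊆ S, (∀ u ∈ I, ∀ v ∈ I, u ≠ v → ¬ R u v) ∧ S.card ≤ I.card * D := by
  obtain ⟨I, hI, hmax⟩ := Finset.exists_max_image
    (S.powerset.filter (fun I => ∀ u ∈ I, ∀ v ∈ I, u ≠ v → ¬ R u v)) Finset.card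
    ⟨∅, by simp⟩
  simp only [Finset.mem_filter, Finset.mem_powerset] at hI hmax
  refine ⟨I, hI.1, hI.2, ?_⟩
  have hsub : S ⊆ I.biUnion (fun u => insert u (S.filter (R u))) := by
    intro v hv
    simp only [Finset.mem_biUnion, Finset.mem_insert, Finset.mem_filter]
    by_contra hcon
    push Not at hcon
    have hvI : v ∉ I := fun hvI => (hcon v hvI).1 rfl
    have := hmax (insert v I) ⟨by
      intro z hz
      rcases Finset.mem_insert.1 hz with rfl | hz
      · exact hv
      · exact hI.1 hz, by
      intro u hu w hw huw
      rcases Finset.mem_insert.1 hu with hu' | hu' <;>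
        rcases Finset.mem_insert.1 hw with hw' | hw'
      · exact absurd (hu'.trans hw'.symm) huw
      · subst hu'
        intro hr
        exact (hcon w hw').2 hv (hR _ _ hr)
      · subst hw'
        exact (hcon u hu').2 hv
      · exact hI.2 u hu' w hw' huw⟩
    rw [Finset.card_insert_of_notMem hvI] at this
    omega
  calc S.card ≤ _ := Finset.card_le_card hsub
    _ ≤ ∑ u ∈ I, (insert u (S.filter (R u))).card := Finset.card_biUnion_le
    _ ≤ ∑ u ∈ I, D := by
        apply Finset.sum_le_sum
        intro u hu
        have h1 := Finset.card_insert_le u (S.filter (R u))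
        have h2 := h u (hI.1 hu)
        omega
    _ = I.card * D := by simp

/-- A weak off-diagonal Ramsey bound. -/
lemma ramsey_weak {V : Type} (G : SimpleGraph V) (b : ℕ) (hb : 0 < b) (a : ℕ) :
    ∀ S : Finset V, b ^ a ≤ S.card →
    (∃ K ⊆ S, K.card = a ∧ ∀ u ∈ K, ∀ v ∈ K, u ≠ v → G.Adj u v) ∨
    (∃ I ⊆ S, I.card = b ∧ ∀ u ∈ I, ∀ v ∈ I, ¬ G.Adj u v) := by
  induction a with
  | zero => intro S _; left; exact ⟨∅, by simp⟩
  | succ a ih =>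
    intro S hS
    by_cases h : ∀ v ∈ S, (S.filter (G.Adj v)).card < b ^ a
    · right
      obtain ⟨I, hI, hind, hc⟩ := exists_indep G.Adj (fun u v h => h.symm) S (b ^ a) h
      have : b ≤ I.card := by
        have h1 : b * b ^ a ≤ I.card * b ^ a := by rw [← pow_succ']; omega
        exact Nat.le_of_mul_le_mul_right h1 (by positivity)
      obtain ⟨J, hJ, hJc⟩ := Finset.exists_subset_card_eq this
      refine ⟨J, hJ.trans hI, hJc, fun u hu v hv huv => ?_⟩
      exact hind u (hJ hu) v (hJ hv) huv.ne huv
    · push Not at h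
      obtain ⟨v, hv, hvc⟩ := h
      rcases ih _ hvc with ⟨K, hK, hKc, hKa⟩ | ⟨I, hI, hIc, hIa⟩
      · left
        have hvK : v ∉ K := fun hvK => by
          have := hK hvK
          simp at this
        refine ⟨insert v K, ?_, by rw [Finset.card_insert_of_notMem hvK, hKc], ?_⟩
        · intro z hz
          rcases Finset.mem_insert.1 hz with rfl | hz
          · exact hv
          · exact (Finset.mem_filter.1 (hK hz)).1
        · intro u hu w hw huw
          rcases Finset.mem_insert.1 hu with hu' | hu' <;>
            rcases Finset.mem_insert.1 hw with hw' | hw'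
          · exact absurd (hu'.trans hw'.symm) huw
          · subst hu'; exact (Finset.mem_filter.1 (hK hw')).2
          · subst hw'; exact (Finset.mem_filter.1 (hK hu')).2.symm
          · exact hKa u hu' w hw' huw
      · right
        exact ⟨I, hI.trans (Finset.filter_subset _ _), hIc, hIa⟩

lemma KFree.indep {V : Type} {G : SimpleGraph V} {t : ℕ} (hG : KFree G t) (b : ℕ) (hb : 0 < b)
    (S : Finset V) (hS : b ^ (2 * t) ≤ S.card) :
    ∃ I ⊆ S, I.card = b ∧ ∀ u ∈ I, ∀ v ∈ I, ¬ G.Adj u v := by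
  rcases ramsey_weak G b hb (2 * t) S hS with ⟨K, _, hKc, hKa⟩ | h
  · exfalso
    obtain ⟨A, hA, hAc⟩ := Finset.exists_subset_card_eq (s := K) (n := t) (by omega)
    refine hG A (K \ A) hAc ?_ ?_
    · rw [Finset.card_sdiff_of_subset hA]; omega
    · intro a ha b hb
      rw [Finset.mem_sdiff] at hb
      exact hKa a (hA ha) b hb.1 (fun h => hb.2 (h ▸ ha))
  · exact h

/-- Bounded out-degree orientation of graphs all of whose subgraphs are sparse. -/
lemma exists_orient {V : Type} [Fintype V] (G : SimpleGraph V) (d : ℝ)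
    (h : ∀ S : Finset V, S.Nonempty → ∑ v ∈ S, ((S.filter (G.Adj v)).card : ℝ) ≤ d * S.card) :
    ∀ n : ℕ, ∀ S : Finset V, S.card = n → ∃ out : V → Finset V,
      (∀ v ∈ S, ((out v).card : ℝ) ≤ d) ∧
      ∀ u ∈ S, ∀ v ∈ S, G.Adj u v → u ∈ out v ∨ v ∈ out u := by
  intro n
  induction n with
  | zero =>
    intro S hS
    rw [Finset.card_eq_zero] at hS
    subst hS
    exact ⟨fun _ => ∅, by simp, by simp⟩
  | succ n ih =>
    intro S hS
    have hne : S.Nonempty := by rw [← Finset.card_pos]; omega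
    obtain ⟨v, hv, hvd⟩ : ∃ v ∈ S, ((S.filter (G.Adj v)).card : ℝ) ≤ d := by
      by_contra hcon
      push Not at hcon
      have h1 := Finset.sum_lt_sum_of_nonempty hne hcon
      have h2 := h S hne
      simp at h1
      linarith
    obtain ⟨out, ho1, ho2⟩ := ih (S.erase v) (by rw [Finset.card_erase_of_mem hv]; omega)
    refine ⟨fun u => if u = v then S.filter (G.Adj v) else out u, ?_, ?_⟩
    · intro u hu
      by_cases huv : u = v
      · simpa [huv] using hvd
      · simpa [huv] using ho1 u (Finset.mem_erase.2 ⟨huv, hu⟩)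
    · intro u hu w hw huw
      by_cases h1 : u = v
      · subst h1
        right
        simp [hw, huw]
      · by_cases h2 : w = v
        · subst h2
          left
          simp [hu, huw.symm]
        · simpa [h1, h2] using ho2 u (Finset.mem_erase.2 ⟨h1, hu⟩) w (Finset.mem_erase.2 ⟨h2, hw⟩) huw

/-! ### The hypergraph lemma (a weak form of the delta-system theorem of Füredi) -/

/-- Restriction of a labelled edge to a set of coordinates. -/
def rho {α β : Type} {r : ℕ} (e : α → Fin r → β) (I : Finset (Fin r)) (a : α) : Fin r → Option β :=
  fun i => if i ∈ I then some (e a i) else none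

lemma rho_eq {α β : Type} {r : ℕ} (e : α → Fin r → β) (I : Finset (Fin r)) (a a' : α) :
    rho e I a = rho e I a' ↔ ∀ i ∈ I, e a i = e a' i := by
  constructor
  · intro h i hi
    have := congrFun h i
    simpa [rho, hi] using this
  · intro h
    funext i
    by_cases hi : i ∈ I
    · simp [rho, hi, h i hi]
    · simp [rho, hi]

lemma card_small_subsets (r t : ℕ) :
    ((Finset.univ : Finset (Finset (Fin r))).filter (fun I => I.card ≤ t)).card ≤ (r + 1) ^ t := by
  have h := Finset.card_le_card_of_surjOn (s := (Finset.univ : Finset (Fin t → Option (Fin r))))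
    (t := (Finset.univ : Finset (Finset (Fin r))).filter (fun I => I.card ≤ t))
    (fun g => Finset.univ.filter (fun i => ∃ j, g j = some i)) (by
      intro I hI
      simp only [Finset.coe_filter, Finset.mem_univ, true_and, Set.mem_ofPred_eq] at hI
      refine ⟨fun j => I.toList[j.1]?, by simp, ?_⟩
      ext i
      simp only [Finset.mem_filter, Finset.mem_univ, true_and]
      rw [← Finset.mem_toList, List.mem_iff_getElem?]
      constructor
      · rintro ⟨j, hj⟩
        exact ⟨j.1, hj⟩
      · rintro ⟨j, hj⟩
        have : j < I.toList.length := by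
          by_contra hcon
          rw [List.getElem?_eq_none (by omega)] at hj
          simp at hj
        rw [Finset.length_toList] at this
        exact ⟨⟨j, by omega⟩, hj⟩)
  simpa using h

lemma hyper {α β : Type} (k t : ℕ) (hk : 0 < k) (ht : 0 < t) (r : ℕ) (hr : r = k ^ (t - 1))
    (e : α → Fin r → β) (A : Finset α) (b : ℕ)
    (hK : ∀ A' ⊆ A, ∀ I : Finset (Fin r), I.card = t →
      (∀ a ∈ A', ∀ a' ∈ A', ∀ i ∈ I, e a i = e a' i) → A'.card < t)
    (hb : ∀ i, (A.image (fun a => e a i)).card ≤ b)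
    (hA : b * (k + t) ^ ((r + 1) ^ t) < A.card) :
    ∃ A' ⊆ A, A'.Nonempty ∧ ∃ P : Finset (Fin r), P.card = k ∧
      (∀ a ∈ A', ∀ a' ∈ A', ∀ i ∈ P, ∀ j ∈ P, i ≠ j → e a i = e a' i → e a j = e a' j → a = a') ∧
      ∑ i ∈ P, (A'.image (fun a => e a i)).card ≤ A'.card := by
  set L := k + t with hL
  set F := (Finset.univ : Finset (Finset (Fin r))).filter (fun I => I.card ≤ t) with hF
  have hFc : F.card ≤ (r + 1) ^ t := card_small_subsets r t
  let pc : Finset α → ℕ := fun X => (F.filter (fun I => Set.InjOn (rho e I) (X : Set α))).card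
  obtain ⟨X, hX, hmax⟩ := Finset.exists_max_image A.powerset (fun X => X.card * L ^ pc X)
    ⟨A, by simp⟩
  simp only [Finset.mem_powerset] at hX hmax
  have hLpos : 0 < L := by omega
  have hXc : b < X.card := by
    have h1 := hmax A (Finset.Subset.refl _)
    have h2 : A.card ≤ A.card * L ^ pc A := Nat.le_mul_of_pos_right _ (by positivity)
    have h3 : pc X ≤ (r + 1) ^ t := (Finset.card_filter_le _ _).trans hFc
    have h4 : X.card * L ^ pc X ≤ X.card * L ^ ((r + 1) ^ t) :=
      Nat.mul_le_mul_left _ (Nat.pow_le_pow_right hLpos h3)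
    have h5 : b * L ^ ((r + 1) ^ t) < X.card * L ^ ((r + 1) ^ t) := by omega
    exact Nat.lt_of_mul_lt_mul_right h5
  have hXpos : 0 < X.card := by omega
  -- rich sets
  have hrich : ∀ I ∈ F, ¬ Set.InjOn (rho e I) (X : Set α) →
      (X.image (rho e I)).card * L ≤ X.card := by
    intro I hI hni
    obtain ⟨Y, hYX, hYi, hYim⟩ := Finset.exists_subset_injOn_image_eq_of_surjOn (f := rho e I)
      (X : Set α) (X.image (rho e I)) (by
        intro z hz
        simpa using hz)
    have hYX' : Y ⊆ X := by exact_mod_cast hYX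
    have hYc : Y.card = (X.image (rho e I)).card := by
      rw [← hYim, Finset.card_image_of_injOn hYi]
    have hpc : pc X + 1 ≤ pc Y := by
      have h1 : insert I (F.filter (fun I => Set.InjOn (rho e I) (X : Set α))) ⊆
          F.filter (fun I => Set.InjOn (rho e I) (Y : Set α)) := by
        intro J hJ
        rcases Finset.mem_insert.1 hJ with rfl | hJ
        · exact Finset.mem_filter.2 ⟨hI, hYi⟩
        · rw [Finset.mem_filter] at hJ ⊢
          exact ⟨hJ.1, hJ.2.mono hYX⟩
      have h2 := Finset.card_le_card h1
      rw [Finset.card_insert_of_notMem (by simp [hni])] at h2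
      exact h2
    have h1 := hmax Y (hYX'.trans hX)
    have h2 : Y.card * L ^ (pc X + 1) ≤ Y.card * L ^ pc Y :=
      Nat.mul_le_mul_left _ (Nat.pow_le_pow_right hLpos hpc)
    have h3 : (Y.card * L) * L ^ pc X ≤ X.card * L ^ pc X := by
      rw [pow_succ'] at h2
      calc _ = Y.card * (L * L ^ pc X) := by ring
        _ ≤ _ := h2.trans h1
    rw [← hYc]
    exact Nat.le_of_mul_le_mul_right h3 (by positivity)
  have hmemF : ∀ I : Finset (Fin r), I.card ≤ t → I ∈ F := by
    intro I hI
    simp [hF, hI]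
  -- sets of size `t` are poor
  have hpoor : ∀ I : Finset (Fin r), I.card = t → Set.InjOn (rho e I) (X : Set α) := by
    intro I hI
    by_contra hni
    have h1 := hrich I (hmemF I hI.le) hni
    have h2 : X.card ≤ (X.image (rho e I)).card * t := by
      rw [mul_comm]
      apply Finset.card_le_mul_card_image
      intro z hz
      apply le_of_lt
      apply hK _ ((Finset.filter_subset _ _).trans hX) I hI
      intro a ha a' ha' i hi
      rw [Finset.mem_filter] at ha ha'
      exact (rho_eq e I a a').1 (ha.2.trans ha'.2.symm) i hi
    have h3 : 0 < (X.image (rho e I)).card := by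
      rw [Finset.card_pos, Finset.image_nonempty, ← Finset.card_pos]
      exact hXpos
    have : (X.image (rho e I)).card * t < (X.image (rho e I)).card * L :=
      Nat.mul_lt_mul_of_pos_left (by omega) h3
    omega
  have hmono : ∀ I J : Finset (Fin r), I ⊆ J → Set.InjOn (rho e I) (X : Set α) →
      Set.InjOn (rho e J) (X : Set α) := by
    intro I J hIJ h a ha a' ha' haa
    apply h ha ha'
    rw [rho_eq] at haa ⊢
    exact fun i hi => haa i (hIJ hi)
  let XX : Finset (Fin r) → Finset (Fin r) := fun I =>
    Finset.univ.filter (fun i => i ∉ I ∧ ¬ Set.InjOn (rho e (insert i I)) (X : Set α))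
  have key : ∀ j : ℕ, ∀ I : Finset (Fin r), I.card + j + 1 = t → k ^ j ≤ (XX I).card →
      ∃ A' ⊆ A, A'.Nonempty ∧ ∃ P : Finset (Fin r), P.card = k ∧
      (∀ a ∈ A', ∀ a' ∈ A', ∀ i ∈ P, ∀ j ∈ P, i ≠ j → e a i = e a' i → e a j = e a' j → a = a') ∧
      ∑ i ∈ P, (A'.image (fun a => e a i)).card ≤ A'.card := by
    intro j
    induction j with
    | zero =>
      intro I hI hc
      exfalso
      have : 0 < (XX I).card := by simpa using hc
      obtain ⟨i, hi⟩ := Finset.card_pos.1 this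
      simp only [XX, Finset.mem_filter, Finset.mem_univ, true_and] at hi
      exact hi.2 (hpoor _ (by rw [Finset.card_insert_of_notMem hi.1]; omega))
    | succ j ih =>
      intro I hI hc
      let R : Fin r → Fin r → Prop := fun i i' =>
        i ≠ i' ∧ ¬ Set.InjOn (rho e (insert i' (insert i I))) (X : Set α)
      by_cases hdeg : ∀ i ∈ XX I, ((XX I).filter (R i)).card < k ^ j
      · obtain ⟨P0, hP0, hind, hPc⟩ := exists_indep R (by
          rintro u v ⟨h1, h2⟩
          refine ⟨h1.symm, ?_⟩
          rwa [Finset.insert_comm]) (XX I) (k ^ j)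
          (fun v hv => by convert hdeg v hv)
        have : k ≤ P0.card := by
          have h1 : k * k ^ j ≤ P0.card * k ^ j := by rw [← pow_succ']; omega
          exact Nat.le_of_mul_le_mul_right h1 (by positivity)
        obtain ⟨P, hPP, hPk⟩ := Finset.exists_subset_card_eq this
        -- averaging over the links
        let Z := X.image (rho e I)
        let lk : (Fin r → Option β) → Finset α := fun z => X.filter (fun a => rho e I a = z)
        have hZ : Z.Nonempty := by
          rw [Finset.image_nonempty, ← Finset.card_pos]; exact hXpos
        have hsum1 : ∑ z ∈ Z, (lk z).card = X.card :=
          (Finset.card_eq_sum_card_fiberwise (f := rho e I) (s := X) (t := Z)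
            (fun a ha => Finset.mem_coe.2 (Finset.mem_image_of_mem _ ha))).symm
        have hsum2 : ∀ i ∈ P, (∑ z ∈ Z, ((lk z).image (fun a => e a i)).card) * L ≤ X.card := by
          intro i hi
          have hiX := hP0 (hPP hi)
          simp only [XX, Finset.mem_filter, Finset.mem_univ, true_and] at hiX
          have h1 := hrich (insert i I)
            (hmemF _ (by rw [Finset.card_insert_of_notMem hiX.1]; omega)) hiX.2
          refine le_trans (Nat.mul_le_mul_right _ ?_) h1
          have h2 : (X.image (fun a => (rho e I a, e a i))).card ≤
              (X.image (rho e (insert i I))).card := by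
            apply Finset.card_le_card_of_surjOn (fun w : Fin r → Option β =>
              ((fun l => if l ∈ I then w l else none), (w i).getD (e (Classical.choose
                (Finset.card_pos.1 hXpos)) i)))
            intro y hy
            simp only [Finset.coe_image, Set.mem_image, Finset.mem_coe] at hy
            obtain ⟨a, ha, rfl⟩ := hy
            refine ⟨rho e (insert i I) a, by simpa using ⟨a, ha, rfl⟩, ?_⟩
            refine Prod.ext ?_ ?_
            · funext l
              by_cases hl : l ∈ I <;> simp [rho, hl]
            · simp [rho]
          refine le_trans (le_of_eq ?_) h2
          rw [Finset.card_eq_sum_card_fiberwise (f := Prod.fst) (t := Z)]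
          · apply Finset.sum_congr rfl
            intro z hz
            rw [← Finset.card_image_of_injective ((lk z).image (fun a => e a i))
              (Prod.mk_right_injective z)]
            congr 1
            ext ⟨y1, y2⟩
            simp only [Finset.mem_image, Finset.mem_filter, lk, Prod.mk.injEq]
            constructor
            · rintro ⟨_, ⟨a, ⟨ha, hz⟩, rfl⟩, rfl, rfl⟩
              exact ⟨⟨a, ha, hz, rfl⟩, rfl⟩
            · rintro ⟨⟨a, ha, h1, h2⟩, rfl⟩
              exact ⟨_, ⟨a, ⟨ha, h1⟩, h2⟩, rfl, rfl⟩
          · intro y hy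
            simp only [Finset.coe_image, Set.mem_image, Finset.mem_coe] at hy
            obtain ⟨a, ha, rfl⟩ := hy
            exact Finset.mem_coe.2 (Finset.mem_image_of_mem _ ha)
        have hsum3 : ∑ z ∈ Z, ∑ i ∈ P, ((lk z).image (fun a => e a i)).card ≤
            ∑ z ∈ Z, (lk z).card := by
          rw [hsum1, Finset.sum_comm]
          have h1 := Finset.sum_le_sum hsum2
          rw [← Finset.sum_mul, Finset.sum_const, hPk, smul_eq_mul] at h1
          have h2 : k * X.card ≤ X.card * L := by rw [mul_comm]; exact Nat.mul_le_mul_left _ (by omega)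
          exact Nat.le_of_mul_le_mul_right (h1.trans h2) hLpos
        obtain ⟨z, hz, hzle⟩ := Finset.exists_le_of_sum_le hZ hsum3
        refine ⟨lk z, (Finset.filter_subset _ _).trans hX, ?_, P, hPk, ?_, hzle⟩
        · obtain ⟨a, ha, haz⟩ := Finset.mem_image.1 hz
          exact ⟨a, Finset.mem_filter.2 ⟨ha, haz⟩⟩
        · intro a ha a' ha' i hi i' hi' hii h1 h2
          have h3 := hind i (hPP hi) i' (hPP hi') hii
          simp only [R, not_and, not_not] at h3
          rw [Finset.mem_filter] at ha ha'
          apply h3 hii ha.1 ha'.1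
          rw [rho_eq]
          intro l hl
          rcases Finset.mem_insert.1 hl with rfl | hl
          · exact h2
          rcases Finset.mem_insert.1 hl with rfl | hl
          · exact h1
          · exact (rho_eq e I a a').1 (ha.2.trans ha'.2.symm) l hl
      · push Not at hdeg
        obtain ⟨i, hi, hic⟩ := hdeg
        simp only [XX, Finset.mem_filter, Finset.mem_univ, true_and] at hi
        refine ih (insert i I) (by rw [Finset.card_insert_of_notMem hi.1]; omega)
          (hic.trans (Finset.card_le_card ?_))
        intro l hl
        simp only [XX, R, Finset.mem_filter, Finset.mem_univ, true_and] at hl ⊢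
        refine ⟨?_, hl.2.2⟩
        rw [Finset.mem_insert]
        rintro (h | h)
        · exact hl.2.1 h.symm
        · exact hl.1.1 h
  refine key (t - 1) ∅ (by simp; omega) ?_
  have : XX ∅ = Finset.univ := by
    ext i
    simp only [XX, Finset.mem_filter, Finset.mem_univ, true_and, iff_true]
    refine ⟨by simp, fun hinj => ?_⟩
    have h1 : X.card ≤ (X.image (fun a => e a i)).card := by
      rw [Finset.card_image_of_injOn]
      intro a ha a' ha' haa
      apply hinj ha ha'
      rw [rho_eq]
      intro l hl
      have : l = i := by simpa using hl
      subst this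
      exact haa
    have h2 : (X.image (fun a => e a i)).card ≤ (A.image (fun a => e a i)).card :=
      Finset.card_le_card (Finset.image_subset_image hX)
    have h3 := hb i
    omega
  rw [this]
  simp [hr]

/-! ### Weighted Kővári–Sós–Turán and the sampling lemma -/

lemma kst_weighted {V : Type} (G : SimpleGraph V) (t : ℕ) (hG : KFree G t)
    (w : V → ℝ) (p W σ : ℝ) (hw0 : ∀ v, 0 ≤ w v) (hwp : ∀ v, w v ≤ p) (hp : 0 < p)
    (X Z : Finset V) (hX : ∑ x ∈ X, w x ≤ W) (hW : 0 < W) (hσ0 : 0 < σ) (hσ : 2 * t * p ≤ σ)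
    (hZ : ∀ u ∈ Z, σ ≤ ∑ x ∈ X.filter (G.Adj u), w x) :
    ∑ u ∈ Z, w u ≤ t * p * (2 * W / σ) ^ t := by
  by_cases hpos : ∑ u ∈ Z, w u ≤ 0
  · exact hpos.trans (by positivity)
  push Not at hpos
  have key : ∀ j : ℕ, j ≤ t → ∃ T ⊆ X, T.card = j ∧
      (∑ u ∈ Z, w u) * (σ / (2 * W)) ^ j ≤ ∑ u ∈ Z.filter (fun u => ∀ x ∈ T, G.Adj u x), w u := by
    intro j
    induction j with
    | zero => intro _; exact ⟨∅, by simp, by simp, by simp⟩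
    | succ j ih =>
      intro hj
      obtain ⟨T, hTX, hTc, hT⟩ := ih (by omega)
      set Z' := Z.filter (fun u => ∀ x ∈ T, G.Adj u x) with hZ'
      set m := ∑ u ∈ Z', w u with hm
      have hmpos : 0 < m := lt_of_lt_of_le (by positivity) hT
      have hex : ∃ x ∈ X \ T, m * (σ / (2 * W)) ≤ ∑ u ∈ Z'.filter (fun u => G.Adj u x), w u := by
        by_contra hcon
        push Not at hcon
        have h1 : ∑ x ∈ X \ T, w x * ∑ u ∈ Z'.filter (fun u => G.Adj u x), w u ≤ m * σ / 2 := by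
          calc _ ≤ ∑ x ∈ X \ T, w x * (m * (σ / (2 * W))) := by
                apply Finset.sum_le_sum
                intro x hx
                exact mul_le_mul_of_nonneg_left (hcon x hx).le (hw0 x)
            _ = (∑ x ∈ X \ T, w x) * (m * (σ / (2 * W))) := by rw [← Finset.sum_mul]
            _ ≤ W * (m * (σ / (2 * W))) := by
                apply mul_le_mul_of_nonneg_right _ (by positivity)
                exact (Finset.sum_le_sum_of_subset_of_nonneg Finset.sdiff_subset
                  (fun i _ _ => hw0 i)).trans hX
            _ = m * σ / 2 := by field_simp
        have h2 : ∑ x ∈ X \ T, w x * ∑ u ∈ Z'.filter (fun u => G.Adj u x), w u =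
            ∑ u ∈ Z', w u * ∑ x ∈ (X \ T).filter (G.Adj u), w x := by
          simp only [Finset.sum_filter, Finset.mul_sum]
          rw [Finset.sum_comm]
          apply Finset.sum_congr rfl
          intro u _
          apply Finset.sum_congr rfl
          intro x _
          by_cases h : G.Adj u x <;> simp [h, mul_comm]
        have h3 : ∀ u ∈ Z', σ - j * p ≤ ∑ x ∈ (X \ T).filter (G.Adj u), w x := by
          intro u hu
          have h4 := hZ u (Finset.mem_filter.1 hu).1
          have h5 : ∑ x ∈ X.filter (G.Adj u), w x ≤
              ∑ x ∈ (X \ T).filter (G.Adj u), w x + ∑ x ∈ T, w x := by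
            rw [← Finset.sum_union]
            · apply Finset.sum_le_sum_of_subset_of_nonneg
              · intro x hx
                rw [Finset.mem_filter] at hx
                by_cases hxT : x ∈ T
                · exact Finset.mem_union_right _ hxT
                · exact Finset.mem_union_left _ (by simp [hx.1, hx.2, hxT])
              · exact fun i _ _ => hw0 i
            · rw [Finset.disjoint_left]
              intro x hx
              simp at hx
              exact hx.1.2
          have h6 : ∑ x ∈ T, w x ≤ j * p := by
            calc _ ≤ ∑ x ∈ T, p := Finset.sum_le_sum (fun x _ => hwp x)
              _ = j * p := by simp [hTc]
          linarith
        have h4 : m * (σ - j * p) ≤ ∑ u ∈ Z', w u * ∑ x ∈ (X \ T).filter (G.Adj u), w x := by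
          rw [hm, Finset.sum_mul]
          exact Finset.sum_le_sum (fun u hu => mul_le_mul_of_nonneg_left (h3 u hu) (hw0 u))
        rw [h2] at h1
        have h5 : (j : ℝ) + 1 ≤ t := by exact_mod_cast hj
        have h6 : m * σ / 2 < m * (σ - j * p) := by
          have : σ / 2 < σ - j * p := by nlinarith
          nlinarith
        linarith
      obtain ⟨x, hx, hxm⟩ := hex
      rw [Finset.mem_sdiff] at hx
      refine ⟨insert x T, ?_, by rw [Finset.card_insert_of_notMem hx.2, hTc], ?_⟩
      · intro z hz
        rcases Finset.mem_insert.1 hz with rfl | hz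
        · exact hx.1
        · exact hTX hz
      · have h1 : Z.filter (fun u => ∀ y ∈ insert x T, G.Adj u y) =
            Z'.filter (fun u => G.Adj u x) := by
          ext u
          simp only [hZ', Finset.mem_filter, Finset.mem_insert, forall_eq_or_imp]
          tauto
        rw [h1]
        refine le_trans ?_ hxm
        rw [pow_succ, ← mul_assoc]
        exact mul_le_mul_of_nonneg_right hT (by positivity)
  obtain ⟨T, hTX, hTc, hT⟩ := key t le_rfl
  set Z' := Z.filter (fun u => ∀ x ∈ T, G.Adj u x) with hZ'
  have hcard : Z'.card ≤ t := by
    by_contra hcon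
    push Not at hcon
    obtain ⟨Y, hY, hYc⟩ := Finset.exists_subset_card_eq hcon.le
    refine hG Y T hYc hTc ?_
    intro a ha b hb
    exact (Finset.mem_filter.1 (hY ha)).2 b hb
  have h1 : ∑ u ∈ Z', w u ≤ t * p := by
    calc _ ≤ ∑ u ∈ Z', p := Finset.sum_le_sum (fun x _ => hwp x)
      _ = Z'.card * p := by simp
      _ ≤ t * p := by
        apply mul_le_mul_of_nonneg_right _ hp.le
        exact_mod_cast hcard
  have h2 : (σ / (2 * W)) ^ t * (2 * W / σ) ^ t = 1 := by
    rw [← mul_pow]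
    have : σ / (2 * W) * (2 * W / σ) = 1 := by field_simp
    rw [this, one_pow]
  calc ∑ u ∈ Z, w u = (∑ u ∈ Z, w u) * (σ / (2 * W)) ^ t * (2 * W / σ) ^ t := by
        rw [mul_assoc, h2, mul_one]
    _ ≤ t * p * (2 * W / σ) ^ t :=
        mul_le_mul_of_nonneg_right (hT.trans h1) (by positivity)

/-- Probability of the set `S` under independent sampling with probabilities `w`. -/
def mu {V : Type} [Fintype V] (w : V → ℝ) (S : Finset V) : ℝ :=
  (∏ v ∈ S, w v) * ∏ v ∈ Finset.univ \ S, (1 - w v)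

lemma mu_sum {V : Type} [Fintype V] (w : V → ℝ) (T : Finset V) :
    ∑ S : Finset V, mu w S * (if T ⊆ S then 1 else 0) = ∏ v ∈ T, w v := by
  have h := Finset.prod_add w (fun v => if v ∈ T then 0 else 1 - w v) Finset.univ
  have h1 : ∏ v, (w v + (if v ∈ T then 0 else 1 - w v)) = ∏ v ∈ T, w v := by
    rw [← Finset.prod_subset (Finset.subset_univ T)]
    · apply Finset.prod_congr rfl
      intro v hv
      simp [hv]
    · intro v _ hv
      simp [hv]
  rw [← h1, h, Finset.powerset_univ]
  apply Finset.sum_congr rfl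
  intro S _
  unfold mu
  by_cases hTS : T ⊆ S
  · rw [if_pos hTS, mul_one]
    congr 1
    apply Finset.prod_congr rfl
    intro v hv
    rw [Finset.mem_sdiff] at hv
    rw [if_neg (fun hvT => hv.2 (hTS hvT))]
  · rw [if_neg hTS, mul_zero]
    obtain ⟨v, hvT, hvS⟩ := Finset.not_subset.1 hTS
    rw [Finset.prod_eq_zero (i := v) (s := Finset.univ \ S) (by simp [hvS]) (by simp [hvT]), mul_zero]

lemma mu_sum_family {V ι : Type} [Fintype V] (w : V → ℝ) (Y : Finset ι) (T : ι → Finset V) :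
    ∑ S : Finset V, mu w S * ((Y.filter (fun y => T y ⊆ S)).card : ℝ) =
      ∑ y ∈ Y, ∏ v ∈ T y, w v := by
  simp_rw [← mu_sum w]
  rw [Finset.sum_comm]
  apply Finset.sum_congr rfl
  intro S _
  rw [← Finset.mul_sum]
  congr 1
  rw [Finset.card_filter]
  push_cast
  rfl

/-- Deletion: from a set with many edges and few decorated 4-cycles to a `C₄`-free one. -/
lemma deletion {V : Type} [Fintype V] (G : SimpleGraph V) (k : ℕ) (S : Finset V)
    (h : (k : ℝ) * S.card +
      2 * ((Finset.univ : Finset (V × V × V × V × V)).filter (fun q =>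
        (G.Adj q.1 q.2.1 ∧ G.Adj q.2.1 q.2.2.1 ∧ G.Adj q.2.2.1 q.2.2.2.1 ∧ G.Adj q.2.2.2.1 q.1 ∧
          q.1 ≠ q.2.2.1 ∧ q.2.1 ≠ q.2.2.2.1 ∧ G.Adj q.1 q.2.2.2.2) ∧
        ({q.1, q.2.1, q.2.2.1, q.2.2.2.1, q.2.2.2.2} : Finset V) ⊆ S)).card <
      (((Finset.univ : Finset (V × V)).filter (fun q => G.Adj q.1 q.2 ∧
        ({q.1, q.2} : Finset V) ⊆ S)).card : ℝ)) : Goal G k := by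
  set Q := (Finset.univ : Finset (V × V × V × V × V)).filter (fun q =>
        (G.Adj q.1 q.2.1 ∧ G.Adj q.2.1 q.2.2.1 ∧ G.Adj q.2.2.1 q.2.2.2.1 ∧ G.Adj q.2.2.2.1 q.1 ∧
          q.1 ≠ q.2.2.1 ∧ q.2.1 ≠ q.2.2.2.1 ∧ G.Adj q.1 q.2.2.2.2) ∧
        ({q.1, q.2.1, q.2.2.1, q.2.2.2.1, q.2.2.2.2} : Finset V) ⊆ S) with hQ
  set E := (Finset.univ : Finset (V × V)).filter (fun q => G.Adj q.1 q.2 ∧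
        ({q.1, q.2} : Finset V) ⊆ S) with hE
  let bad : V → Prop := fun v => ∃ x ∈ S, ∃ u ∈ S, ∃ y ∈ S, G.Adj v x ∧ G.Adj x u ∧ G.Adj u y ∧
    G.Adj y v ∧ v ≠ u ∧ x ≠ y
  let S' := S.filter (fun v => ¬ bad v)
  let E' := (Finset.univ : Finset (V × V)).filter (fun q => G.Adj q.1 q.2 ∧ q.1 ∈ S' ∧ q.2 ∈ S')
  have hcov : E ⊆ E' ∪ (Q.image (fun q => (q.1, q.2.2.2.2)) ∪
      Q.image (fun q => (q.2.2.2.2, q.1))) := by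
    rintro ⟨v, z⟩ hvz
    simp only [hE, Finset.mem_filter, Finset.mem_univ, true_and, Finset.insert_subset_iff,
      Finset.singleton_subset_iff] at hvz
    obtain ⟨hadj, hv, hz⟩ := hvz
    by_cases hbv : bad v
    · apply Finset.mem_union_right
      apply Finset.mem_union_left
      obtain ⟨x, hx, u, hu, y, hy, h1, h2, h3, h4, h5, h6⟩ := hbv
      refine Finset.mem_image.2 ⟨(v, x, u, y, z), ?_, rfl⟩
      simp only [hQ, Finset.mem_filter, Finset.mem_univ, true_and, Finset.insert_subset_iff,
        Finset.singleton_subset_iff]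
      exact ⟨⟨h1, h2, h3, h4, h5, h6, hadj⟩, hv, hx, hu, hy, hz⟩
    by_cases hbz : bad z
    · apply Finset.mem_union_right
      apply Finset.mem_union_right
      obtain ⟨x, hx, u, hu, y, hy, h1, h2, h3, h4, h5, h6⟩ := hbz
      refine Finset.mem_image.2 ⟨(z, x, u, y, v), ?_, rfl⟩
      simp only [hQ, Finset.mem_filter, Finset.mem_univ, true_and, Finset.insert_subset_iff,
        Finset.singleton_subset_iff]
      exact ⟨⟨h1, h2, h3, h4, h5, h6, hadj.symm⟩, hz, hx, hu, hy, hv⟩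
    · apply Finset.mem_union_left
      simp only [E', S', Finset.mem_filter, Finset.mem_univ, true_and]
      exact ⟨hadj, ⟨hv, hbv⟩, hz, hbz⟩
  have hcard : E.card ≤ E'.card + (Q.card + Q.card) := by
    refine (Finset.card_le_card hcov).trans ((Finset.card_union_le _ _).trans ?_)
    refine Nat.add_le_add_left ((Finset.card_union_le _ _).trans ?_) _
    exact Nat.add_le_add Finset.card_image_le Finset.card_image_le
  have hE' : (E'.card : ℝ) = ∑ v ∈ S', ((S'.filter (G.Adj v)).card : ℝ) := by
    rw [Finset.card_eq_sum_card_fiberwise (f := Prod.fst) (t := S')]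
    · push_cast
      apply Finset.sum_congr rfl
      intro v hv
      rw [← Finset.card_image_of_injective (S'.filter (G.Adj v)) (Prod.mk_right_injective v)]
      congr 2
      ext ⟨a, b⟩
      simp only [E', Finset.mem_filter, Finset.mem_univ, true_and, Finset.mem_image, Prod.mk.injEq]
      constructor
      · rintro ⟨⟨h1, h2, h3⟩, rfl⟩
        exact ⟨b, ⟨h3, h1⟩, rfl, rfl⟩
      · rintro ⟨_, ⟨h1, h2⟩, rfl, rfl⟩
        exact ⟨⟨h2, hv, h1⟩, rfl⟩
    · intro q hq
      simp only [E', Finset.coe_filter, Finset.mem_univ, true_and, Set.mem_ofPred_eq] at hq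
      exact Finset.mem_coe.2 hq.2.1
  have hcard' : (E.card : ℝ) ≤ E'.card + (Q.card + Q.card) := by exact_mod_cast hcard
  have hlt : (k : ℝ) * S.card < E'.card := by linarith
  have hSS : (S'.card : ℝ) ≤ S.card := by exact_mod_cast Finset.card_filter_le _ _
  refine ⟨S', ?_, ?_, ?_⟩
  · by_contra hne
    rw [Finset.not_nonempty_iff_eq_empty] at hne
    rw [hE', hne] at hlt
    simp at hlt
    have : (0 : ℝ) ≤ k * S.card := by positivity
    linarith
  · intro a ha b hb c hc d hd h1 h2 h3 h4 h5 h6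
    simp only [S', Finset.mem_filter] at ha hb hc hd
    exact ha.2 ⟨b, hb.1, c, hc.1, d, hd.1, h1, h2, h3, h4, h5, h6⟩
  · rw [← hE']
    have : (k : ℝ) * S'.card ≤ k * S.card := mul_le_mul_of_nonneg_left hSS (by positivity)
    linarith

/-- Adjacency indicator. -/
def ind {V : Type} (G : SimpleGraph V) (u v : V) : ℝ := if G.Adj u v then 1 else 0

lemma ind_nonneg {V : Type} (G : SimpleGraph V) (u v : V) : 0 ≤ ind G u v := by
  unfold ind; split_ifs <;> norm_num

lemma ind_le_one {V : Type} (G : SimpleGraph V) (u v : V) : ind G u v ≤ 1 := by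
  unfold ind; split_ifs <;> norm_num

lemma ind_comm {V : Type} (G : SimpleGraph V) (u v : V) : ind G u v = ind G v u := by
  unfold ind; simp only [G.adj_comm]

lemma codegree_bound {V : Type} [Fintype V] (G : SimpleGraph V) (t : ℕ) (hG : KFree G t)
    (w : V → ℝ) (p W σ : ℝ) (hw0 : ∀ v, 0 ≤ w v) (hwp : ∀ v, w v ≤ p) (hp : 0 < p)
    (hW : 0 < W) (hσ0 : 0 < σ) (hσ : 2 * t * p ≤ σ)
    (hdeg : ∀ v, 0 < w v → ∑ u, ind G v u * w u ≤ W) (v : V) (hv : 0 < w v) :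
    ∑ u, w u * (∑ x, ind G v x * ind G x u * w x) ^ 2 ≤
      σ * W ^ 2 + W ^ 2 * (t * p * (2 * W / σ) ^ t) := by
  set s : V → ℝ := fun u => ∑ x, ind G v x * ind G x u * w x with hs
  have hs0 : ∀ u, 0 ≤ s u := fun u => Finset.sum_nonneg (fun x _ =>
    mul_nonneg (mul_nonneg (ind_nonneg _ _ _) (ind_nonneg _ _ _)) (hw0 x))
  have hsW : ∀ u, s u ≤ W := fun u => by
    refine le_trans (Finset.sum_le_sum (fun x _ => ?_)) (hdeg v hv)
    refine mul_le_mul_of_nonneg_right ?_ (hw0 x)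
    exact mul_le_of_le_one_right (ind_nonneg _ _ _) (ind_le_one _ _ _)
  let Z := (Finset.univ : Finset V).filter (fun u => σ ≤ s u)
  have hZ : ∑ u ∈ Z, w u ≤ t * p * (2 * W / σ) ^ t := by
    refine kst_weighted G t hG w p W σ hw0 hwp hp (Finset.univ.filter (G.Adj v)) Z ?_ hW hσ0 hσ ?_
    · refine le_trans (le_of_eq ?_) (hdeg v hv)
      rw [Finset.sum_filter]
      apply Finset.sum_congr rfl
      intro x _
      unfold ind
      split_ifs <;> simp
    · intro u hu
      have h1 : σ ≤ s u := (Finset.mem_filter.1 hu).2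
      refine h1.trans (le_of_eq ?_)
      rw [hs, Finset.sum_filter, Finset.sum_filter]
      apply Finset.sum_congr rfl
      intro x _
      unfold ind
      rw [G.adj_comm x u]
      split_ifs <;> simp
  have hlin : ∑ u, w u * s u ≤ W ^ 2 := by
    have h1 : ∑ u, w u * s u = ∑ x, ind G v x * w x * ∑ u, ind G x u * w u := by
      simp only [hs, Finset.mul_sum]
      rw [Finset.sum_comm]
      refine Finset.sum_congr rfl (fun x _ => Finset.sum_congr rfl (fun u _ => by ring))
    rw [h1]
    calc _ ≤ ∑ x, ind G v x * w x * W := by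
          apply Finset.sum_le_sum
          intro x _
          rcases (hw0 x).eq_or_lt with h | h
          · rw [← h]; simp
          · exact mul_le_mul_of_nonneg_left (hdeg x h) (mul_nonneg (ind_nonneg _ _ _) (hw0 x))
      _ = (∑ x, ind G v x * w x) * W := by rw [Finset.sum_mul]
      _ ≤ W * W := mul_le_mul_of_nonneg_right (hdeg v hv) hW.le
      _ = W ^ 2 := by ring
  have hpt : ∀ u, w u * s u ^ 2 ≤ σ * (w u * s u) + (if σ ≤ s u then W ^ 2 * w u else 0) := by
    intro u
    have hpos := mul_nonneg (hw0 u) (hs0 u)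
    split_ifs with h
    · have h1 : s u ^ 2 ≤ W ^ 2 := pow_le_pow_left₀ (hs0 u) (hsW u) 2
      have h2 := mul_le_mul_of_nonneg_left h1 (hw0 u)
      nlinarith [mul_nonneg hσ0.le hpos]
    · push Not at h
      have := mul_le_mul_of_nonneg_left h.le hpos
      nlinarith
  calc _ ≤ ∑ u, (σ * (w u * s u) + (if σ ≤ s u then W ^ 2 * w u else 0)) :=
        Finset.sum_le_sum (fun u _ => hpt u)
    _ = σ * ∑ u, w u * s u + W ^ 2 * ∑ u ∈ Z, w u := by
        rw [Finset.sum_add_distrib, ← Finset.mul_sum, ← Finset.sum_filter, ← Finset.mul_sum]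
    _ ≤ _ := add_le_add (mul_le_mul_of_nonneg_left hlin hσ0.le)
        (mul_le_mul_of_nonneg_left hZ (by positivity))

set_option maxHeartbeats 1600000 in
lemma sampling {V : Type} [Fintype V] (G : SimpleGraph V) (t k : ℕ) (hG : KFree G t)
    (w : V → ℝ) (p W σ : ℝ) (hw0 : ∀ v, 0 ≤ w v) (hwp : ∀ v, w v ≤ p) (hp : 0 < p) (hp1 : p ≤ 1)
    (hW : 0 < W) (hσ0 : 0 < σ) (hσ : 2 * t * p ≤ σ)
    (hdeg : ∀ v, 0 < w v → ∑ u, ind G v u * w u ≤ W)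
    (hmain : k * ∑ v, w v + 2 * ((W + 3) * (σ * W ^ 2 + W ^ 2 * (t * p * (2 * W / σ) ^ t))) * ∑ v, w v
      < ∑ u, ∑ v, ind G u v * w u * w v) : Goal G k := by
  set Γ := σ * W ^ 2 + W ^ 2 * (t * p * (2 * W / σ) ^ t) with hΓ
  have hw1 : ∀ v, w v ≤ 1 := fun v => (hwp v).trans hp1
  set Q : Finset (V × V × V × V × V) := Finset.univ.filter (fun q =>
        (G.Adj q.1 q.2.1 ∧ G.Adj q.2.1 q.2.2.1 ∧ G.Adj q.2.2.1 q.2.2.2.1 ∧ G.Adj q.2.2.2.1 q.1 ∧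
          q.1 ≠ q.2.2.1 ∧ q.2.1 ≠ q.2.2.2.1 ∧ G.Adj q.1 q.2.2.2.2)) with hQ
  set E : Finset (V × V) := Finset.univ.filter (fun q => G.Adj q.1 q.2) with hE
  let TQ : V × V × V × V × V → Finset V := fun q => {q.1, q.2.1, q.2.2.1, q.2.2.2.1, q.2.2.2.2}
  let TE : V × V → Finset V := fun q => {q.1, q.2}
  -- expectation of the cycles
  have hQsum : ∑ q ∈ Q, ∏ v ∈ TQ q, w v ≤ (W + 3) * Γ * ∑ v, w v := by
    have h1 : ∑ q ∈ Q, ∏ v ∈ TQ q, w v ≤ ∑ v, ∑ x, ∑ u, ∑ y, ∑ z,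
        (ind G v x * ind G x u * ind G u y * ind G y v * (w v * w x * w u * w y)) *
          (ind G v z * w z + (if z = x then 1 else 0) + (if z = u then 1 else 0) +
            (if z = y then 1 else 0)) := by
      rw [hQ, Finset.sum_filter]
      simp only [← Finset.univ_product_univ, Finset.sum_product]
      refine Finset.sum_le_sum fun v _ => Finset.sum_le_sum fun x _ => Finset.sum_le_sum fun u _ =>
        Finset.sum_le_sum fun y _ => Finset.sum_le_sum fun z _ => ?_
      have hB : 0 ≤ ind G v z * w z + (if z = x then (1:ℝ) else 0) + (if z = u then 1 else 0) +
            (if z = y then 1 else 0) := by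
        have := mul_nonneg (ind_nonneg G v z) (hw0 z)
        split_ifs <;> linarith
      have hA : 0 ≤ w v * w x * w u * w y :=
        mul_nonneg (mul_nonneg (mul_nonneg (hw0 v) (hw0 x)) (hw0 u)) (hw0 y)
      have hI : 0 ≤ ind G v x * ind G x u * ind G u y * ind G y v :=
        mul_nonneg (mul_nonneg (mul_nonneg (ind_nonneg _ _ _) (ind_nonneg _ _ _)) (ind_nonneg _ _ _))
          (ind_nonneg _ _ _)
      by_cases hc : G.Adj v x ∧ G.Adj x u ∧ G.Adj u y ∧ G.Adj y v ∧ v ≠ u ∧ x ≠ y ∧ G.Adj v z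
      · rw [if_pos hc]
        obtain ⟨c1, c2, c3, c4, c5, c6, c7⟩ := hc
        have e1 := c1.ne
        have e2 := c2.ne
        have e3 := c3.ne
        have e4 := c4.ne
        have e5 := c7.ne
        have hI1 : ind G v x * ind G x u * ind G u y * ind G y v = 1 := by
          unfold ind; simp [c1, c2, c3, c4]
        have hz1 : ind G v z = 1 := by unfold ind; simp [c7]
        rw [hI1, hz1, one_mul, one_mul]
        have h4 : ∏ a ∈ ({v, x, u, y} : Finset V), w a = w v * w x * w u * w y := by
          rw [Finset.prod_insert, Finset.prod_insert, Finset.prod_insert, Finset.prod_singleton]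
          · ring
          · simpa using e3
          · simp only [Finset.mem_insert, Finset.mem_singleton, not_or]; exact ⟨e2, c6⟩
          · simp only [Finset.mem_insert, Finset.mem_singleton, not_or]
            exact ⟨e1, c5, e4.symm⟩
        by_cases hz : z = x ∨ z = u ∨ z = y
        · have hT : TQ (v, x, u, y, z) = {v, x, u, y} := by
            ext a
            simp only [TQ, Finset.mem_insert, Finset.mem_singleton]
            constructor
            · rintro (h | h | h | h | h)
              · exact Or.inl h
              · exact Or.inr (Or.inl h)
              · exact Or.inr (Or.inr (Or.inl h))
              · exact Or.inr (Or.inr (Or.inr h))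
              · rcases hz with h' | h' | h'
                · exact Or.inr (Or.inl (h.trans h'))
                · exact Or.inr (Or.inr (Or.inl (h.trans h')))
                · exact Or.inr (Or.inr (Or.inr (h.trans h')))
            · rintro (h | h | h | h)
              · exact Or.inl h
              · exact Or.inr (Or.inl h)
              · exact Or.inr (Or.inr (Or.inl h))
              · exact Or.inr (Or.inr (Or.inr (Or.inl h)))
          rw [hT, h4]
          have hge : (1:ℝ) ≤ w z + (if z = x then (1:ℝ) else 0) + (if z = u then 1 else 0) +
            (if z = y then 1 else 0) := by
            have := hw0 z
            rcases hz with h | h | h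
            · rw [if_pos h]; split_ifs <;> linarith
            · rw [if_pos h]; split_ifs <;> linarith
            · rw [if_pos h]; split_ifs <;> linarith
          exact le_mul_of_one_le_right hA hge
        · push Not at hz
          have hT : TQ (v, x, u, y, z) = insert z {v, x, u, y} := by
            ext a
            simp only [TQ, Finset.mem_insert, Finset.mem_singleton]
            constructor
            · rintro (h | h | h | h | h)
              · exact Or.inr (Or.inl h)
              · exact Or.inr (Or.inr (Or.inl h))
              · exact Or.inr (Or.inr (Or.inr (Or.inl h)))
              · exact Or.inr (Or.inr (Or.inr (Or.inr h)))
              · exact Or.inl h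
            · rintro (h | h | h | h | h)
              · exact Or.inr (Or.inr (Or.inr (Or.inr h)))
              · exact Or.inl h
              · exact Or.inr (Or.inl h)
              · exact Or.inr (Or.inr (Or.inl h))
              · exact Or.inr (Or.inr (Or.inr (Or.inl h)))
          rw [hT, Finset.prod_insert, h4, if_neg hz.1, if_neg hz.2.1, if_neg hz.2.2]
          · apply le_of_eq; ring
          · simp only [Finset.mem_insert, Finset.mem_singleton, not_or]
            exact ⟨e5.symm, hz.1, hz.2.1, hz.2.2⟩
      · rw [if_neg hc]
        exact mul_nonneg (mul_nonneg hI hA) hB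
    have h2 : ∀ v, ∑ x, ∑ u, ∑ y, ∑ z,
        (ind G v x * ind G x u * ind G u y * ind G y v * (w v * w x * w u * w y)) *
          (ind G v z * w z + (if z = x then 1 else 0) + (if z = u then 1 else 0) +
            (if z = y then 1 else 0)) ≤ (W + 3) * Γ * w v := by
      intro v
      rcases (hw0 v).eq_or_lt with h0 | h0
      · simp [← h0]
      have h3 : ∀ x u y, ∑ z, (ind G v x * ind G x u * ind G u y * ind G y v *
          (w v * w x * w u * w y)) * (ind G v z * w z + (if z = x then (1:ℝ) else 0) +
          (if z = u then 1 else 0) + (if z = y then 1 else 0)) ≤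
          (ind G v x * ind G x u * ind G u y * ind G y v * (w v * w x * w u * w y)) * (W + 3) := by
        intro x u y
        rw [← Finset.mul_sum]
        apply mul_le_mul_of_nonneg_left
        · rw [Finset.sum_add_distrib, Finset.sum_add_distrib, Finset.sum_add_distrib]
          simp only [Finset.sum_ite_eq', Finset.mem_univ, if_true]
          linarith [hdeg v h0]
        · exact mul_nonneg (mul_nonneg (mul_nonneg (mul_nonneg (ind_nonneg _ _ _) (ind_nonneg _ _ _))
            (ind_nonneg _ _ _)) (ind_nonneg _ _ _))
            (mul_nonneg (mul_nonneg (mul_nonneg (hw0 v) (hw0 x)) (hw0 u)) (hw0 y))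
      calc _ ≤ ∑ x, ∑ u, ∑ y, (ind G v x * ind G x u * ind G u y * ind G y v *
            (w v * w x * w u * w y)) * (W + 3) :=
            Finset.sum_le_sum fun x _ => Finset.sum_le_sum fun u _ => Finset.sum_le_sum fun y _ =>
              h3 x u y
        _ = (W + 3) * w v * ∑ u, w u * (∑ x, ind G v x * ind G x u * w x) ^ 2 := by
            rw [Finset.sum_comm, Finset.mul_sum]
            apply Finset.sum_congr rfl
            intro u _
            rw [sq, Finset.sum_mul_sum, Finset.mul_sum, Finset.mul_sum]
            apply Finset.sum_congr rfl
            intro x _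
            rw [Finset.mul_sum, Finset.mul_sum]
            apply Finset.sum_congr rfl
            intro y _
            rw [ind_comm G u y, ind_comm G y v]
            ring
        _ ≤ (W + 3) * w v * Γ := by
            apply mul_le_mul_of_nonneg_left _ (by positivity)
            exact codegree_bound G t hG w p W σ hw0 hwp hp hW hσ0 hσ hdeg v h0
        _ = _ := by ring
    refine h1.trans ((Finset.sum_le_sum fun v _ => h2 v).trans (le_of_eq ?_))
    rw [Finset.mul_sum]
  have hEsum : ∑ q ∈ E, ∏ v ∈ TE q, w v = ∑ u, ∑ v, ind G u v * w u * w v := by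
    rw [hE, Finset.sum_filter]
    simp only [← Finset.univ_product_univ, Finset.sum_product]
    refine Finset.sum_congr rfl fun u _ => Finset.sum_congr rfl fun v _ => ?_
    unfold ind
    split_ifs with h
    · simp only [TE]
      rw [Finset.prod_pair h.ne]; ring
    · simp
  have hSsum : ∑ S : Finset V, mu w S * (S.card : ℝ) = ∑ v, w v := by
    have := mu_sum_family w (Finset.univ : Finset V) (fun v => {v})
    simpa using this
  have hmu : ∀ S, 0 ≤ mu w S := fun S =>
    mul_nonneg (Finset.prod_nonneg fun v _ => hw0 v)
      (Finset.prod_nonneg fun v _ => by linarith [hw1 v])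
  have hex : ∃ S : Finset V, (k : ℝ) * S.card + 2 * ((Q.filter (fun q => TQ q ⊆ S)).card : ℝ) <
      ((E.filter (fun q => TE q ⊆ S)).card : ℝ) := by
    by_contra hcon
    push Not at hcon
    have h1 : ∑ S : Finset V, mu w S * ((E.filter (fun q => TE q ⊆ S)).card : ℝ) ≤
        ∑ S : Finset V, (k * (mu w S * S.card) +
          2 * (mu w S * ((Q.filter (fun q => TQ q ⊆ S)).card : ℝ))) := by
      apply Finset.sum_le_sum
      intro S _
      have := mul_le_mul_of_nonneg_left (hcon S) (hmu S)
      linarith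
    rw [Finset.sum_add_distrib, ← Finset.mul_sum, ← Finset.mul_sum, hSsum,
      mu_sum_family w Q TQ, mu_sum_family w E TE, hEsum] at h1
    linarith
  obtain ⟨S, hS⟩ := hex
  apply deletion G k S
  rw [hQ, hE, Finset.filter_filter, Finset.filter_filter] at hS
  convert hS using 3

/-! ### The very unbalanced case -/

lemma bernoulli_nat (Q r m : ℕ) (hQ : 0 < Q) (h : 2 * r * m ≤ Q) : Q ^ m ≤ 2 * (Q - r) ^ m := by
  rcases Nat.eq_zero_or_pos m with rfl | hm
  · simp
  have hrQ : r ≤ Q := by nlinarith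
  have hQ' : (0 : ℝ) < Q := by exact_mod_cast hQ
  have h' : (2 : ℝ) * r * m ≤ Q := by exact_mod_cast h
  have hr' : (r : ℝ) ≤ Q := by exact_mod_cast hrQ
  have h1 : (1 : ℝ) + m * (-(r / Q)) ≤ (1 + -((r : ℝ) / Q)) ^ m := by
    apply one_add_mul_le_pow
    have : (r : ℝ) / Q ≤ 1 := by rw [div_le_one hQ']; exact hr'
    linarith
  have h2 : (1 : ℝ) / 2 ≤ 1 + m * (-(r / Q)) := by
    have : (m : ℝ) * (r / Q) ≤ 1 / 2 := by
      rw [← mul_div_assoc, div_le_div_iff₀ hQ' (by norm_num)]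
      linarith
    linarith
  have h3 : (Q : ℝ) ^ m * (1 + -((r : ℝ) / Q)) ^ m = ((Q : ℝ) - r) ^ m := by
    rw [← mul_pow]; congr 1; field_simp; ring
  have h4 : (Q : ℝ) ^ m ≤ 2 * ((Q : ℝ) - r) ^ m := by
    rw [← h3]
    have : (0 : ℝ) < (Q : ℝ) ^ m := by positivity
    nlinarith
  have h5 : ((Q - r : ℕ) : ℝ) = (Q : ℝ) - r := Nat.cast_sub hrQ
  rw [← h5] at h4
  exact_mod_cast h4

lemma good_colorings {V : Type} [Fintype V] (Q r m : ℕ) (hQ : 0 < Q) (hrQ : r ≤ Q)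
    (h : 2 * r * m ≤ Q) (e : Fin r → V) (he : Function.Injective e) (U : Finset V)
    (hU : U.card ≤ m) (hdis : ∀ j, e j ∉ U) :
    Q ^ Fintype.card V ≤ (2 * Q ^ r) * (Finset.univ.filter (fun f : V → Fin Q =>
      (∀ j, (f (e j)).val = j.val) ∧ ∀ u ∈ U, r ≤ (f u).val)).card := by
  let F : V → Finset (Fin Q) := fun v =>
    if v ∈ U then Finset.univ.filter (fun c => r ≤ c.val) else
      Finset.univ.filter (fun c => ∀ j, e j = v → c.val = j.val)
  have hF : Fintype.piFinset F ⊆ Finset.univ.filter (fun f : V → Fin Q =>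
      (∀ j, (f (e j)).val = j.val) ∧ ∀ u ∈ U, r ≤ (f u).val) := by
    intro f hf
    rw [Fintype.mem_piFinset] at hf
    simp only [Finset.mem_filter, Finset.mem_univ, true_and]
    constructor
    · intro j
      have := hf (e j)
      simp only [F, hdis j, if_false, Finset.mem_filter, Finset.mem_univ, true_and] at this
      exact this j rfl
    · intro u hu
      have := hf u
      simpa only [F, hu, if_true, Finset.mem_filter, Finset.mem_univ, true_and] using this
  refine le_trans ?_ (Nat.mul_le_mul_left _ (Finset.card_le_card hF))
  rw [Fintype.card_piFinset]
  have hc1 : ∀ v ∈ U, (F v).card = Q - r := by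
    intro v hv
    simp only [F, hv, if_true]
    have h1 : (Finset.univ.filter (fun c : Fin Q => r ≤ c.val)) =
        Finset.univ \ Finset.univ.image (Fin.castLE hrQ) := by
      ext c
      simp only [Finset.mem_filter, Finset.mem_univ, true_and, Finset.mem_sdiff, Finset.mem_image,
        not_exists]
      constructor
      · intro hc x hx
        rw [← hx] at hc
        simp at hc
        omega
      · intro hc
        by_contra hlt
        push Not at hlt
        exact hc ⟨c.val, hlt⟩ (by ext; simp)
    rw [h1, Finset.card_sdiff_of_subset (Finset.subset_univ _),
      Finset.card_image_of_injective _ (Fin.castLE_injective hrQ)]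
    simp
  have hc2 : ∀ v, v ∉ U → v ∉ Finset.univ.image e → (F v).card = Q := by
    intro v hv hv'
    simp only [F, hv, if_false]
    rw [Finset.filter_true_of_mem]
    · simp
    · intro c _ j hj
      exact absurd (Finset.mem_image.2 ⟨j, Finset.mem_univ _, hj⟩) hv'
  have hc3 : ∀ v ∈ Finset.univ.image e, 1 ≤ (F v).card := by
    intro v hv
    obtain ⟨j, _, rfl⟩ := Finset.mem_image.1 hv
    simp only [F, hdis j, if_false]
    apply Finset.card_pos.2
    refine ⟨Fin.castLE hrQ j, ?_⟩
    simp only [Finset.mem_filter, Finset.mem_univ, true_and]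
    intro j' hj'
    rw [he hj']; simp
  set I := Finset.univ.image e with hI
  have hIc : I.card = r := by rw [hI, Finset.card_image_of_injective _ he]; simp
  have hIU : Disjoint I U := by
    rw [Finset.disjoint_left]
    intro v hv
    obtain ⟨j, _, rfl⟩ := Finset.mem_image.1 hv
    exact hdis j
  set R := Finset.univ \ (I ∪ U) with hR
  have hsplit : ∀ g : V → ℕ, ∏ v, g v = (∏ v ∈ I, g v) * (∏ v ∈ U, g v) * ∏ v ∈ R, g v := by
    intro g
    rw [← Finset.prod_union hIU, hR, mul_comm, Finset.prod_sdiff (Finset.subset_univ _)]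
  have hpow : Q ^ Fintype.card V = Q ^ r * Q ^ U.card * Q ^ R.card := by
    have := hsplit (fun _ => Q)
    simpa [hIc, Finset.prod_const] using this
  rw [hpow, hsplit (fun v => (F v).card)]
  have p1 : 1 ≤ ∏ v ∈ I, (F v).card := Finset.one_le_prod' hc3
  have p2 : ∏ v ∈ U, (F v).card = (Q - r) ^ U.card := by
    rw [Finset.prod_congr rfl hc1, Finset.prod_const]
  have p3 : ∏ v ∈ R, (F v).card = Q ^ R.card := by
    rw [Finset.prod_congr rfl (fun v hv => ?_), Finset.prod_const]
    simp only [hR, Finset.mem_sdiff, Finset.mem_union, not_or] at hv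
    exact hc2 v hv.2.2 hv.2.1
  rw [p2, p3]
  have hb := bernoulli_nat Q r U.card hQ (le_trans (Nat.mul_le_mul_left _ hU) h)
  calc Q ^ r * Q ^ U.card * Q ^ R.card ≤ Q ^ r * (2 * (Q - r) ^ U.card) * Q ^ R.card := by gcongr
    _ = 2 * Q ^ r * (1 * (Q - r) ^ U.card * Q ^ R.card) := by ring
    _ ≤ _ := by gcongr

lemma super {V : Type} [Fintype V] (G : SimpleGraph V) (k t : ℕ) (hk : 2 ≤ k) (ht : 1 ≤ t)
    (hG : KFree G t) (r : ℕ) (hr : r = k ^ (t - 1)) (D D' Q : ℕ) (out : V → Finset V)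
    (hout : ∀ v, (out v).card ≤ D')
    (hor : ∀ u v, G.Adj u v → u ∈ out v ∨ v ∈ out u)
    (A B : Finset V) (hAB : Disjoint A B)
    (hdegA : ∀ a ∈ A, (Finset.univ.filter (G.Adj a)).card < D)
    (hAdeg : ∀ a ∈ A, r ^ (2 * t) ≤ (B.filter (G.Adj a)).card)
    (hQ0 : 0 < Q) (hrQ : r ≤ Q) (hQ : 2 * r * (D + r * D') ≤ Q)
    (hbig : B.card * (k + t) ^ ((r + 1) ^ t) * (2 * Q ^ r * D) < A.card) : Goal G k := by
  have hr1 : 1 ≤ r := by rw [hr]; exact Nat.one_le_pow _ _ (by omega)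
  have hex : ∀ a, ∃ e : Fin r → V, a ∈ A → (Function.Injective e ∧ (∀ i, e i ∈ B) ∧
      (∀ i, G.Adj a (e i)) ∧ ∀ i j, ¬ G.Adj (e i) (e j)) := by
    intro a
    by_cases ha : a ∈ A
    · obtain ⟨I, hI, hIc, hind⟩ := KFree.indep hG r hr1 (B.filter (G.Adj a)) (hAdeg a ha)
      let φ := (Finset.equivFinOfCardEq hIc).symm
      refine ⟨fun i => (φ i : V), fun _ => ⟨?_, ?_, ?_, ?_⟩⟩
      · exact Subtype.val_injective.comp φ.injective
      · intro i; exact (Finset.mem_filter.1 (hI (φ i).2)).1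
      · intro i; exact (Finset.mem_filter.1 (hI (φ i).2)).2
      · intro i j; exact hind _ (φ i).2 _ (φ j).2
    · exact ⟨fun _ => a, fun h => absurd h ha⟩
  choose e he using hex
  let U : V → Finset V := fun a =>
    (B.filter (G.Adj a) ∪ Finset.univ.biUnion (fun j => out (e a j))) \ Finset.univ.image (e a)
  have hUc : ∀ a ∈ A, (U a).card ≤ D + r * D' := by
    intro a ha
    refine (Finset.card_le_card Finset.sdiff_subset).trans ((Finset.card_union_le _ _).trans ?_)
    apply Nat.add_le_add
    · exact (Finset.card_le_card (Finset.filter_subset_filter _ (Finset.subset_univ _))).trans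
        (hdegA a ha).le
    · refine Finset.card_biUnion_le.trans ?_
      calc _ ≤ ∑ _j : Fin r, D' := Finset.sum_le_sum (fun j _ => hout _)
        _ = r * D' := by simp
  let good : V → (V → Fin Q) → Prop := fun a f =>
    (∀ j, (f (e a j)).val = j.val) ∧ ∀ u ∈ U a, r ≤ (f u).val
  have hgood : ∀ a ∈ A, Q ^ Fintype.card V ≤ (2 * Q ^ r) * (Finset.univ.filter (good a)).card := by
    intro a ha
    exact good_colorings Q r (D + r * D') hQ0 hrQ hQ (e a) (he a ha).1 (U a) (hUc a ha)
      (fun j hj => (Finset.mem_sdiff.1 hj).2 (Finset.mem_image_of_mem _ (Finset.mem_univ _)))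
  -- pick a good colouring
  have hf : ∃ f : V → Fin Q, A.card ≤ (2 * Q ^ r) * (A.filter (fun a => good a f)).card := by
    by_contra hcon
    push Not at hcon
    have h1 : ∑ f : V → Fin Q, (2 * Q ^ r) * (A.filter (fun a => good a f)).card <
        ∑ _f : V → Fin Q, A.card := by
      apply Finset.sum_lt_sum_of_nonempty
      · exact ⟨fun _ => ⟨0, hQ0⟩, Finset.mem_univ _⟩
      · intro f _; exact hcon f
    have h2 : ∑ _f : V → Fin Q, A.card = A.card * Q ^ Fintype.card V := by
      simp [mul_comm]
    have h3 : ∑ f : V → Fin Q, (A.filter (fun a => good a f)).card =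
        ∑ a ∈ A, (Finset.univ.filter (good a)).card := by
      simp only [Finset.card_filter]
      rw [Finset.sum_comm]
    rw [← Finset.mul_sum, h3, h2, Finset.mul_sum] at h1
    have h4 : A.card * Q ^ Fintype.card V ≤
        ∑ a ∈ A, (2 * Q ^ r) * (Finset.univ.filter (good a)).card := by
      rw [← smul_eq_mul, ← Finset.sum_const]
      exact Finset.sum_le_sum hgood
    omega
  obtain ⟨f, hf⟩ := hf
  set A2 := A.filter (fun a => good a f) with hA2
  obtain ⟨A3, hA32, hind3, hA3c⟩ := exists_indep G.Adj (fun _ _ h => h.symm) A2 D (by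
    intro v hv
    refine lt_of_le_of_lt ?_ (hdegA v (Finset.mem_filter.1 hv).1)
    exact Finset.card_le_card (Finset.filter_subset_filter _ (Finset.subset_univ _)))
  have hA3A : ∀ a ∈ A3, a ∈ A := fun a ha => (Finset.mem_filter.1 (hA32 ha)).1
  have hA3g : ∀ a ∈ A3, good a f := fun a ha => (Finset.mem_filter.1 (hA32 ha)).2
  have hA3big : B.card * (k + t) ^ ((r + 1) ^ t) < A3.card := by
    by_contra hcon
    push Not at hcon
    have : A.card ≤ B.card * (k + t) ^ ((r + 1) ^ t) * (2 * Q ^ r * D) := by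
      calc A.card ≤ (2 * Q ^ r) * A2.card := hf
        _ ≤ (2 * Q ^ r) * (A3.card * D) := Nat.mul_le_mul_left _ hA3c
        _ = A3.card * (2 * Q ^ r * D) := by ring
        _ ≤ _ := Nat.mul_le_mul_right _ hcon
    omega
  obtain ⟨A', hA', hA'ne, P, hPc, hlin, hsum⟩ := hyper k t (by omega) ht r hr e A3 B.card (by
    intro X hX I hI hagree
    by_contra hcon
    push Not at hcon
    obtain ⟨Y, hY, hYc⟩ := Finset.exists_subset_card_eq hcon
    have hYne : Y.Nonempty := by rw [← Finset.card_pos]; omega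
    obtain ⟨a0, ha0⟩ := hYne
    have ha0A := he a0 (hA3A a0 (hX (hY ha0)))
    refine hG Y (I.image (e a0)) hYc (by rw [Finset.card_image_of_injective _ ha0A.1, hI]) ?_
    intro a ha b hb
    obtain ⟨i, hi, rfl⟩ := Finset.mem_image.1 hb
    rw [hagree a0 (hY ha0) a (hY ha) i hi]
    exact (he a (hA3A a (hX (hY ha)))).2.2.1 i) (by
    intro i
    apply Finset.card_le_card
    intro v hv
    obtain ⟨a, ha, rfl⟩ := Finset.mem_image.1 hv
    exact (he a (hA3A a ha)).2.1 i) hA3big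
  have hA'A : ∀ a ∈ A', a ∈ A := fun a ha => hA3A a (hA' ha)
  have hA'g : ∀ a ∈ A', good a f := fun a ha => hA3g a (hA' ha)
  set B' := P.biUnion (fun i => A'.image (fun a => e a i)) with hB'
  have hB'mem : ∀ v, v ∈ B' ↔ ∃ i ∈ P, ∃ a ∈ A', e a i = v := by
    intro v; simp [hB']
  have hB'B : ∀ v ∈ B', v ∈ B := by
    intro v hv
    obtain ⟨i, hi, a, ha, rfl⟩ := (hB'mem v).1 hv
    exact (he a (hA'A a ha)).2.1 i
  have hdis : Disjoint A' B' := by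
    rw [Finset.disjoint_left]
    intro v h1 h2
    exact Finset.disjoint_left.1 hAB (hA'A v h1) (hB'B v h2)
  have hB'c : B'.card ≤ A'.card := Finset.card_biUnion_le.trans hsum
  -- the only edges between the two parts are the chosen ones
  have F1 : ∀ a ∈ A', ∀ v ∈ B', G.Adj a v → ∃ i ∈ P, e a i = v := by
    intro a ha v hv hadj
    have hvB := hB'B v hv
    obtain ⟨i, hi, a', ha', hvi⟩ := (hB'mem v).1 hv
    have hfv : (f v).val = i.val := by rw [← hvi]; exact (hA'g a' ha').1 i
    by_cases him : v ∈ Finset.univ.image (e a)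
    · obtain ⟨j, _, hj⟩ := Finset.mem_image.1 him
      have hfj : (f v).val = j.val := by rw [← hj]; exact (hA'g a ha).1 j
      have : i = j := by ext; omega
      exact ⟨i, hi, by rw [this, hj]⟩
    · exfalso
      have : v ∈ U a := Finset.mem_sdiff.2 ⟨Finset.mem_union_left _
        (Finset.mem_filter.2 ⟨hvB, hadj⟩), him⟩
      have := (hA'g a ha).2 v this
      have := i.isLt
      omega
  have F2' : ∀ u ∈ B', ∀ v ∈ B', G.Adj u v → v ∉ out u := by
    intro u hu v hv hadj hvo
    obtain ⟨i, hi, a, ha, hui⟩ := (hB'mem u).1 hu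
    obtain ⟨j, hj, a', ha', hvj⟩ := (hB'mem v).1 hv
    have hfv : (f v).val = j.val := by rw [← hvj]; exact (hA'g a' ha').1 j
    by_cases him : v ∈ Finset.univ.image (e a)
    · obtain ⟨j', _, hj'⟩ := Finset.mem_image.1 him
      rw [← hui, ← hj'] at hadj
      exact (he a (hA'A a ha)).2.2.2 _ _ hadj
    · have : v ∈ U a := Finset.mem_sdiff.2 ⟨Finset.mem_union_right _
        (Finset.mem_biUnion.2 ⟨i, Finset.mem_univ _, by rw [hui]; exact hvo⟩), him⟩
      have := (hA'g a ha).2 v this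
      have := j.isLt
      omega
  have F2 : ∀ u ∈ B', ∀ v ∈ B', ¬ G.Adj u v := by
    intro u hu v hv hadj
    rcases hor u v hadj with h | h
    · exact F2' v hv u hu hadj.symm h
    · exact F2' u hu v hv hadj h
  have F3 : ∀ u ∈ A', ∀ v ∈ A', ¬ G.Adj u v := by
    intro u hu v hv hadj
    exact hind3 u (hA' hu) v (hA' hv) hadj.ne hadj
  have F4 : ∀ a ∈ A', ∀ c ∈ A', ∀ b ∈ B', ∀ d ∈ B', G.Adj a b → G.Adj c b → G.Adj a d →
      G.Adj c d → a ≠ c → b = d := by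
    intro a ha c hc b hb d hd h1 h2 h3 h4 hac
    obtain ⟨i, hi, hai⟩ := F1 a ha b hb h1
    obtain ⟨i', hi', hci⟩ := F1 c hc b hb h2
    obtain ⟨j, hj, haj⟩ := F1 a ha d hd h3
    obtain ⟨j', hj', hcj⟩ := F1 c hc d hd h4
    have e1 : i = i' := by
      have x1 := (hA'g a ha).1 i
      have x2 := (hA'g c hc).1 i'
      rw [hai] at x1
      rw [hci] at x2
      ext; omega
    have e2 : j = j' := by
      have x1 := (hA'g a ha).1 j
      have x2 := (hA'g c hc).1 j'
      rw [haj] at x1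
      rw [hcj] at x2
      ext; omega
    subst e1 e2
    by_contra hbd
    have hij : i ≠ j := by
      intro h; apply hbd; rw [← hai, ← haj, h]
    exact hac (hlin a ha c hc i hi j hj hij (hai.trans hci.symm) (haj.trans hcj.symm))
  refine ⟨A' ∪ B', hA'ne.mono Finset.subset_union_left, ?_, ?_⟩
  · intro a ha b hb c hc d hd h1 h2 h3 h4 hac hbd
    rw [Finset.mem_union] at ha hb hc hd
    rcases ha with ha | ha
    · have hb' : b ∈ B' := hb.resolve_left (fun h => F3 a ha b h h1)
      have hd' : d ∈ B' := hd.resolve_left (fun h => F3 d h a ha h4)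
      have hc' : c ∈ A' := hc.resolve_right (fun h => F2 b hb' c h h2)
      exact hbd (F4 a ha c hc' b hb' d hd' h1 h2.symm h4.symm h3 hac)
    · have hb' : b ∈ A' := hb.resolve_right (fun h => F2 a ha b h h1)
      have hd' : d ∈ A' := hd.resolve_right (fun h => F2 d h a ha h4)
      have hc' : c ∈ B' := hc.resolve_left (fun h => F3 b hb' c h h2)
      exact hac (F4 b hb' d hd' a ha c hc' h1.symm h4 h2 h3.symm hbd)
  · have hda : ∀ a ∈ A', k ≤ (B'.filter (G.Adj a)).card := by
      intro a ha
      have h1 : (P.image (e a)) ⊆ B'.filter (G.Adj a) := by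
        intro v hv
        obtain ⟨i, hi, rfl⟩ := Finset.mem_image.1 hv
        exact Finset.mem_filter.2 ⟨(hB'mem _).2 ⟨i, hi, a, ha, rfl⟩, (he a (hA'A a ha)).2.2.1 i⟩
      have h2 := Finset.card_le_card h1
      rwa [Finset.card_image_of_injective _ (he a (hA'A a ha)).1, hPc] at h2
    have hs1 : k * A'.card ≤ ∑ a ∈ A', (B'.filter (G.Adj a)).card := by
      rw [mul_comm, ← smul_eq_mul, ← Finset.sum_const]
      exact Finset.sum_le_sum hda
    have hs2 : ∑ v ∈ B', (A'.filter (G.Adj v)).card = ∑ a ∈ A', (B'.filter (G.Adj a)).card := by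
      simp only [Finset.card_filter]
      rw [Finset.sum_comm]
      simp only [G.adj_comm]
    have hs3 : ∑ a ∈ A', (B'.filter (G.Adj a)).card ≤
        ∑ a ∈ A', ((A' ∪ B').filter (G.Adj a)).card :=
      Finset.sum_le_sum fun a _ => Finset.card_le_card
        (Finset.filter_subset_filter _ Finset.subset_union_right)
    have hs4 : ∑ a ∈ B', (A'.filter (G.Adj a)).card ≤
        ∑ a ∈ B', ((A' ∪ B').filter (G.Adj a)).card :=
      Finset.sum_le_sum fun a _ => Finset.card_le_card
        (Finset.filter_subset_filter _ Finset.subset_union_left)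
    have hfin : k * (A' ∪ B').card ≤ ∑ v ∈ A' ∪ B', ((A' ∪ B').filter (G.Adj v)).card := by
      rw [Finset.sum_union hdis, Finset.card_union_of_disjoint hdis]
      have : k * B'.card ≤ k * A'.card := Nat.mul_le_mul_left _ hB'c
      nlinarith
    exact_mod_cast hfin

/-! ### Numerical estimates -/

lemma numeric (k t : ℕ) (hk : 2 ≤ k) (ht : 1 ≤ t) (r : ℕ) (hr : r = k ^ (t - 1)) :
    (r + 1) ^ t + (48 * t + 3) * r + 48 * t + 5 ≤ k ^ (20 * t ^ 2) ∧
    64 * (k + 1) < k ^ (20 * t ^ 2) ∧ t ≤ k ^ (20 * t ^ 2) ∧ r ^ 2 ≤ k ^ (20 * t ^ 2) ∧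
    k + t ≤ k ^ (20 * t ^ 2) := by
  have ht2 : t ≤ t ^ 2 := by nlinarith
  have hpk : ∀ {a b : ℕ}, a ≤ b → k ^ a ≤ k ^ b := fun h => Nat.pow_le_pow_right (by omega) h
  have h2k : ∀ a : ℕ, 2 ^ a ≤ k ^ a := fun a => Nat.pow_le_pow_left hk a
  have htk : t ≤ k ^ t := (Nat.lt_pow_self (by omega : 1 < k)).le
  have hrt : r ≤ k ^ t := by rw [hr]; exact hpk (by omega)
  have hr1 : r + 1 ≤ k ^ t := by
    have h1 : k ^ t = k * r := by
      rw [hr, ← pow_succ']; congr 1; omega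
    have h2 : 1 ≤ r := by rw [hr]; exact Nat.one_le_pow _ _ (by omega)
    nlinarith
  have a1 : (r + 1) ^ t ≤ k ^ (t ^ 2) := by
    calc (r + 1) ^ t ≤ (k ^ t) ^ t := Nat.pow_le_pow_left hr1 t
      _ = k ^ (t ^ 2) := by rw [← pow_mul, sq]
  have h64 : 64 ≤ k ^ 6 := by simpa using h2k 6
  have a2 : (48 * t + 3) * r ≤ k ^ (6 + t + t) := by
    calc (48 * t + 3) * r ≤ (64 * t) * r := Nat.mul_le_mul_right _ (by omega)
      _ ≤ (k ^ 6 * k ^ t) * k ^ t := by gcongr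
      _ = _ := by rw [pow_add, pow_add]
  have a3 : 48 * t + 5 ≤ k ^ (6 + t) := by
    calc 48 * t + 5 ≤ 64 * t := by omega
      _ ≤ k ^ 6 * k ^ t := by gcongr
      _ = _ := by rw [pow_add]
  have h4 : 4 ≤ k ^ 2 := by simpa using h2k 2
  refine ⟨?_, ?_, ?_, ?_, ?_⟩
  · have b1 : (r + 1) ^ t ≤ k ^ (t ^ 2 + 2 * t + 6) := a1.trans (hpk (by omega))
    have b2 : (48 * t + 3) * r ≤ k ^ (t ^ 2 + 2 * t + 6) := a2.trans (hpk (by omega))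
    have b3 : 48 * t + 5 ≤ k ^ (t ^ 2 + 2 * t + 6) := a3.trans (hpk (by omega))
    have b4 : k ^ (t ^ 2 + 2 * t + 6) * k ^ 2 ≤ k ^ (20 * t ^ 2) := by
      rw [← pow_add]; exact hpk (by omega)
    have b5 : k ^ (t ^ 2 + 2 * t + 6) * 4 ≤ k ^ (t ^ 2 + 2 * t + 6) * k ^ 2 :=
      Nat.mul_le_mul_left _ h4
    omega
  · have : k + 1 < k ^ 2 := by nlinarith
    calc 64 * (k + 1) < 64 * k ^ 2 := by omega
      _ ≤ k ^ 6 * k ^ 2 := Nat.mul_le_mul_right _ h64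
      _ = k ^ (6 + 2) := by rw [pow_add]
      _ ≤ _ := hpk (by omega)
  · exact htk.trans (hpk (by omega))
  · calc r ^ 2 ≤ (k ^ t) ^ 2 := Nat.pow_le_pow_left hrt 2
      _ = k ^ (t * 2) := by rw [← pow_mul]
      _ ≤ _ := hpk (by omega)
  · calc k + t ≤ k ^ t + k ^ t := by
          apply Nat.add_le_add _ htk
          calc k = k ^ 1 := (pow_one k).symm
            _ ≤ k ^ t := hpk ht
      _ = 2 * k ^ t := by ring
      _ ≤ k * k ^ t := Nat.mul_le_mul_right _ hk
      _ = k ^ (t + 1) := by rw [pow_succ']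
      _ ≤ _ := hpk (by omega)

/-- Sampling with a fixed choice of parameters. -/
lemma sampling' {V : Type} [Fintype V] (G : SimpleGraph V) (t k : ℕ) (ht : 1 ≤ t) (hG : KFree G t)
    (x : ℝ) (hx8 : 8 ≤ x) (htx : (t : ℝ) ≤ x) (w : V → ℝ) (hw0 : ∀ v, 0 ≤ w v)
    (hwp : ∀ v, w v ≤ x ^ 2 / (2 * x ^ (48 * t)))
    (hdeg : ∀ v, 0 < w v → ∑ u, ind G v u * w u ≤ x ^ 5)
    (hmain : (k + 1) * ∑ v, w v < ∑ u, ∑ v, ind G u v * w u * w v) : Goal G k := by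
  have hx0 : 0 < x := by linarith
  have hx1 : 1 ≤ x := by linarith
  have hpow : ∀ {a b : ℕ}, a ≤ b → x ^ a ≤ x ^ b := fun h => pow_le_pow_right₀ hx1 h
  have hsmall : (t : ℝ) * (x ^ 2 / (2 * x ^ (48 * t))) * (2 * x ^ 5 / (1 / x ^ 16)) ^ t ≤
      1 / x ^ 16 := by
    have h1 : (2 * x ^ 5 / (1 / x ^ 16)) ^ t ≤ x ^ (22 * t) := by
      calc (2 * x ^ 5 / (1 / x ^ 16)) ^ t = (2 * x ^ 21) ^ t := by
            congr 1; field_simp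
        _ ≤ (x * x ^ 21) ^ t := by gcongr; linarith
        _ = x ^ (22 * t) := by rw [pow_mul]; congr 1; ring
    calc _ ≤ x * (x ^ 2 / (2 * x ^ (48 * t))) * x ^ (22 * t) := by gcongr
      _ ≤ 1 / x ^ 16 := by
        rw [le_div_iff₀ (by positivity), mul_div_assoc', div_mul_eq_mul_div, div_mul_eq_mul_div,
          div_le_one (by positivity)]
        calc x * x ^ 2 * x ^ (22 * t) * x ^ 16 = x ^ (19 + 22 * t) := by rw [pow_add]; ring
          _ ≤ x ^ (48 * t) := hpow (by omega)
          _ ≤ 2 * x ^ (48 * t) := by nlinarith [pow_pos hx0 (48 * t)]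
  have hp1 : x ^ 2 / (2 * x ^ (48 * t)) ≤ 1 := by
    rw [div_le_one (by positivity)]
    calc x ^ 2 ≤ x ^ (48 * t) := hpow (by omega)
      _ ≤ 2 * x ^ (48 * t) := by nlinarith [pow_pos hx0 (48 * t)]
  have hσ : 2 * t * (x ^ 2 / (2 * x ^ (48 * t))) ≤ 1 / x ^ 16 := by
    rw [le_div_iff₀ (by positivity), mul_div_assoc', div_mul_eq_mul_div,
          div_le_one (by positivity)]
    calc 2 * t * x ^ 2 * x ^ 16 ≤ 2 * x * x ^ 2 * x ^ 16 := by gcongr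
      _ = 2 * x ^ 19 := by ring
      _ ≤ 2 * x ^ (48 * t) := by
        have := hpow (show 19 ≤ 48 * t by omega)
        linarith
  refine sampling G t k hG w (x ^ 2 / (2 * x ^ (48 * t))) (x ^ 5) (1 / x ^ 16) hw0 hwp
    (by positivity) hp1 (by positivity) (by positivity) hσ hdeg ?_
  have hSig : 0 ≤ ∑ v, w v := Finset.sum_nonneg fun v _ => hw0 v
  have hG1 : 2 * ((x ^ 5 + 3) * (1 / x ^ 16 * (x ^ 5) ^ 2 + (x ^ 5) ^ 2 *
      (t * (x ^ 2 / (2 * x ^ (48 * t))) * (2 * x ^ 5 / (1 / x ^ 16)) ^ t))) ≤ 1 := by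
    have hx3 : 3 ≤ x ^ 5 := by
      have := hpow (show 1 ≤ 5 by norm_num)
      rw [pow_one] at this
      linarith
    calc _ ≤ 2 * ((x ^ 5 + x ^ 5) * (1 / x ^ 16 * (x ^ 5) ^ 2 + (x ^ 5) ^ 2 * (1 / x ^ 16))) := by
          gcongr
      _ = 8 / x := by field_simp; ring
      _ ≤ 1 := by rw [div_le_one hx0]; exact hx8
  have := mul_le_mul_of_nonneg_right hG1 hSig
  linarith

/-! ### The densest case -/

lemma sum_ind {V : Type} (G : SimpleGraph V) (u : V) (Y : Finset V) :
    ∑ v ∈ Y, ind G u v = ((Y.filter (G.Adj u)).card : ℝ) := by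
  rw [Finset.card_filter]; push_cast; rfl

/-- Number of adjacent pairs between two sets. -/
def ee {V : Type} (G : SimpleGraph V) (X Y : Finset V) : ℝ := ∑ u ∈ X, ∑ v ∈ Y, ind G u v

lemma ee_comm {V : Type} (G : SimpleGraph V) (X Y : Finset V) : ee G X Y = ee G Y X := by
  unfold ee
  rw [Finset.sum_comm]
  exact Finset.sum_congr rfl fun u _ => Finset.sum_congr rfl fun v _ => ind_comm _ _ _

lemma ee_union_left {V : Type} (G : SimpleGraph V) (X X' Y : Finset V) (h : Disjoint X X') :
    ee G (X ∪ X') Y = ee G X Y + ee G X' Y := by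
  unfold ee; rw [Finset.sum_union h]

lemma ee_union_right {V : Type} (G : SimpleGraph V) (X Y Y' : Finset V) (h : Disjoint Y Y') :
    ee G X (Y ∪ Y') = ee G X Y + ee G X Y' := by
  rw [ee_comm, ee_union_left G _ _ _ h, ee_comm G Y, ee_comm G Y']

lemma ee_nonneg {V : Type} (G : SimpleGraph V) (X Y : Finset V) : 0 ≤ ee G X Y :=
  Finset.sum_nonneg fun _ _ => Finset.sum_nonneg fun _ _ => ind_nonneg _ _ _

/-- `ee X Y ≤ |X| * D` if all `Y`-degrees in `X` are at most `D`. -/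
lemma ee_le {V : Type} (G : SimpleGraph V) (X Y : Finset V) (D : ℝ)
    (h : ∀ u ∈ X, ∑ v ∈ Y, ind G u v ≤ D) : ee G X Y ≤ X.card * D := by
  unfold ee
  rw [← nsmul_eq_mul, ← Finset.sum_const]
  exact Finset.sum_le_sum h

lemma le_ee {V : Type} (G : SimpleGraph V) (X Y : Finset V) (D : ℝ)
    (h : ∀ u ∈ X, D ≤ ∑ v ∈ Y, ind G u v) : X.card * D ≤ ee G X Y := by
  unfold ee
  rw [← nsmul_eq_mul, ← Finset.sum_const]
  exact Finset.sum_le_sum h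

lemma ind_mono {V : Type} [Fintype V] (G : SimpleGraph V) (u : V) (Y : Finset V) :
    ∑ v ∈ Y, ind G u v ≤ ∑ v, ind G u v :=
  Finset.sum_le_sum_of_subset_of_nonneg (Finset.subset_univ _) fun _ _ _ => ind_nonneg _ _ _

/-- Case 1 : many edges among low degree vertices. -/
lemma case_one {V : Type} [Fintype V] [Nonempty V] (G : SimpleGraph V) (k t : ℕ) (ht : 1 ≤ t)
    (hG : KFree G t) (x : ℝ) (hx8 : 8 ≤ x) (htx : (t : ℝ) ≤ x) (hkx : 64 * ((k : ℝ) + 1) < x)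
    (X : Finset V) (hX : ∀ v ∈ X, ∑ u, ind G v u ≤ x ^ (48 * t) * x)
    (hE : x ^ (48 * t) * Fintype.card V / 4 ≤ ee G X X) : Goal G k := by
  have hx0 : 0 < x := by linarith
  have hx1 : 1 ≤ x := by linarith
  set d := x ^ (48 * t) with hd
  have hd0 : 0 < d := by positivity
  set p := x ^ 2 / (2 * d) with hp
  have hp0 : 0 < p := by positivity
  have hn : (0 : ℝ) < Fintype.card V := by exact_mod_cast Fintype.card_pos
  let w : V → ℝ := fun v => if v ∈ X then p else 0
  have hwsum : ∀ (g : V → ℝ), ∑ v, g v * w v = (∑ v ∈ X, g v) * p := by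
    intro g
    simp only [w, mul_ite, mul_zero]
    rw [← Finset.sum_filter, Finset.sum_mul]
    congr 1
    ext v; simp
  have hpd : p * (d * x) ≤ x ^ 5 := by
    have : p * (d * x) = x ^ 3 / 2 := by rw [hp]; field_simp
    rw [this]
    have h1 : x ^ 3 ≤ x ^ 5 := pow_le_pow_right₀ hx1 (by norm_num)
    have h2 : 0 < x ^ 3 := by positivity
    linarith
  refine sampling' G t k ht hG x hx8 htx w ?_ ?_ ?_ ?_
  · intro v; simp only [w]; split_ifs <;> linarith
  · intro v; simp only [w]; split_ifs
    · exact le_rfl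
    · exact hp0.le
  · intro v hv
    have hvX : v ∈ X := by
      by_contra h; simp [w, h] at hv
    rw [hwsum]
    calc _ ≤ (d * x) * p := by
          apply mul_le_mul_of_nonneg_right _ hp0.le
          exact (ind_mono G v X).trans (hX v hvX)
      _ ≤ x ^ 5 := by linarith
  · have h1 : ∑ v, w v = X.card * p := by
      have := hwsum (fun _ => 1)
      simpa using this
    have h2 : ∑ u, ∑ v, ind G u v * w u * w v = ee G X X * p * p := by
      have h3 : ∀ u, ∑ v, ind G u v * w u * w v = ((∑ v ∈ X, ind G u v) * p) * w u := by
        intro u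
        rw [← hwsum, Finset.sum_mul]
        exact Finset.sum_congr rfl fun v _ => by ring
      simp only [h3]
      rw [hwsum, ← Finset.sum_mul]
      rfl
    rw [h1, h2]
    have hXn : (X.card : ℝ) ≤ Fintype.card V := by exact_mod_cast Finset.card_le_univ X
    have h4 : (d * Fintype.card V / 4) * p = x ^ 2 * Fintype.card V / 8 := by
      rw [hp]; field_simp; norm_num
    have h5 : (d * Fintype.card V / 4) * p ≤ ee G X X * p := mul_le_mul_of_nonneg_right hE hp0.le
    have h6 : ((k : ℝ) + 1) * X.card < ee G X X * p := by
      calc ((k : ℝ) + 1) * X.card ≤ (k + 1) * Fintype.card V := by gcongr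
        _ < x ^ 2 * Fintype.card V / 8 := by
          have : (k : ℝ) + 1 < x ^ 2 / 8 := by nlinarith
          nlinarith
        _ ≤ _ := by linarith
    calc _ = (((k : ℝ) + 1) * X.card) * p := by ring
      _ < _ := mul_lt_mul_of_pos_right h6 hp0

/-- Case 2 : many edges between low degree vertices and vertices of degree about `d x^i`. -/
lemma case_two {V : Type} [Fintype V] [Nonempty V] (G : SimpleGraph V) (k t : ℕ) (ht : 1 ≤ t)
    (hG : KFree G t) (x : ℝ) (hx8 : 8 ≤ x) (htx : (t : ℝ) ≤ x) (hkx : 64 * ((k : ℝ) + 1) < x)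
    (i : ℕ) (X Y : Finset V) (hXY : Disjoint X Y)
    (hX : ∀ v ∈ X, ∑ u, ind G v u ≤ x ^ (48 * t) * x)
    (hY : ∀ v ∈ Y, ∑ u, ind G v u ≤ x ^ (48 * t) * x ^ (i + 1))
    (hYY : ee G Y Y ≤ x ^ (48 * t) * Y.card)
    (hYc : Y.card * x ^ i ≤ Fintype.card V)
    (hE : x ^ (48 * t) * Fintype.card V / (8 * x) ≤ ee G X Y) : Goal G k := by
  have hx0 : 0 < x := by linarith
  have hx1 : 1 ≤ x := by linarith
  set d := x ^ (48 * t) with hd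
  have hd0 : 0 < d := by positivity
  set p := x ^ 2 / (2 * d) with hp
  have hp0 : 0 < p := by positivity
  set q := p / x ^ i with hq
  have hq0 : 0 < q := by positivity
  have hqp : q ≤ p := div_le_self hp0.le (one_le_pow₀ hx1)
  have hn : (0 : ℝ) < Fintype.card V := by exact_mod_cast Fintype.card_pos
  set n : ℝ := ((Fintype.card V : ℕ) : ℝ) with hnn
  let B := Y.filter (fun v => ∑ u ∈ Y, ind G v u ≤ d * x ^ 3)
  let B' := Y.filter (fun v => ¬ ∑ u ∈ Y, ind G v u ≤ d * x ^ 3)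
  have hBY : B ⊆ Y := Finset.filter_subset _ _
  have hBu : B ∪ B' = Y := Finset.filter_union_filter_not_eq _ _
  have hBd : Disjoint B B' := Finset.disjoint_filter_filter_not _ _ _
  have hXB : Disjoint X B := Finset.disjoint_of_subset_right hBY hXY
  have hk64 : (64 : ℝ) ≤ x := by have : (0:ℝ) ≤ k := by positivity
                                 linarith
  -- few vertices of large degree inside
  have hB'c : B'.card * x ^ 3 ≤ Y.card := by
    have h1 : B'.card * (d * x ^ 3) ≤ ee G B' Y := le_ee G B' Y _ (by
      intro u hu
      exact (not_le.1 (Finset.mem_filter.1 hu).2).le)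
    have h2 : ee G Y Y = ee G B Y + ee G B' Y := by
      conv_lhs => rw [show ee G Y Y = ee G (B ∪ B') Y by rw [hBu]]
      exact ee_union_left G _ _ _ hBd
    have h3 := ee_nonneg G B Y
    have h4 : d * (B'.card * x ^ 3) ≤ d * Y.card := by linarith
    exact le_of_mul_le_mul_left h4 hd0
  have hEB : d * n / (16 * x) ≤ ee G X B := by
    have h1 : ee G X Y = ee G X B + ee G X B' := by
      conv_lhs => rw [← hBu]
      exact ee_union_right G _ _ _ hBd
    have h2 : ee G X B' ≤ B'.card * (d * x ^ (i + 1)) := by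
      rw [ee_comm]
      exact ee_le G B' X _ (fun u hu => (ind_mono G u X).trans (hY u (Finset.mem_filter.1 hu).1))
    have h3 : B'.card * x ^ 3 * x ^ i ≤ n := by
      have := mul_le_mul_of_nonneg_right hB'c (show 0 ≤ x ^ i by positivity)
      linarith
    have h4 : B'.card * (d * x ^ (i + 1)) ≤ d * n / x ^ 2 := by
      rw [le_div_iff₀ (by positivity)]
      calc (B'.card : ℝ) * (d * x ^ (i + 1)) * x ^ 2 = d * (B'.card * x ^ 3 * x ^ i) := by ring
        _ ≤ d * n := by gcongr
    have h5 : d * n / x ^ 2 ≤ d * n / (16 * x) := by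
      apply div_le_div_of_nonneg_left (by positivity) (by positivity)
      nlinarith
    have h6 : d * n / (8 * x) = d * n / (16 * x) + d * n / (16 * x) := by field_simp; norm_num
    linarith
  let w : V → ℝ := fun v => if v ∈ X then q else if v ∈ B then p else 0
  have hwsum : ∀ (g : V → ℝ), ∑ v, g v * w v = (∑ v ∈ X, g v) * q + (∑ v ∈ B, g v) * p := by
    intro g
    have h1 : ∀ v, g v * w v = (if v ∈ X then g v * q else 0) + (if v ∈ B then g v * p else 0) := by
      intro v
      simp only [w]
      by_cases h1 : v ∈ X
      · have h2 : v ∉ B := Finset.disjoint_left.1 hXB h1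
        simp [h1, h2]
      · simp [h1]
    simp only [h1]
    rw [Finset.sum_add_distrib, ← Finset.sum_filter, ← Finset.sum_filter, Finset.sum_mul,
      Finset.sum_mul]
    congr 1
    · congr 1; ext v; simp
    · congr 1; ext v; simp
  have hpd : p * (d * x) = x ^ 3 / 2 := by rw [hp]; field_simp
  have hpd3 : p * (d * x ^ 3) = x ^ 5 / 2 := by rw [hp]; field_simp
  have hqd : q * (d * x ^ (i + 1)) = x ^ 3 / 2 := by
    rw [hq, hp]; field_simp; ring
  have hx35 : x ^ 3 ≤ x ^ 5 := pow_le_pow_right₀ hx1 (by norm_num)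
  have hw0 : ∀ v, 0 ≤ w v := by
    intro v; simp only [w]; split_ifs <;> linarith
  refine sampling' G t k ht hG x hx8 htx w hw0 ?_ ?_ ?_
  · intro v; simp only [w]; split_ifs
    · exact hqp
    · exact le_rfl
    · exact hp0.le
  · intro v hv
    rw [hwsum]
    by_cases hvX : v ∈ X
    · have h1 := (ind_mono G v X).trans (hX v hvX)
      have h2 := (ind_mono G v B).trans (hX v hvX)
      have hs1 : 0 ≤ ∑ u ∈ X, ind G v u := Finset.sum_nonneg fun _ _ => ind_nonneg _ _ _
      calc _ ≤ (d * x) * p + (d * x) * p := by gcongr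
        _ = x ^ 3 := by linarith
        _ ≤ _ := hx35
    · have hvB : v ∈ B := by
        by_contra h; simp [w, h, hvX] at hv
      have h1 := (ind_mono G v X).trans (hY v (hBY hvB))
      have h2 : ∑ u ∈ B, ind G v u ≤ d * x ^ 3 :=
        (Finset.sum_le_sum_of_subset_of_nonneg hBY fun _ _ _ => ind_nonneg _ _ _).trans
          (Finset.mem_filter.1 hvB).2
      calc _ ≤ (d * x ^ (i + 1)) * q + (d * x ^ 3) * p := by gcongr
        _ = x ^ 3 / 2 + x ^ 5 / 2 := by linarith
        _ ≤ _ := by linarith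
  · have h1 : ∑ v, w v ≤ 2 * q * n := by
      have h2 := hwsum (fun _ => 1)
      simp only [one_mul, Finset.sum_const, nsmul_eq_mul, mul_one] at h2
      rw [h2]
      have hXn : (X.card : ℝ) ≤ n := by rw [hnn]; exact_mod_cast Finset.card_le_univ X
      have hBn : (B.card : ℝ) * x ^ i ≤ n := by
        have : (B.card : ℝ) ≤ Y.card := by exact_mod_cast Finset.card_le_card hBY
        exact (mul_le_mul_of_nonneg_right this (by positivity)).trans hYc
      have h3 : (B.card : ℝ) * p = (B.card * x ^ i) * q := by rw [hq]; field_simp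
      rw [h3]
      have := mul_le_mul_of_nonneg_right hXn hq0.le
      have := mul_le_mul_of_nonneg_right hBn hq0.le
      linarith
    have h2 : ee G X B * p * q ≤ ∑ u, ∑ v, ind G u v * w u * w v := by
      have h3 : ∀ u, ∑ v, ind G u v * w u * w v =
          ((∑ v ∈ X, ind G u v) * q + (∑ v ∈ B, ind G u v) * p) * w u := by
        intro u
        rw [← hwsum, Finset.sum_mul]
        exact Finset.sum_congr rfl fun v _ => by ring
      simp only [h3]
      have h4 : ∀ u, ((∑ v ∈ B, ind G u v) * p) * w u ≤
          ((∑ v ∈ X, ind G u v) * q + (∑ v ∈ B, ind G u v) * p) * w u := by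
        intro u
        apply mul_le_mul_of_nonneg_right _ (hw0 u)
        have : 0 ≤ (∑ v ∈ X, ind G u v) * q :=
          mul_nonneg (Finset.sum_nonneg fun _ _ => ind_nonneg _ _ _) hq0.le
        linarith
      refine le_trans ?_ (Finset.sum_le_sum fun u _ => h4 u)
      rw [hwsum, ← Finset.sum_mul, ← Finset.sum_mul]
      have : 0 ≤ (∑ u ∈ B, ∑ v ∈ B, ind G u v) * p * p :=
        mul_nonneg (mul_nonneg (ee_nonneg G B B) hp0.le) hp0.le
      have h5 : ee G X B * p * q = (∑ u ∈ X, ∑ v ∈ B, ind G u v) * p * q := rfl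
      linarith
    have h3 : (d * n / (16 * x)) * p = x * n / 32 := by rw [hp]; field_simp; norm_num
    have h4 : (d * n / (16 * x)) * p * q ≤ ee G X B * p * q := by gcongr
    rw [h3] at h4
    have h5 : ((k : ℝ) + 1) * ∑ v, w v ≤ (k + 1) * (2 * q * n) := by gcongr
    have h6 : ((k : ℝ) + 1) * (2 * q * n) < x * n / 32 * q := by
      have : 0 < q * n := by positivity
      nlinarith
    linarith

/-- Case 3 : many edges between low degree vertices and vertices of huge degree. -/
lemma case_three {V : Type} [Fintype V] [Nonempty V] (G : SimpleGraph V) (k t : ℕ) (hk : 2 ≤ k)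
    (ht : 1 ≤ t) (hG : KFree G t) (x : ℝ) (hx64 : 64 ≤ x) (r : ℕ) (hr : r = k ^ (t - 1))
    (hrx : (r : ℝ) ^ 2 ≤ x) (hkt : (k : ℝ) + t ≤ x)
    (hdense : ∀ S : Finset V, S.Nonempty →
      ∑ v ∈ S, ((S.filter (G.Adj v)).card : ℝ) ≤ x ^ (48 * t) * S.card)
    (m : ℕ) (hm : (r + 1) ^ t + (48 * t + 3) * r + 48 * t + 5 ≤ m)
    (X Y : Finset V) (hXY : Disjoint X Y)
    (hX : ∀ v ∈ X, ∑ u, ind G v u < x ^ (48 * t) * x)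
    (hYc : Y.card * x ^ m ≤ Fintype.card V)
    (hE : x ^ (48 * t) * Fintype.card V / 8 ≤ ee G X Y) : Goal G k := by
  have hx0 : 0 < x := by linarith
  have hx1 : 1 ≤ x := by linarith
  have hr1 : 1 ≤ r := by rw [hr]; exact Nat.one_le_pow _ _ (by omega)
  have hr1' : (1 : ℝ) ≤ r := by exact_mod_cast hr1
  have hrx' : (r : ℝ) ≤ x := by nlinarith
  set d := x ^ (48 * t) with hd
  have hd0 : 0 < d := by positivity
  have hd1 : 1 ≤ d := one_le_pow₀ hx1
  have hn : (0 : ℝ) < Fintype.card V := by exact_mod_cast Fintype.card_pos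
  set n : ℝ := ((Fintype.card V : ℕ) : ℝ) with hnn
  obtain ⟨out, hout, hor⟩ := exists_orient G d hdense _ Finset.univ rfl
  let A1 := X.filter (fun a => d / 16 ≤ ∑ v ∈ Y, ind G a v)
  let A2 := X.filter (fun a => ¬ d / 16 ≤ ∑ v ∈ Y, ind G a v)
  have hA1 : n ≤ 16 * x * A1.card := by
    have h1 : ee G X Y = ee G A1 Y + ee G A2 Y := by
      conv_lhs => rw [← Finset.filter_union_filter_not_eq
        (fun a => d / 16 ≤ ∑ v ∈ Y, ind G a v) X]
      exact ee_union_left G _ _ _ (Finset.disjoint_filter_filter_not _ _ _)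
    have h2 : ee G A1 Y ≤ A1.card * (d * x) := ee_le G A1 Y _ (fun u hu =>
      (ind_mono G u Y).trans (hX u (Finset.mem_filter.1 hu).1).le)
    have h3 : ee G A2 Y ≤ A2.card * (d / 16) := ee_le G A2 Y _ (fun u hu =>
      (not_le.1 (Finset.mem_filter.1 hu).2).le)
    have h4 : (A2.card : ℝ) ≤ n := by rw [hnn]; exact_mod_cast Finset.card_le_univ A2
    have h5 : (A2.card : ℝ) * (d / 16) ≤ n * (d / 16) := by gcongr
    have h6 : d * n ≤ d * (16 * x * A1.card) := by linarith
    exact le_of_mul_le_mul_left h6 hd0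
  have hA1pos : (0 : ℝ) < A1.card := by
    by_contra h
    push Not at h
    have : 16 * x * A1.card ≤ 0 := mul_nonpos_of_nonneg_of_nonpos (by positivity) h
    linarith
  set D := ⌈d * x⌉₊ with hD
  set D' := ⌊d⌋₊ with hD'
  have hDle : (D : ℝ) ≤ 2 * (d * x) := by
    have := (Nat.ceil_lt_add_one (show 0 ≤ d * x by positivity)).le
    have : 1 ≤ d * x := one_le_mul_of_one_le_of_one_le hd1 hx1
    linarith
  have hD1 : 1 ≤ D := Nat.one_le_ceil_iff.2 (by positivity)
  have hD'le : (D' : ℝ) ≤ d := Nat.floor_le hd0.le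
  set Q := 2 * r * (D + r * D') with hQ
  have hQr : r ≤ Q := by rw [hQ]; nlinarith [Nat.zero_le (r * D')]
  have hQle : (Q : ℝ) ≤ x ^ (48 * t + 3) := by
    rw [hQ]; push_cast
    calc (2 : ℝ) * r * (D + r * D') ≤ 2 * r * (2 * (d * x) + r * d) := by gcongr
      _ ≤ 2 * r * (r * (2 * (d * x)) + r * (d * x)) := by
          have h1 : 2 * (d * x) ≤ (r : ℝ) * (2 * (d * x)) :=
            le_mul_of_one_le_left (by positivity) hr1'
          have h2 : (r : ℝ) * d ≤ r * (d * x) :=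
            mul_le_mul_of_nonneg_left (le_mul_of_one_le_right hd0.le hx1) (by positivity)
          exact mul_le_mul_of_nonneg_left (add_le_add h1 h2) (by positivity)
      _ = 6 * (r : ℝ) ^ 2 * (d * x) := by ring
      _ ≤ x * x * (d * x) := by gcongr; linarith
      _ = x ^ (48 * t + 3) := by rw [hd, pow_add]; ring
  refine super G k t hk ht hG r hr D D' Q out ?_ ?_ A1 Y ?_ ?_ ?_ (by omega) hQr le_rfl ?_
  · intro v
    exact Nat.le_floor (hout v (Finset.mem_univ _))
  · intro u v h
    exact hor u (Finset.mem_univ _) v (Finset.mem_univ _) h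
  · exact Finset.disjoint_of_subset_left (Finset.filter_subset _ _) hXY
  · intro a ha
    have h1 := hX a (Finset.mem_filter.1 ha).1
    rw [sum_ind] at h1
    exact Nat.lt_ceil.2 h1
  · intro a ha
    have h1 := (Finset.mem_filter.1 ha).2
    rw [sum_ind] at h1
    have h2 : (r : ℝ) ^ (2 * t) ≤ d / 16 := by
      rw [le_div_iff₀ (by norm_num)]
      calc (r : ℝ) ^ (2 * t) * 16 ≤ x ^ (2 * t) * x := by gcongr; linarith
        _ = x ^ (2 * t + 1) := by rw [pow_succ]
        _ ≤ d := pow_le_pow_right₀ hx1 (by omega)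
    exact_mod_cast h2.trans h1
  · set M := (r + 1) ^ t with hM
    have h2D : 2 * (D : ℝ) ≤ x ^ (48 * t + 2) := by
      calc 2 * (D : ℝ) ≤ 4 * (d * x) := by linarith
        _ ≤ x * (d * x) := by gcongr; linarith
        _ = _ := by rw [hd, pow_add]; ring
    have hL : ((Y.card * (k + t) ^ M * (2 * Q ^ r * D) : ℕ) : ℝ) * x ^ 3 ≤ n := by
      push_cast
      calc (Y.card : ℝ) * ((k : ℝ) + t) ^ M * (2 * (Q : ℝ) ^ r * D) * x ^ 3
          = Y.card * (((k : ℝ) + t) ^ M * (Q : ℝ) ^ r * (2 * D) * x ^ 3) := by ring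
        _ ≤ Y.card * (x ^ M * (x ^ (48 * t + 3)) ^ r * x ^ (48 * t + 2) * x ^ 3) := by gcongr
        _ = Y.card * x ^ (M + (48 * t + 3) * r + (48 * t + 2) + 3) := by
            rw [← pow_mul, ← pow_add, ← pow_add, ← pow_add]
        _ ≤ Y.card * x ^ m := by
            apply mul_le_mul_of_nonneg_left _ (by positivity)
            exact pow_le_pow_right₀ hx1 (by omega)
        _ ≤ n := hYc
    by_contra hcon
    push Not at hcon
    have hcon' : (A1.card : ℝ) ≤ ((Y.card * (k + t) ^ M * (2 * Q ^ r * D) : ℕ) : ℝ) := by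
      exact_mod_cast hcon
    have h1 : (A1.card : ℝ) * x ^ 3 ≤ 16 * x * A1.card :=
      ((mul_le_mul_of_nonneg_right hcon' (by positivity)).trans hL).trans hA1
    have h2 : 16 * x < x ^ 3 := by nlinarith [sq_nonneg x]
    nlinarith

lemma main_dense {V : Type} [Fintype V] [Nonempty V] (G : SimpleGraph V) (k t : ℕ) (hk : 2 ≤ k)
    (ht : 1 ≤ t) (hG : KFree G t) (x : ℝ) (hx : (k : ℝ) ^ (20 * t ^ 2) ≤ x)
    (hdense : ∀ S : Finset V, S.Nonempty →
      ∑ v ∈ S, ((S.filter (G.Adj v)).card : ℝ) ≤ x ^ (48 * t) * S.card)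
    (htot : ∑ v, ((Finset.univ.filter (G.Adj v)).card : ℝ) = x ^ (48 * t) * Fintype.card V) :
    Goal G k := by
  obtain ⟨n1, n2, n3, n4, n5⟩ := numeric k t hk ht _ rfl
  set r := k ^ (t - 1) with hr
  have hcast : ∀ a : ℕ, a ≤ k ^ (20 * t ^ 2) → (a : ℝ) ≤ x := fun a ha => by
    refine le_trans ?_ hx
    exact_mod_cast ha
  have hkx : 64 * ((k : ℝ) + 1) < x := by
    refine lt_of_lt_of_le ?_ hx
    exact_mod_cast n2
  have htx : (t : ℝ) ≤ x := hcast t n3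
  have hrx : (r : ℝ) ^ 2 ≤ x := by exact_mod_cast hcast _ n4
  have hkt : (k : ℝ) + t ≤ x := by exact_mod_cast hcast _ n5
  have hk0 : (0 : ℝ) ≤ k := by positivity
  have hx64 : 64 ≤ x := by linarith
  have hx0 : 0 < x := by linarith
  have hx1 : 1 ≤ x := by linarith
  set m := ⌊x⌋₊ with hm
  have hmN : (r + 1) ^ t + (48 * t + 3) * r + 48 * t + 5 ≤ m := Nat.le_floor (hcast _ n1)
  have hmx : (m : ℝ) ≤ x := Nat.floor_le hx0.le
  set d := x ^ (48 * t) with hd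
  have hd0 : 0 < d := by positivity
  have hn : (0 : ℝ) < Fintype.card V := by exact_mod_cast Fintype.card_pos
  set n : ℝ := ((Fintype.card V : ℕ) : ℝ) with hnn
  have hdense' : ∀ S : Finset V, ee G S S ≤ d * S.card := by
    intro S
    rcases S.eq_empty_or_nonempty with rfl | hS
    · simp [ee]
    · have := hdense S hS
      unfold ee
      simpa only [sum_ind] using this
  have htot' : ee G Finset.univ Finset.univ = d * n := by
    rw [← htot]; unfold ee; simp only [sum_ind]
  let L : ℕ → Finset V := fun i => Finset.univ.filter (fun v => d * x ^ i ≤ ∑ u, ind G v u)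
  let X : Finset V := Finset.univ.filter (fun v => ¬ d * x ^ 1 ≤ ∑ u, ind G v u)
  have hXL : Disjoint X (L 1) := (Finset.disjoint_filter_filter_not _ _ _).symm
  have hXLu : X ∪ L 1 = Finset.univ := by
    rw [Finset.union_comm]; exact Finset.filter_union_filter_not_eq _ _
  have hX : ∀ v ∈ X, ∑ u, ind G v u < d * x := by
    intro v hv
    have := not_le.1 (Finset.mem_filter.1 hv).2
    rwa [pow_one] at this
  have hLc : ∀ i, (L i).card * x ^ i ≤ n := by
    intro i
    have h1 : (L i).card * (d * x ^ i) ≤ ee G (L i) Finset.univ :=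
      le_ee G _ _ _ (fun u hu => (Finset.mem_filter.1 hu).2)
    have h2 : ee G (L i) Finset.univ ≤ ee G Finset.univ Finset.univ :=
      Finset.sum_le_sum_of_subset_of_nonneg (Finset.subset_univ _)
        (fun _ _ _ => Finset.sum_nonneg fun _ _ => ind_nonneg _ _ _)
    have h3 : d * ((L i).card * x ^ i) ≤ d * n := by linarith
    exact le_of_mul_le_mul_left h3 hd0
  have hLanti : ∀ i, L (i + 1) ⊆ L i := by
    intro i v hv
    have := (Finset.mem_filter.1 hv).2
    refine Finset.mem_filter.2 ⟨Finset.mem_univ _, le_trans ?_ this⟩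
    have := pow_le_pow_right₀ hx1 (Nat.le_succ i)
    gcongr
  have hL1 : ∀ i, L (i + 1) ⊆ L 1 := by
    intro i
    induction i with
    | zero => exact Finset.Subset.refl _
    | succ i ih => exact (hLanti _).trans ih
  -- split of all the edges
  have hsplit : ee G X X + 2 * ee G X (L 1) + ee G (L 1) (L 1) = d * n := by
    rw [← htot', ← hXLu, ee_union_left G _ _ _ hXL, ee_union_right G _ _ _ hXL,
      ee_union_right G _ _ _ hXL, ee_comm G (L 1) X]
    ring
  have hLL : ee G (L 1) (L 1) ≤ d * n / 4 := by
    have h1 := hdense' (L 1)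
    have h2 := hLc 1
    rw [pow_one] at h2
    have h3 : ((L 1).card : ℝ) * 4 ≤ n := by
      have : ((L 1).card : ℝ) * 4 ≤ (L 1).card * x := by gcongr; linarith
      linarith
    have h4 : d * ((L 1).card * 4) ≤ d * n := by gcongr
    linarith
  by_cases c1 : d * n / 4 ≤ ee G X X
  · exact case_one G k t ht hG x (by linarith) htx hkx X (fun v hv => (hX v hv).le) c1
  have hXL1 : d * n / 4 ≤ ee G X (L 1) := by linarith
  by_cases c2 : ∃ i, d * n / (8 * x) ≤ ee G X (L (i + 1) \ L (i + 2))
  · obtain ⟨i, hi⟩ := c2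
    refine case_two G k t ht hG x (by linarith) htx hkx (i + 1) X (L (i + 1) \ L (i + 2)) ?_
      (fun v hv => (hX v hv).le) ?_ (hdense' _) ?_ hi
    · exact Finset.disjoint_of_subset_right (Finset.sdiff_subset.trans (hL1 i)) hXL
    · intro v hv
      have h1 := (Finset.mem_sdiff.1 hv).2
      have h2 : ¬ d * x ^ (i + 2) ≤ ∑ u, ind G v u := fun h =>
        h1 (Finset.mem_filter.2 ⟨Finset.mem_univ _, h⟩)
      exact (not_le.1 h2).le
    · have h1 : ((L (i + 1) \ L (i + 2)).card : ℝ) ≤ (L (i + 1)).card := by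
        exact_mod_cast Finset.card_le_card Finset.sdiff_subset
      exact (mul_le_mul_of_nonneg_right h1 (by positivity)).trans (hLc (i + 1))
  push Not at c2
  have hchain : ∀ j : ℕ, ee G X (L 1) ≤ ee G X (L (j + 1)) + j * (d * n / (8 * x)) := by
    intro j
    induction j with
    | zero => simp
    | succ j ih =>
      have h1 : ee G X (L (j + 1)) = ee G X (L (j + 1) \ L (j + 2)) + ee G X (L (j + 2)) := by
        rw [← ee_union_right G _ _ _ Finset.sdiff_disjoint,
          Finset.sdiff_union_of_subset (hLanti (j + 1))]
      have h2 := c2 j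
      push_cast
      have h3 : j + 1 + 1 = j + 2 := rfl
      rw [h3]
      linarith
  obtain ⟨m', hm'⟩ : ∃ m', m = m' + 1 := ⟨m - 1, by omega⟩
  have hfin : d * n / 8 ≤ ee G X (L m) := by
    have h1 := hchain m'
    rw [← hm'] at h1
    have h2 : (m' : ℝ) ≤ x := by
      have : (m' : ℝ) ≤ m := by exact_mod_cast (by omega : m' ≤ m)
      linarith
    have h3 : (m' : ℝ) * (d * n / (8 * x)) ≤ x * (d * n / (8 * x)) := by gcongr
    have h4 : x * (d * n / (8 * x)) = d * n / 8 := by field_simp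
    linarith
  refine case_three G k t hk ht hG x hx64 r hr hrx hkt hdense m hmN X (L m) ?_ hX (hLc m) hfin
  rw [hm']
  exact Finset.disjoint_of_subset_right (hL1 m') hXL

/-- The induced subgraph on the finite set `U`. -/
def subG {V : Type} (G : SimpleGraph V) (U : Finset V) : SimpleGraph U :=
  G.comap (Function.Embedding.subtype (· ∈ U))

/-- Degree sums in an induced subgraph agree with those in the ambient graph. -/
lemma sum_sub {V : Type} (G : SimpleGraph V) (U : Finset V) (S : Finset U) :
    ∑ v ∈ S, ((S.filter ((subG G U).Adj v)).card : ℝ) =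
      ∑ v ∈ S.map (Function.Embedding.subtype (· ∈ U)),
        (((S.map (Function.Embedding.subtype (· ∈ U))).filter (G.Adj v)).card : ℝ) := by
  rw [Finset.sum_map]
  refine Finset.sum_congr rfl fun v _ => ?_
  rw [Finset.filter_map, Finset.card_map]
  congr 1

lemma goal_of_sub {V : Type} (G : SimpleGraph V) (U : Finset V) (k : ℕ)
    (h : Goal (subG G U) k) : Goal G k := by
  obtain ⟨S, hS, hC, hk⟩ := h
  refine ⟨S.map (Function.Embedding.subtype (· ∈ U)), hS.map, ?_, ?_⟩
  · intro a ha b hb c hc d hd h1 h2 h3 h4 h5 h6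
    rw [Finset.mem_map] at ha hb hc hd
    obtain ⟨a, ha, rfl⟩ := ha
    obtain ⟨b, hb, rfl⟩ := hb
    obtain ⟨c, hc, rfl⟩ := hc
    obtain ⟨d, hd, rfl⟩ := hd
    exact hC a ha b hb c hc d hd h1 h2 h3 h4 (fun h => h5 (by rw [h])) (fun h => h6 (by rw [h]))
  · rw [sum_sub] at hk
    rw [Finset.card_map]
    exact hk

lemma kfree_sub {V : Type} (G : SimpleGraph V) (U : Finset V) (t : ℕ) (h : KFree G t) :
    KFree (subG G U) t := by
  intro A B hA hB hAB
  refine h (A.map (Function.Embedding.subtype (· ∈ U)))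
    (B.map (Function.Embedding.subtype (· ∈ U))) (by rwa [Finset.card_map])
    (by rwa [Finset.card_map]) ?_
  intro a ha b hb
  rw [Finset.mem_map] at ha hb
  obtain ⟨a, ha, rfl⟩ := ha
  obtain ⟨b, hb, rfl⟩ := hb
  exact hAB a ha b hb

lemma kfree_of_not {V : Type} (G : SimpleGraph V) (t : ℕ) (h : ¬ HasBicliqueSub G t) :
    KFree G t := by
  intro A B hA hB hAB
  refine h ⟨A, B, ?_, hA, hB, hAB⟩
  rw [Finset.disjoint_left]
  intro a ha hb
  exact G.irrefl (hAB a ha a hb)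

lemma avgDeg_eq {V : Type} [Fintype V] (G : SimpleGraph V) :
    avgDeg G = (∑ v, ((Finset.univ.filter (G.Adj v)).card : ℝ)) / (Fintype.card V) := by
  unfold avgDeg
  congr 1
  refine Finset.sum_congr rfl fun v _ => ?_
  rw [← SimpleGraph.card_neighborFinset_eq_degree, SimpleGraph.neighborFinset_eq_filter]

lemma avgDeg_induce {V : Type} [Fintype V] (G : SimpleGraph V) (S : Finset V)
    [inst : Fintype (S : Set V)] :
    avgDeg (G.induce (S : Set V)) =
      (∑ v ∈ S, ((S.filter (G.Adj v)).card : ℝ)) / S.card := by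
  rw [avgDeg_eq]
  have hc : Fintype.card (S : Set V) = S.card := by simp
  rw [hc]
  congr 1
  have := sum_sub G S Finset.univ
  have hm : (Finset.univ : Finset S).map (Function.Embedding.subtype (· ∈ S)) = S := by
    ext a; simp
  rw [hm] at this
  rw [← this]
  have hi : inst = Finset.Subtype.fintype S := Subsingleton.elim _ _
  subst hi
  refine Finset.sum_congr rfl fun v _ => ?_
  congr 2

lemma final_of_goal {V : Type} [Fintype V] (G : SimpleGraph V) (S : Finset V) (k : ℕ)
    (inst : Fintype (S : Set V))
    (hS : S.Nonempty)
    (hC : ∀ a ∈ S, ∀ b ∈ S, ∀ c ∈ S, ∀ d ∈ S, G.Adj a b → G.Adj b c → G.Adj c d → G.Adj d a →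
      a ≠ c → b ≠ d → False)
    (hk : (k : ℝ) * S.card ≤ ∑ v ∈ S, ((S.filter (G.Adj v)).card : ℝ)) :
    (S : Set V).Nonempty ∧ ¬ ContainsSub C4 (G.induce (S : Set V)) ∧
      (k : ℝ) ≤ avgDeg (G.induce (S : Set V)) := by
  refine ⟨by simpa using hS, ?_, ?_⟩
  · rintro ⟨f, hf, h⟩
    have e : ∀ i j : Fin 4, i ≠ j → j = i + 1 → G.Adj (f i) (f j) := fun i j hij hj =>
      h (by unfold C4; rw [SimpleGraph.fromRel_adj]; exact ⟨hij, Or.inl hj⟩)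
    refine hC (f 0) (f 0).2 (f 1) (f 1).2 (f 2) (f 2).2 (f 3) (f 3).2
      (e 0 1 (by decide) (by decide)) (e 1 2 (by decide) (by decide))
      (e 2 3 (by decide) (by decide)) (e 3 0 (by decide) (by decide)) ?_ ?_
    · intro h0
      exact absurd (hf (Subtype.ext h0)) (by decide)
    · intro h0
      exact absurd (hf (Subtype.ext h0)) (by decide)
  · rw [avgDeg_induce, le_div_iff₀ (by exact_mod_cast hS.card_pos)]
    exact hk

lemma goal_one {V : Type} [Fintype V] [Nonempty V] (G : SimpleGraph V)
    (h : 1 ≤ avgDeg G) : Goal G 1 := by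
  have hE : ∃ u v, G.Adj u v := by
    by_contra hno
    push Not at hno
    have h0 : avgDeg G = 0 := by
      rw [avgDeg_eq]
      simp [hno]
    linarith
  obtain ⟨u, v, huv⟩ := hE
  have hne : u ≠ v := huv.ne
  refine ⟨{u, v}, by simp, ?_, ?_⟩
  · intro a ha b hb c hc d hd h1 h2 h3 h4 h5 h6
    simp only [Finset.mem_insert, Finset.mem_singleton] at ha hb hc hd
    have := h1.ne
    have := h2.ne
    grind
  · rw [Finset.sum_pair hne, Finset.card_pair hne]
    have h1 : 1 ≤ (({u, v} : Finset V).filter (G.Adj u)).card :=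
      Finset.card_pos.2 ⟨v, by simp [huv]⟩
    have h2 : 1 ≤ (({u, v} : Finset V).filter (G.Adj v)).card :=
      Finset.card_pos.2 ⟨u, by simp [huv.symm]⟩
    have h1' : (1 : ℝ) ≤ ((({u, v} : Finset V).filter (G.Adj u)).card : ℝ) := by exact_mod_cast h1
    have h2' : (1 : ℝ) ≤ ((({u, v} : Finset V).filter (G.Adj v)).card : ℝ) := by exact_mod_cast h2
    push_cast
    linarith

lemma goal_big {V : Type} [Fintype V] [Nonempty V] (G : SimpleGraph V) (k t : ℕ) (hk : 2 ≤ k)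
    (ht : 1 ≤ t) (hG : KFree G t) (h : (k : ℝ) ^ (960 * t ^ 3) ≤ avgDeg G) : Goal G k := by
  obtain ⟨U, hU, hmax⟩ := Finset.exists_max_image
    ((Finset.univ : Finset (Finset V)).filter Finset.Nonempty)
    (fun S => (∑ v ∈ S, ((S.filter (G.Adj v)).card : ℝ)) / S.card)
    ⟨Finset.univ, by simp⟩
  have hUne : U.Nonempty := (Finset.mem_filter.1 hU).2
  set d : ℝ := (∑ v ∈ U, ((U.filter (G.Adj v)).card : ℝ)) / U.card with hd
  have hdG : (k : ℝ) ^ (960 * t ^ 3) ≤ d := by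
    refine h.trans ?_
    rw [avgDeg_eq]
    exact hmax Finset.univ (by simp)
  have hk0 : (0 : ℝ) < k := by exact_mod_cast (by omega : 0 < k)
  have hd0 : 0 ≤ d := le_trans (by positivity) hdG
  have ht0 : 48 * t ≠ 0 := by omega
  set x : ℝ := d ^ (((48 * t : ℕ) : ℝ)⁻¹) with hx
  have hx0 : 0 ≤ x := Real.rpow_nonneg hd0 _
  have hxd : x ^ (48 * t) = d := Real.rpow_inv_natCast_pow hd0 ht0
  have hxk : (k : ℝ) ^ (20 * t ^ 2) ≤ x := by
    refine le_of_pow_le_pow_left₀ ht0 hx0 ?_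
    rw [hxd, ← pow_mul]
    have : 20 * t ^ 2 * (48 * t) = 960 * t ^ 3 := by ring
    rw [this]
    exact hdG
  have : Nonempty U := hUne.to_subtype
  refine goal_of_sub G U k (main_dense (subG G U) k t hk ht (kfree_sub G U t hG) x hxk ?_ ?_)
  · intro S hS
    rw [sum_sub, hxd]
    have := hmax (S.map (Function.Embedding.subtype (· ∈ U))) (by simpa using hS)
    rw [Finset.card_map] at this
    rw [div_le_iff₀ (by exact_mod_cast hS.card_pos)] at this
    exact this
  · rw [sum_sub, hxd]
    have hm : (Finset.univ : Finset U).map (Function.Embedding.subtype (· ∈ U)) = U := by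
      ext a; simp
    rw [hm, Fintype.card_coe, hd]
    have : (U.card : ℝ) ≠ 0 := by exact_mod_cast hUne.card_pos.ne'
    exact (div_mul_cancel₀ _ this).symm

lemma pow_conv (k t : ℕ) : (k : ℝ) ^ ((960 : ℝ) * (t : ℝ) ^ 3) = (k : ℝ) ^ (960 * t ^ 3 : ℕ) := by
  have e : (960 : ℝ) * (t : ℝ) ^ 3 = ((960 * t ^ 3 : ℕ) : ℝ) := by
    push_cast
    ring
  rw [e]
  exact Real.rpow_natCast _ _

lemma goal_all {V : Type} [Fintype V] [Nonempty V] (G : SimpleGraph V) (k t : ℕ) (hk : 0 < k)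
    (ht : 0 < t) (hG : KFree G t) (h : (k : ℝ) ^ ((960 : ℝ) * (t : ℝ) ^ 3) ≤ avgDeg G) :
    Goal G k := by
  rcases Nat.lt_or_ge k 2 with h2 | h2
  · have hk1 : k = 1 := by omega
    subst hk1
    refine goal_one G ?_
    rw [Nat.cast_one, Real.one_rpow] at h
    exact h
  · exact goal_big G k t h2 ht hG ((pow_conv k t).symm.le.trans h)

lemma final_all {V : Type} [Fintype V] (G : SimpleGraph V) (k : ℕ) (h : Goal G k) :
    ∃ s : Set V, s.Nonempty ∧ ¬ ContainsSub C4 (G.induce s) ∧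
      (k : ℝ) ≤ avgDeg (G.induce s) := by
  obtain ⟨S, hS, hC, hSk⟩ := h
  refine ⟨(S : Set V), ?_⟩
  exact final_of_goal G S k _ hS hC hSk

/-- Du–Girão–Hunter–McCarty–Scott: any graph of average degree at least `k^(C t³)` contains
`K_{t,t}` as a subgraph, or has a `C₄`-free induced subgraph of average degree at least `k`. -/
theorem singly_exponential :
    ∃ C : ℝ, 0 < C ∧ ∀ k t : ℕ, 0 < k → 0 < t →
      ∀ (V : Type) [Fintype V] [Nonempty V] (G : SimpleGraph V),
        (k : ℝ) ^ (C * (t : ℝ) ^ 3) ≤ avgDeg G →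
        HasBicliqueSub G t ∨
          ∃ s : Set V, s.Nonempty ∧ ¬ ContainsSub C4 (G.induce s) ∧
            (k : ℝ) ≤ avgDeg (G.induce s) := by
  refine ⟨960, by norm_num, ?_⟩
  intro k t hk ht V _ _ G h
  by_cases hB : HasBicliqueSub G t
  · exact Or.inl hB
  · exact Or.inr (final_all G k (goal_all G k t hk ht (kfree_of_not G t hB) h))
end
end

section
/- Let f : ℕ → ℕ be any non-decreasing function with f(1) = 1 and f(n) ≥ C(3n+1, 3) (the binomial coefficient 'choose') for every n ≥ 2. Then there exists a hereditary class F of finite simple graphs whose optimal χ-bounding function is f; that is: every graph G ∈ F satisfies χ(G) ≤ f(ω(G)), and for every n ≥ 1 there exists a graph G ∈ F with ω(G) ≤ n and χ(G) = f(n). -/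
open SimpleGraph
open scoped Classical

noncomputable section

/-- The clique number of a finite simple graph. -/
def cliqNum {V : Type} [Fintype V] (G : SimpleGraph V) : ℕ :=
  sSup {n | ∃ s : Finset V, G.IsNClique n s}

/-- A class of finite simple graphs. -/
def GraphClass := ∀ (V : Type) [Fintype V], SimpleGraph V → Prop

/-- Hereditary: closed under isomorphism and nonempty induced subgraphs. -/
def Hereditary (F : GraphClass) : Prop :=
  (∀ (V W : Type) [Fintype V] [Fintype W] (G : SimpleGraph V) (H : SimpleGraph W),
      Nonempty (G ≃g H) → F V G → F W H) ∧
  (∀ (V : Type) [Fintype V] (G : SimpleGraph V) (s : Set V), s.Nonempty →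
      F V G → F s (G.induce s))

namespace BDW


lemma choose_dvd_imp {p n : ℕ} (hp : p.Prime) (h : 3 * n < p ^ 2)
    (hd : p ∣ (2 * n + n).choose n) : p ≤ n % p + (2 * n) % p := by
  have hlog : Nat.log p (2 * n + n) < 2 :=
    Nat.log_lt_of_lt_pow' (by norm_num) (by omega)
  have h1 := Nat.factorization_choose' (n := 2 * n) (k := n) hp hlog
  have h2 : 0 < ((2 * n + n).choose n).factorization p :=
    hp.factorization_pos_of_dvd (Nat.choose_pos (by omega)).ne' hd
  rw [h1, Finset.card_pos] at h2
  obtain ⟨i, hi⟩ := h2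
  simp only [Finset.mem_filter, Finset.mem_Ico] at hi
  obtain rfl : i = 1 := by omega
  simpa using hi.2

lemma dvd_choose_of {p n : ℕ} (hp : p.Prime) (h : p ≤ n % p + (2 * n) % p) :
    p ∣ (2 * n + n).choose n := by
  have h1 := Nat.factorization_choose' (n := 2 * n) (k := n) hp
    (Nat.lt_add_of_pos_right (n := Nat.log p (2 * n + n)) (k := 2) (by norm_num))
  have h2 : 0 < ((2 * n + n).choose n).factorization p := by
    rw [h1, Finset.card_pos]
    exact ⟨1, by simp [h]⟩
  exact Nat.dvd_of_factorization_pos h2.ne'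

lemma choose_step (n : ℕ) :
    (3 * (n + 1)).choose (n + 1) * ((2 * n + 1) * (2 * n + 2)) =
      3 * (3 * n + 1) * (3 * n + 2) * (3 * n).choose n := by
  have h1 := Nat.add_choose_mul_factorial_mul_factorial (2 * n) n
  have h2 := Nat.add_choose_mul_factorial_mul_factorial (2 * n + 2) (n + 1)
  rw [show 2 * n + 2 + (n + 1) = 3 * n + 2 + 1 by ring] at h2
  rw [show 2 * n + n = 3 * n by ring] at h1
  simp only [Nat.factorial_succ] at h2
  rw [← h1] at h2
  have hpos : 0 < (n + 1) * (Nat.factorial n * Nat.factorial (2 * n)) := by positivity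
  apply Nat.eq_of_mul_eq_mul_right hpos
  rw [show 3 * (n + 1) = 3 * n + 2 + 1 by ring]
  linear_combination h2

lemma choose_lower (n : ℕ) (hn : 1 ≤ n) : 4 * 27 ^ n ≤ 9 * n * (3 * n).choose n * 4 ^ n := by
  induction n, hn using Nat.le_induction with
  | base => decide
  | succ n hn ih =>
    have hs := choose_step n
    set a := (3 * n).choose n
    set b := (3 * (n + 1)).choose (n + 1)
    have hpos : 0 < n * ((2 * n + 1) * (2 * n + 2)) := by positivity
    apply Nat.le_of_mul_le_mul_right _ hpos
    have e1 : 9 * (n + 1) * b * 4 ^ (n + 1) * (n * ((2 * n + 1) * (2 * n + 2)))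
        = (9 * n * a * 4 ^ n) * (4 * (n + 1) * (3 * (3 * n + 1) * (3 * n + 2))) := by
      linear_combination (9 * (n + 1) * 4 ^ (n + 1) * n) * hs
    rw [e1]
    have e2 : 4 * 27 ^ (n + 1) * (n * ((2 * n + 1) * (2 * n + 2)))
        = (4 * 27 ^ n) * (27 * (n * ((2 * n + 1) * (2 * n + 2)))) := by ring
    rw [e2]
    apply Nat.mul_le_mul ih
    nlinarith

lemma choose_upper (n : ℕ) : (3 * n).choose n * 4 ^ n ≤ 27 ^ n := by
  induction n with
  | zero => simp
  | succ n ih =>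
    have hs := choose_step n
    set a := (3 * n).choose n
    set b := (3 * (n + 1)).choose (n + 1)
    have hpos : 0 < ((2 * n + 1) * (2 * n + 2)) := by positivity
    apply Nat.le_of_mul_le_mul_right _ hpos
    have e1 : b * 4 ^ (n + 1) * ((2 * n + 1) * (2 * n + 2))
        = (a * 4 ^ n) * (4 * (3 * (3 * n + 1) * (3 * n + 2))) := by
      linear_combination (4 ^ (n + 1)) * hs
    rw [e1]
    have e2 : 27 ^ (n + 1) * ((2 * n + 1) * (2 * n + 2))
        = (27 ^ n) * (27 * (((2 * n + 1) * (2 * n + 2)))) := by ring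
    rw [e2]
    apply Nat.mul_le_mul ih
    nlinarith

open Finset in
lemma choose_le_of_no_prime (n : ℕ) (hn : 1 ≤ n)
    (no_prime : ∀ p : ℕ, p.Prime → 2 * n < p → 3 * n < p) :
    (3 * n).choose n ≤ (3 * n) ^ Nat.sqrt (3 * n) * (4 ^ ((n + 1) / 2) *
      (3 * ((n + 1) / 2)).choose ((n + 1) / 2)) := by
  set m := (n + 1) / 2 with hm
  set N := (3 * n).choose n with hN
  have hN0 : N ≠ 0 := (Nat.choose_pos (by omega)).ne'
  let f : ℕ → ℕ := fun x => x ^ N.factorization x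
  have h0 : N = ∏ p ∈ N.primeFactors, f p := (Nat.prod_factorization_pow_eq_self hN0).symm
  rw [h0, ← prod_filter_mul_prod_filter_not N.primeFactors (· ≤ Nat.sqrt (3 * n))]
  have hf1 : ∀ p, Nat.sqrt (3 * n) < p → p.Prime → f p ≤ p := by
    intro p hp hpp
    refine (Nat.pow_le_pow_right hpp.pos ?_).trans (pow_one p).le
    exact Nat.factorization_choose_le_one (Nat.sqrt_lt'.mp hp)
  apply Nat.mul_le_mul
  · refine (Finset.prod_le_prod' fun p _ => (?_ : f p ≤ 3 * n)).trans ?_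
    · exact Nat.pow_factorization_choose_le (by omega)
    rw [Finset.prod_const]
    refine Nat.pow_le_pow_right (by omega) ?_
    have : (Finset.Icc 1 (Nat.sqrt (3 * n))).card = Nat.sqrt (3 * n) := by simp
    refine (Finset.card_le_card fun x hx => ?_).trans this.le
    simp only [mem_filter, Nat.mem_primeFactors] at hx
    exact Finset.mem_Icc.mpr ⟨hx.1.1.one_lt.le, hx.2⟩
  · rw [← prod_filter_mul_prod_filter_not _ (· ≤ m)]
    apply Nat.mul_le_mul
    · refine le_trans ?_ (primorial_le_four_pow m)
      refine (Finset.prod_le_prod' fun p hp => (?_ : f p ≤ p)).trans ?_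
      · simp only [mem_filter, Nat.mem_primeFactors, not_le] at hp
        exact hf1 p hp.1.2 hp.1.1.1
      · refine Finset.prod_le_prod_of_subset_of_one_le' ?_ ?_
        · intro p hp
          simp only [mem_filter, Nat.mem_primeFactors, not_le] at hp
          simp only [mem_filter, mem_range]
          exact ⟨by omega, hp.1.1.1⟩
        · intro p hp _
          simp only [mem_filter, mem_range] at hp
          exact hp.2.one_lt.le
    · have hC0 : (3 * m).choose m ≠ 0 := (Nat.choose_pos (by omega)).ne'
      refine le_trans ?_ (Nat.le_of_dvd (Nat.pos_of_ne_zero hC0)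
        (Nat.prod_primeFactors_dvd ((3 * m).choose m)))
      refine (Finset.prod_le_prod' fun p hp => (?_ : f p ≤ p)).trans ?_
      · simp only [mem_filter, Nat.mem_primeFactors, not_le] at hp
        exact hf1 p hp.1.2 hp.1.1.1
      · refine Finset.prod_le_prod_of_subset_of_one_le' ?_ ?_
        · intro p hp
          simp only [mem_filter, Nat.mem_primeFactors, not_le] at hp
          obtain ⟨⟨⟨hpp, hd, -⟩, hs⟩, hpm⟩ := hp
          rw [Nat.mem_primeFactors]
          refine ⟨hpp, ?_, hC0⟩
          rw [show 3 * m = 2 * m + m by ring]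
          apply dvd_choose_of hpp
          have h1 := choose_dvd_imp hpp (Nat.sqrt_lt'.mp hs)
            (by rw [show 2 * n + n = 3 * n by ring]; exact hd)
          have h3n : ¬ 3 * n < p := by
            intro h
            have := Nat.mod_eq_of_lt (show n < p by omega)
            have := Nat.mod_eq_of_lt (show 2 * n < p by omega)
            omega
          have h2n : p ≤ 2 * n := by
            by_contra h
            exact h3n (no_prime p hpp (by omega))
          have hodd : p = 2 ∨ p % 2 = 1 := hpp.eq_two_or_odd
          have hcase : (n < p ∧ 2 * p ≤ 3 * n) ∨ (4 * p ≤ 3 * n) := by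
            by_contra hcon
            rcases Nat.lt_or_ge n p with h | h
            · have e1 := Nat.mod_eq_of_lt h
              have e2 : (2 * n) % p = 2 * n - p := by
                rw [Nat.mod_eq_sub_mod h2n, Nat.mod_eq_of_lt (by omega)]
              omega
            · have e1 : n % p = n - p := by
                rw [Nat.mod_eq_sub_mod h, Nat.mod_eq_of_lt (by omega)]
              have e2 : (2 * n) % p = 2 * n - p - p := by
                rw [Nat.mod_eq_sub_mod h2n, Nat.mod_eq_sub_mod (by omega),
                  Nat.mod_eq_of_lt (by omega)]
              omega
          have e1 : m % p = m := Nat.mod_eq_of_lt hpm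
          rcases Nat.lt_or_ge (2 * m) p with h | h
          · have e2 : (2 * m) % p = 2 * m := Nat.mod_eq_of_lt h
            omega
          · have e2 : (2 * m) % p = 2 * m - p := by
              rw [Nat.mod_eq_sub_mod h, Nat.mod_eq_of_lt (by omega)]
            omega
        · intro p hp _
          exact (Nat.prime_of_mem_primeFactors hp).one_lt.le

lemma two_pow_ge (k : ℕ) (hk : 15 ≤ k) : (8 * k + 29) ^ 2 ≤ 2 ^ k := by
  induction k, hk using Nat.le_induction with
  | base => norm_num
  | succ k hk ih => rw [pow_succ 2 k]; nlinarith

lemma main_ineq (n : ℕ) (hn : 10923 ≤ n)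
    (h : 4 * 27 ^ n ≤ 9 * n * 4 ^ n * ((3 * n) ^ Nat.sqrt (3 * n) * 27 ^ ((n + 1) / 2))) :
    False := by
  set s := Nat.sqrt (3 * n) with hs
  set m := (n + 1) / 2 with hm
  set k := Nat.log 2 (3 * n) with hk
  have hk15 : 15 ≤ k := Nat.le_log_of_pow_le (by norm_num) (by norm_num; omega)
  have hk1 : 2 ^ k ≤ 3 * n := Nat.pow_log_le_self 2 (by omega)
  have hk2 : 3 * n < 2 ^ (k + 1) := Nat.lt_pow_succ_log_self (by norm_num) _
  have hs1 : s * s ≤ 3 * n := Nat.sqrt_le _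
  have hs2 : 3 * n < (s + 1) * (s + 1) := Nat.lt_succ_sqrt _
  have hsk : 8 * k + 28 ≤ s := by
    have h1 := two_pow_ge k hk15
    by_contra hcon
    nlinarith
  have h2 : (4 * 27 ^ n) ^ 2 ≤ 81 * n ^ 2 * 16 ^ n * ((3 * n) ^ (2 * s) * 27 ^ (n + 1)) := by
    calc (4 * 27 ^ n) ^ 2 ≤ (9 * n * 4 ^ n * ((3 * n) ^ s * 27 ^ m)) ^ 2 := Nat.pow_le_pow_left h 2
      _ = 81 * n ^ 2 * 16 ^ n * ((3 * n) ^ (2 * s) * 27 ^ (2 * m)) := by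
        rw [show (16 : ℕ) = 4 ^ 2 by norm_num, ← pow_mul 4 2 n, mul_comm 2 n, pow_mul 4 n 2,
          mul_comm 2 s, pow_mul, mul_comm 2 m, pow_mul]
        ring
      _ ≤ _ := by
        gcongr
        · norm_num
        · omega
  have h3 : 16 * 27 ^ n ≤ 243 * (3 * n) ^ (2 * s + 2) * 16 ^ n := by
    apply Nat.le_of_mul_le_mul_right _ (show 0 < 27 ^ n by positivity)
    calc _ = (4 * 27 ^ n) ^ 2 := by ring
      _ ≤ _ := h2
      _ = _ := by ring
  have h4 : 2 ^ (3 * n + 16) ≤ 2 ^ (32 + (k + 1) * (8 * s + 8)) := by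
    apply Nat.le_of_mul_le_mul_right _ (show 0 < 16 ^ (4 * n) by positivity)
    calc 2 ^ (3 * n + 16) * 16 ^ (4 * n) = 16 ^ 4 * (8 * 16 ^ 4) ^ n := by
          rw [pow_add, pow_mul, mul_pow, pow_mul 16 4 n]; ring
      _ ≤ 16 ^ 4 * (27 ^ 4) ^ n := by gcongr; norm_num
      _ = (16 * 27 ^ n) ^ 4 := by rw [mul_pow, ← pow_mul, ← pow_mul, mul_comm 4 n]
      _ ≤ (243 * (3 * n) ^ (2 * s + 2) * 16 ^ n) ^ 4 := Nat.pow_le_pow_left h3 4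
      _ = 243 ^ 4 * (3 * n) ^ (8 * s + 8) * 16 ^ (4 * n) := by
          rw [mul_pow, mul_pow, ← pow_mul, ← pow_mul]; ring_nf
      _ ≤ 2 ^ 32 * (2 ^ (k + 1)) ^ (8 * s + 8) * 16 ^ (4 * n) := by
          gcongr ?_ * ?_ * _
          · norm_num
          · exact Nat.pow_le_pow_left hk2.le _
      _ = _ := by rw [pow_add 2 32, pow_mul 2 (k + 1)]
  have h5 := (Nat.pow_le_pow_iff_right (by norm_num)).1 h4
  nlinarith

lemma prime_step {n : ℕ} (hn2 : 2 ≤ n) (q : ℕ) {p : ℕ} (hp : p.Prime) (hq : q % 2 = 1) (hc : 2 * p ≤ 3 * (q + 1))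
    (H : 2 * n < q → ∃ p : ℕ, p.Prime ∧ 2 * n < p ∧ p < 3 * n) (hn : 2 * n < p) :
    ∃ p : ℕ, p.Prime ∧ 2 * n < p ∧ p < 3 * n := by
  by_cases h : 2 * n < q
  · exact H h
  · by_cases h3 : p < 3 * n
    · exact ⟨p, hp, hn, h3⟩
    · have he : p = 3 * n := by omega
      have := (Nat.prime_dvd_prime_iff_eq Nat.prime_three hp).1 ⟨n, he⟩
      omega

/-- For every `n ≥ 2` there is a prime strictly between `2n` and `3n`. -/
lemma exists_prime_two_three (n : ℕ) (hn : 2 ≤ n) : ∃ p : ℕ, p.Prime ∧ 2 * n < p ∧ p < 3 * n := by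
  rcases Nat.lt_or_ge n 10923 with h | h
  · have h' : 2 * n < 29251 := by omega
    revert h'
    refine prime_step hn 19507 (by norm_num) (by norm_num) (by norm_num) ?_
    refine prime_step hn 13009 (by norm_num) (by norm_num) (by norm_num) ?_
    refine prime_step hn 8681 (by norm_num) (by norm_num) (by norm_num) ?_
    refine prime_step hn 5791 (by norm_num) (by norm_num) (by norm_num) ?_
    refine prime_step hn 3863 (by norm_num) (by norm_num) (by norm_num) ?_
    refine prime_step hn 2579 (by norm_num) (by norm_num) (by norm_num) ?_
    refine prime_step hn 1723 (by norm_num) (by norm_num) (by norm_num) ?_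
    refine prime_step hn 1153 (by norm_num) (by norm_num) (by norm_num) ?_
    refine prime_step hn 773 (by norm_num) (by norm_num) (by norm_num) ?_
    refine prime_step hn 523 (by norm_num) (by norm_num) (by norm_num) ?_
    refine prime_step hn 349 (by norm_num) (by norm_num) (by norm_num) ?_
    refine prime_step hn 233 (by norm_num) (by norm_num) (by norm_num) ?_
    refine prime_step hn 157 (by norm_num) (by norm_num) (by norm_num) ?_
    refine prime_step hn 107 (by norm_num) (by norm_num) (by norm_num) ?_
    refine prime_step hn 71 (by norm_num) (by norm_num) (by norm_num) ?_
    refine prime_step hn 47 (by norm_num) (by norm_num) (by norm_num) ?_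
    refine prime_step hn 31 (by norm_num) (by norm_num) (by norm_num) ?_
    refine prime_step hn 23 (by norm_num) (by norm_num) (by norm_num) ?_
    refine prime_step hn 17 (by norm_num) (by norm_num) (by norm_num) ?_
    refine prime_step hn 11 (by norm_num) (by norm_num) (by norm_num) ?_
    refine prime_step hn 7 (by norm_num) (by norm_num) (by norm_num) ?_
    refine prime_step hn 5 (by norm_num) (by norm_num) (by norm_num) ?_
    intro h5
    exact ⟨5, by norm_num, h5, by omega⟩
  · by_contra hcon
    push Not at hcon
    have h1 := choose_le_of_no_prime n (by omega) (by
      intro p hp h2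
      have := hcon p hp h2
      rcases this.lt_or_eq with h | h
      · exact h
      · have := (Nat.prime_dvd_prime_iff_eq Nat.prime_three hp).1 ⟨n, h.symm⟩
        omega)
    have h2 := choose_lower n (by omega)
    have h3 := choose_upper ((n + 1) / 2)
    apply main_ineq n h
    calc _ ≤ _ := h2
      _ = 9 * n * 4 ^ n * (3 * n).choose n := by ring
      _ ≤ 9 * n * 4 ^ n * ((3 * n) ^ Nat.sqrt (3 * n) * 27 ^ ((n + 1) / 2)) := by
        gcongr
        refine h1.trans ?_
        gcongr
        rw [mul_comm]; exact h3




/-- A strict partial order with an additive length function on comparable pairs. -/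
structure Sys (V : Type) where
  R : V → V → Prop
  d : V → V → ℕ
  irrefl : ∀ u, ¬ R u u
  trans : ∀ u v w, R u v → R v w → R u w
  add : ∀ u v w, R u v → R v w → d u w = d u v + d v w

/-- pairs at distance one -/
def Sys.cover {V : Type} (S : Sys V) : SimpleGraph V where
  Adj u v := (S.R u v ∧ S.d u v = 1) ∨ (S.R v u ∧ S.d v u = 1)
  symm := ⟨fun _ _ h => h.symm⟩
  loopless := ⟨fun u h => by rcases h with h | h <;> exact S.irrefl u h.1⟩

/-- the allowed residues `±1, …, ±(n-1)` modulo `p` -/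
def T (p n : ℕ) (x : ZMod p) : Prop :=
  ∃ j : ℕ, 1 ≤ j ∧ j < n ∧ (x = (j : ZMod p) ∨ x = -(j : ZMod p))

lemma T_neg {p n : ℕ} {x : ZMod p} (h : T p n x) : T p n (-x) := by
  obtain ⟨j, h1, h2, h3⟩ := h
  refine ⟨j, h1, h2, ?_⟩
  rcases h3 with rfl | rfl
  · exact Or.inr rfl
  · exact Or.inl (neg_neg _)

lemma T_ne_zero {p n : ℕ} (hnp : n ≤ p) {x : ZMod p} (h : T p n x) : x ≠ 0 := by
  obtain ⟨j, h1, h2, h3⟩ := h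
  have : (j : ZMod p) ≠ 0 := by
    rw [Ne, ZMod.natCast_eq_zero_iff]
    intro hd
    have := Nat.le_of_dvd (by omega) hd
    omega
  rcases h3 with rfl | rfl
  · exact this
  · exact neg_ne_zero.2 this

def Sys.graph {V : Type} (S : Sys V) (p n : ℕ) : SimpleGraph V where
  Adj u v := (S.R u v ∧ T p n (S.d u v : ZMod p)) ∨ (S.R v u ∧ T p n (S.d v u : ZMod p))
  symm := ⟨fun _ _ h => h.symm⟩
  loopless := ⟨fun u h => by rcases h with h | h <;> exact S.irrefl u h.1⟩

def Sys.comap {V W : Type} (S : Sys W) (e : V → W) : Sys V where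
  R u v := S.R (e u) (e v)
  d u v := S.d (e u) (e v)
  irrefl u := S.irrefl _
  trans u v w := S.trans _ _ _
  add u v w := S.add _ _ _

lemma cover_le_graph {V : Type} (S : Sys V) (p n : ℕ) (hn : 2 ≤ n) : S.cover ≤ S.graph p n := by
  intro u v h
  have h1 : T p n ((1 : ℕ) : ZMod p) := ⟨1, le_rfl, hn, Or.inl rfl⟩
  rcases h with ⟨h, h'⟩ | ⟨h, h'⟩
  · exact Or.inl ⟨h, by rw [h']; exact h1⟩
  · exact Or.inr ⟨h, by rw [h']; exact h1⟩

/-! ### Systems of large chromatic number -/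

/-- Zykov-type extension. -/
def Sys.zykov {V : Type} (S : Sys V) (ι : Type) : Sys ((ι × V) ⊕ (ι → V)) where
  R x y := match x, y with
    | Sum.inl a, Sum.inl b => a.1 = b.1 ∧ S.R a.2 b.2
    | Sum.inl a, Sum.inr g => a.2 = g a.1 ∨ S.R a.2 (g a.1)
    | Sum.inr _, _ => False
  d x y := match x, y with
    | Sum.inl a, Sum.inl b => S.d a.2 b.2
    | Sum.inl a, Sum.inr g => if a.2 = g a.1 then 1 else S.d a.2 (g a.1) + 1
    | Sum.inr _, _ => 0
  irrefl := by
    rintro (a | g)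
    · exact fun h => S.irrefl _ h.2
    · exact id
  trans := by
    rintro (⟨i, a⟩ | g) (⟨j, b⟩ | g') (⟨k, c⟩ | g'') h1 h2 <;> simp at h1 h2 ⊢
    · obtain ⟨rfl, h1⟩ := h1
      obtain ⟨rfl, h2⟩ := h2
      exact ⟨rfl, S.trans _ _ _ h1 h2⟩
    · obtain ⟨rfl, h1⟩ := h1
      rcases h2 with rfl | h2
      · exact Or.inr h1
      · exact Or.inr (S.trans _ _ _ h1 h2)
  add := by
    rintro (⟨i, a⟩ | g) (⟨j, b⟩ | g') (⟨k, c⟩ | g'') h1 h2 <;> simp at h1 h2 ⊢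
    · obtain ⟨rfl, h1⟩ := h1
      obtain ⟨rfl, h2⟩ := h2
      exact S.add _ _ _ h1 h2
    · obtain ⟨rfl, h1⟩ := h1
      have hne : a ≠ g'' i := by
        rintro rfl
        rcases h2 with rfl | h2
        · exact S.irrefl _ h1
        · exact S.irrefl _ (S.trans _ _ _ h1 h2)
      rw [if_neg hne]
      rcases h2 with rfl | h2
      · simp
      · have hne' : b ≠ g'' i := by
          rintro rfl
          exact S.irrefl _ h2
        rw [if_neg hne', S.add _ _ _ h1 h2]
        ring

lemma zykov_not_colorable {V : Type} (S : Sys V) (k : ℕ) (h : ¬ S.cover.Colorable k) :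
    ¬ (S.zykov (Fin (k + 1))).cover.Colorable (k + 1) := by
  rintro ⟨c⟩
  have key : ∀ i : Fin (k + 1), ∃ v : V, c (Sum.inl (i, v)) = i := by
    intro i
    by_contra hcon
    push Not at hcon
    apply h
    have c' : S.cover.Coloring {j : Fin (k + 1) // j ≠ i} :=
      Coloring.mk (fun v => ⟨c (Sum.inl (i, v)), hcon v⟩) (by
        intro u v huv heq
        have hadj : (S.zykov (Fin (k + 1))).cover.Adj (Sum.inl (i, u)) (Sum.inl (i, v)) := by
          rcases huv with huv | huv
          · exact Or.inl ⟨⟨rfl, huv.1⟩, huv.2⟩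
          · exact Or.inr ⟨⟨rfl, huv.1⟩, huv.2⟩
        exact c.valid hadj (Subtype.ext_iff.1 heq))
    have := c'.colorable
    simpa using this
  choose g hg using key
  have hadj : (S.zykov (Fin (k + 1))).cover.Adj
      (Sum.inl (c (Sum.inr g), g (c (Sum.inr g)))) (Sum.inr g) :=
    Or.inl ⟨Or.inl rfl, if_pos rfl⟩
  exact c.valid hadj (hg _)

lemma exists_sys (k : ℕ) : ∃ (V : Type) (_ : Fintype V) (S : Sys V), ¬ S.cover.Colorable k := by
  induction k with
  | zero =>
    refine ⟨Unit, inferInstance, ⟨fun _ _ => False, fun _ _ => 0, fun _ => id,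
      fun _ _ _ h => h.elim, fun _ _ _ h => h.elim⟩, ?_⟩
    rintro ⟨c⟩
    exact (c ()).elim0
  | succ k ih =>
    obtain ⟨V, _, S, hS⟩ := ih
    exact ⟨_, inferInstance, S.zykov (Fin (k + 1)), zykov_not_colorable S k hS⟩

/-! ### Residues -/

open scoped Pointwise in
lemma T_clique_card {p n : ℕ} (hp : p.Prime) (hn : 1 ≤ n) (hnp : 2 * n < p) (A : Finset (ZMod p))
    (hA : ∀ x ∈ A, ∀ y ∈ A, x ≠ y → T p n (y - x)) : A.card ≤ n := by
  have : Fact p.Prime := ⟨hp⟩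
  rcases A.eq_empty_or_nonempty with rfl | hne
  · simp
  let J : Finset (ZMod p) := (Finset.Icc n (p - n)).image (fun j : ℕ => (j : ZMod p))
  have hJ : J.card = p - 2 * n + 1 := by
    rw [Finset.card_image_of_injOn]
    · simp; omega
    · intro a ha b hb hab
      simp only [Finset.coe_Icc, Set.mem_Icc] at ha hb
      have := (ZMod.natCast_eq_natCast_iff' a b p).1 hab
      rwa [Nat.mod_eq_of_lt (by omega), Nat.mod_eq_of_lt (by omega)] at this
  have hJne : J.Nonempty := by rw [← Finset.card_pos]; omega
  have hcd := ZMod.cauchy_davenport hp hne hJne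
  have hdisj : Disjoint A (A + J) := by
    rw [Finset.disjoint_left]
    intro y hy hy'
    obtain ⟨x, hx, j', hj', rfl⟩ := Finset.mem_add.1 hy'
    obtain ⟨j, hj, rfl⟩ := Finset.mem_image.1 hj'
    rw [Finset.mem_Icc] at hj
    have hj0 : (j : ZMod p) ≠ 0 := by
      rw [Ne, ZMod.natCast_eq_zero_iff]
      intro hd
      have := Nat.le_of_dvd (by omega) hd
      omega
    have := hA x hx _ hy (by simpa using hj0)
    rw [add_sub_cancel_left] at this
    obtain ⟨i, h1, h2, h3⟩ := this
    rcases h3 with h3 | h3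
    · have := (ZMod.natCast_eq_natCast_iff' j i p).1 h3
      rw [Nat.mod_eq_of_lt (by omega), Nat.mod_eq_of_lt (by omega)] at this
      omega
    · have h4 : ((j + i : ℕ) : ZMod p) = 0 := by push_cast; rw [h3]; ring
      rw [ZMod.natCast_eq_zero_iff] at h4
      have := Nat.le_of_dvd (by omega) h4
      omega
  have hle : A.card + (A + J).card ≤ p := by
    rw [← Finset.card_union_of_disjoint hdisj]
    exact (Finset.card_le_univ _).trans (ZMod.card p).le
  have hpos := Finset.card_pos.2 hne
  rw [hJ] at hcd
  rcases min_le_iff.1 hcd with h | h <;> omega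

lemma averaging {p n : ℕ} (hp : p.Prime) (hnp : n < p) (A : Finset (ZMod p)) :
    ∃ B ⊆ A, A.card * n ≤ p * B.card ∧ ∀ x ∈ B, ∀ y ∈ B, x ≠ y → T p n (y - x) := by
  have : Fact p.Prime := ⟨hp⟩
  let F : ZMod p → Finset (ZMod p) := fun t => A.filter (fun x => (x - t).val < n)
  have hcount : ∀ x : ZMod p, (Finset.univ.filter (fun t : ZMod p => (x - t).val < n)).card = n := by
    intro x
    rw [← Finset.card_range n]
    apply Finset.card_bij' (fun t _ => (x - t).val) (fun j _ => x - (j : ZMod p))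
    · intro t ht; simpa using ht
    · intro j hj
      rw [Finset.mem_range] at hj
      simp [ZMod.val_natCast, Nat.mod_eq_of_lt (hj.trans hnp), hj]
    · intro t ht; simp
    · intro j hj
      rw [Finset.mem_range] at hj
      simp [ZMod.val_natCast, Nat.mod_eq_of_lt (hj.trans hnp)]
  have hsum : ∑ t : ZMod p, (F t).card = A.card * n := by
    simp only [F, Finset.card_filter]
    rw [Finset.sum_comm]
    simp only [← Finset.card_filter]
    simp [hcount]
  obtain ⟨t, -, ht⟩ := Finset.exists_max_image (Finset.univ : Finset (ZMod p))
    (fun t => (F t).card) Finset.univ_nonempty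
  refine ⟨F t, Finset.filter_subset _ _, ?_, ?_⟩
  · rw [← hsum]
    calc _ ≤ ∑ _t : ZMod p, (F t).card := Finset.sum_le_sum fun i hi => ht i hi
      _ = _ := by simp [ZMod.card]
  · intro x hx y hy hxy
    have hx' := (Finset.mem_filter.1 hx).2
    have hy' := (Finset.mem_filter.1 hy).2
    have ex : x = t + ((x - t).val : ZMod p) := by simp
    have ey : y = t + ((y - t).val : ZMod p) := by simp
    generalize (x - t).val = i at *
    generalize (y - t).val = j at *
    subst ex ey
    rcases lt_trichotomy i j with h | h | h
    · exact ⟨j - i, by omega, by omega, Or.inl (by rw [Nat.cast_sub h.le]; ring)⟩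
    · exact absurd (by rw [h]) hxy
    · exact ⟨i - j, by omega, by omega, Or.inr (by rw [Nat.cast_sub h.le]; ring)⟩

/-! ### clique number of the graph -/

lemma clique_card_le {V : Type} (S : Sys V) {p n : ℕ} (hp : p.Prime) (hn : 1 ≤ n)
    (hnp : 2 * n < p) (K : Finset V) (hK : (S.graph p n).IsClique (K : Set V)) : K.card ≤ n := by
  rcases K.eq_empty_or_nonempty with rfl | hne
  · simp
  have hcmp : ∀ u ∈ K, ∀ v ∈ K, u ≠ v → S.R u v ∨ S.R v u := by
    intro u hu v hv huv
    rcases hK hu hv huv with h | h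
    · exact Or.inl h.1
    · exact Or.inr h.1
  obtain ⟨v, hv, hmax⟩ : ∃ v ∈ K, ∀ u ∈ K, ¬ S.R v u := by
    let _ : PartialOrder V :=
      { le := fun a b => a = b ∨ S.R a b
        le_refl := fun a => Or.inl rfl
        le_trans := by
          rintro a b c (rfl | h) (rfl | h')
          · exact Or.inl rfl
          · exact Or.inr h'
          · exact Or.inr h
          · exact Or.inr (S.trans _ _ _ h h')
        le_antisymm := by
          rintro a b (rfl | h) (h' | h')
          · rfl
          · rfl
          · exact h'.symm
          · exact (S.irrefl _ (S.trans _ _ _ h h')).elim }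
    obtain ⟨v, hv⟩ := K.exists_maximal hne
    refine ⟨v, hv.1, fun u hu h => ?_⟩
    have := hv.2 hu (Or.inr h)
    rcases this with rfl | h'
    · exact S.irrefl _ h
    · exact S.irrefl _ (S.trans _ _ _ h h')
  let a : V → ZMod p := fun w => if w = v then 0 else -(S.d w v : ZMod p)
  have hR : ∀ u ∈ K, u ≠ v → S.R u v := fun u hu huv =>
    (hcmp u hu v hv huv).resolve_right (hmax u hu)
  have hd1 : ∀ u ∈ K, ∀ w ∈ K, S.R u w → a w - a u = (S.d u w : ZMod p) := by
    intro u hu w hw huw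
    have huv : u ≠ v := by
      rintro rfl
      exact hmax w hw huw
    by_cases hwv : w = v
    · subst hwv; simp [a, huv]
    · simp only [a, huv, hwv, if_false]
      rw [S.add u w v huw (hR w hw hwv)]
      push_cast; ring
  have hd : ∀ u ∈ K, ∀ w ∈ K, u ≠ w → T p n (a w - a u) := by
    intro u hu w hw huw
    rcases hK hu hw huw with h | h
    · rw [hd1 u hu w hw h.1]; exact h.2
    · rw [← neg_sub, hd1 w hw u hu h.1]; exact T_neg h.2
  have hinj : Set.InjOn a K := by
    intro u hu w hw h
    by_contra huw
    exact T_ne_zero (by omega) (hd u hu w hw huw) (by rw [h, sub_self])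
  rw [← Finset.card_image_of_injOn hinj]
  apply T_clique_card hp hn hnp
  intro x hx y hy hxy
  obtain ⟨u, hu, rfl⟩ := Finset.mem_image.1 hx
  obtain ⟨w, hw, rfl⟩ := Finset.mem_image.1 hy
  exact hd u hu w hw (fun h => hxy (by rw [h]))

/-! ### Residue sets of chains -/

inductive ChainRes {V : Type} (S : Sys V) (p : ℕ) : V → Finset (ZMod p) → Prop
  | single (v : V) : ChainRes S p v {0}
  | step (u v : V) (A : Finset (ZMod p)) : ChainRes S p u A → S.R u v →
      ChainRes S p v (insert 0 (A.image (fun x => x - (S.d u v : ZMod p))))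

lemma ChainRes.zero_mem {V : Type} {S : Sys V} {p : ℕ} {v : V} {A : Finset (ZMod p)}
    (h : ChainRes S p v A) : (0 : ZMod p) ∈ A := by
  cases h <;> simp

lemma ChainRes.rep {V : Type} {S : Sys V} {p : ℕ} {v : V} {A : Finset (ZMod p)}
    (h : ChainRes S p v A) : ∃ w : ZMod p → V,
      (∀ a ∈ A, (S.R (w a) v ∧ (S.d (w a) v : ZMod p) = -a) ∨ (w a = v ∧ a = 0)) ∧
      (∀ a ∈ A, ∀ b ∈ A, a ≠ b → (S.R (w a) (w b) ∧ (S.d (w a) (w b) : ZMod p) = b - a) ∨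
        (S.R (w b) (w a) ∧ (S.d (w b) (w a) : ZMod p) = a - b)) := by
  induction h with
  | single v =>
    refine ⟨fun _ => v, ?_, ?_⟩
    · intro a ha
      rw [Finset.mem_singleton] at ha
      exact Or.inr ⟨rfl, ha⟩
    · intro a ha b hb hab
      rw [Finset.mem_singleton] at ha hb
      exact absurd (ha.trans hb.symm) hab
  | step u v A hA huv ih =>
    obtain ⟨w, h1, h2⟩ := ih
    set r : ZMod p := (S.d u v : ZMod p) with hr
    have hmem : ∀ a ∈ insert 0 (A.image (fun x => x - r)), a ≠ 0 → a + r ∈ A := by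
      intro a ha ha0
      rcases Finset.mem_insert.1 ha with h | h
      · exact absurd h ha0
      · obtain ⟨x, hx, rfl⟩ := Finset.mem_image.1 h
        simpa using hx
    have hv : ∀ x ∈ A, S.R (w x) v ∧ (S.d (w x) v : ZMod p) = -(x - r) := by
      intro x hx
      rcases h1 x hx with ⟨h, h'⟩ | ⟨h, rfl⟩
      · refine ⟨S.trans _ _ _ h huv, ?_⟩
        rw [S.add _ _ _ h huv]
        push_cast
        rw [h', ← hr]; ring
      · rw [h]
        exact ⟨huv, by rw [← hr]; ring⟩
    refine ⟨fun a => if a = 0 then v else w (a + r), ?_, ?_⟩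
    · intro a ha
      by_cases ha0 : a = 0
      · exact Or.inr ⟨if_pos ha0, ha0⟩
      · left
        have := hv _ (hmem a ha ha0)
        simp only [ha0, if_false]
        simpa using this
    · intro a ha b hb hab
      by_cases ha0 : a = 0
      · have hb0 : b ≠ 0 := fun h => hab (ha0.trans h.symm)
        right
        have := hv _ (hmem b hb hb0)
        simp only [ha0, hb0, if_false, if_true]
        simpa using this
      · by_cases hb0 : b = 0
        · left
          have := hv _ (hmem a ha ha0)
          simp only [ha0, hb0, if_false, if_true]
          simpa using this
        · have := h2 _ (hmem a ha ha0) _ (hmem b hb hb0) (by simpa using hab)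
          simp only [ha0, hb0, if_false]
          simpa using this

lemma ChainRes.card_mul_le {V : Type} {S : Sys V} {p n m : ℕ} (hp : p.Prime) (hnp : n < p)
    (hm : ∀ K : Finset V, (S.graph p n).IsClique (K : Set V) → K.card ≤ m)
    {v : V} {A : Finset (ZMod p)} (h : ChainRes S p v A) : A.card * n ≤ p * m := by
  obtain ⟨B, hBA, hB, hBT⟩ := averaging hp hnp A
  obtain ⟨w, -, hw⟩ := h.rep
  refine hB.trans (Nat.mul_le_mul_left _ ?_)
  have hadj : ∀ a ∈ B, ∀ b ∈ B, a ≠ b → (S.graph p n).Adj (w a) (w b) := by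
    intro a ha b hb hab
    rcases hw a (hBA ha) b (hBA hb) hab with ⟨h, h'⟩ | ⟨h, h'⟩
    · exact Or.inl ⟨h, by rw [h']; exact hBT a ha b hb hab⟩
    · exact Or.inr ⟨h, by rw [h']; exact hBT b hb a ha hab.symm⟩
  have hinj : Set.InjOn w B := by
    intro a ha b hb h
    by_contra hab
    exact (hadj a ha b hb hab).ne h
  rw [← Finset.card_image_of_injOn hinj]
  apply hm
  intro x hx y hy hxy
  rw [Finset.mem_coe] at hx hy
  obtain ⟨a, ha, rfl⟩ := Finset.mem_image.1 hx
  obtain ⟨b, hb, rfl⟩ := Finset.mem_image.1 hy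
  exact hadj a ha b hb (fun h => hxy (by rw [h]))

/-! ### The canonical index -/

def bary {p : ℕ} (I : Finset (ZMod p)) : ZMod p := (∑ x ∈ I, x) * (I.card : ZMod p)⁻¹

def idx {p : ℕ} (I : Finset (ZMod p)) : ℕ :=
  (I.filter (fun x => (x - bary I).val < (-bary I).val)).card

lemma idx_lt {p : ℕ} {I : Finset (ZMod p)} (h : (0 : ZMod p) ∈ I) : idx I < I.card := by
  apply Finset.card_lt_card
  rw [Finset.filter_ssubset]
  exact ⟨0, h, by simp⟩

lemma idx_inj {p : ℕ} (hp : p.Prime) {I : Finset (ZMod p)} (hI : I.card < p) {r : ZMod p}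
    (h0 : (0 : ZMod p) ∈ I) (hr : r ∈ I) (h : idx (I.image (fun x => x - r)) = idx I) : r = 0 := by
  have : Fact p.Prime := ⟨hp⟩
  have hinj : Function.Injective (fun x : ZMod p => x - r) := sub_left_injective
  have hc : (I.image (fun x => x - r)).card = I.card := Finset.card_image_of_injective _ hinj
  have hc0 : (I.card : ZMod p) ≠ 0 := by
    rw [Ne, ZMod.natCast_eq_zero_iff]
    intro hd
    have := Nat.le_of_dvd (Finset.card_pos.2 ⟨0, h0⟩) hd
    omega
  have hb : bary (I.image (fun x => x - r)) = bary I - r := by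
    unfold bary
    rw [hc, Finset.sum_image (fun x _ y _ h => hinj h), Finset.sum_sub_distrib, Finset.sum_const,
      nsmul_eq_mul, sub_mul]
    field_simp
  have hi : idx (I.image (fun x => x - r)) =
      (I.filter (fun x => (x - bary I).val < (r - bary I).val)).card := by
    unfold idx
    rw [hb, Finset.filter_image, Finset.card_image_of_injective _ hinj]
    congr 1
    ext x
    simp
  rw [hi] at h
  unfold idx at h
  have e0 : (0 : ZMod p) - bary I = -bary I := zero_sub _
  rcases lt_trichotomy ((-bary I).val) ((r - bary I).val) with hlt | heq | hlt
  · exfalso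
    refine absurd h.symm (Nat.ne_of_lt (Finset.card_lt_card ?_))
    rw [Finset.ssubset_iff_of_subset]
    · exact ⟨0, by simp [h0, hlt], by simp⟩
    · intro x hx
      rw [Finset.mem_filter] at hx ⊢
      exact ⟨hx.1, hx.2.trans hlt⟩
  · have := ZMod.val_injective p heq
    have h2 : r = (r - bary I) + bary I := by ring
    rw [h2, ← this]; ring
  · exfalso
    refine absurd h (Nat.ne_of_lt (Finset.card_lt_card ?_))
    rw [Finset.ssubset_iff_of_subset]
    · exact ⟨r, by simp [hr, hlt], by simp⟩
    · intro x hx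
      rw [Finset.mem_filter] at hx ⊢
      exact ⟨hx.1, hx.2.trans hlt⟩

/-! ### The colouring -/

lemma triple_inj {a b c a' b' c' : ℕ} (h1 : a < b) (h2 : b < c) (h1' : a' < b') (h2' : b' < c')
    (h : ({a, b, c} : Finset ℕ) = {a', b', c'}) : a = a' ∧ b = b' ∧ c = c' := by
  have ha : a ∈ ({a', b', c'} : Finset ℕ) := h ▸ (by simp)
  have hb : b ∈ ({a', b', c'} : Finset ℕ) := h ▸ (by simp)
  have hc : c ∈ ({a', b', c'} : Finset ℕ) := h ▸ (by simp)
  simp only [Finset.mem_insert, Finset.mem_singleton] at ha hb hc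
  omega

lemma colorable_of {V : Type} (S : Sys V) {p n M : ℕ} (hp : p.Prime) (hnp : n < p) (hM : M < p)
    (hA : ∀ (v : V) (A : Finset (ZMod p)), ChainRes S p v A → A.card ≤ M) :
    (S.graph p n).Colorable ((M + 2).choose 3) := by
  have : Fact p.Prime := ⟨hp⟩
  let Fam : V → Finset (Finset (ZMod p)) := fun v => Finset.univ.filter (ChainRes S p v)
  let a : V → ℕ := fun v => (Fam v).sup Finset.card
  have hle : ∀ v A, ChainRes S p v A → A.card ≤ a v := fun v A h =>
    Finset.le_sup (f := Finset.card) (by simpa [Fam] using h)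
  have hex : ∀ v, ∃ A, ChainRes S p v A ∧ A.card = a v := by
    intro v
    obtain ⟨A, hA, h⟩ := Finset.exists_mem_eq_sup (Fam v) ⟨{0}, by simpa [Fam] using ChainRes.single v⟩
      Finset.card
    exact ⟨A, by simpa [Fam] using hA, h.symm⟩
  have haM : ∀ v, a v ≤ M := by
    intro v
    obtain ⟨A, h, h'⟩ := hex v
    rw [← h']; exact hA v A h
  let I : V → Finset (ZMod p) := fun v =>
    Finset.univ.filter (fun x => ∀ A, ChainRes S p v A → A.card = a v → x ∈ A)
  have hI0 : ∀ v, (0 : ZMod p) ∈ I v := by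
    intro v
    simp only [I, Finset.mem_filter, Finset.mem_univ, true_and]
    exact fun A h _ => h.zero_mem
  have hIa : ∀ v, (I v).card ≤ a v := by
    intro v
    obtain ⟨A, h, h'⟩ := hex v
    rw [← h']
    apply Finset.card_le_card
    intro x hx
    simp only [I, Finset.mem_filter, Finset.mem_univ, true_and] at hx
    exact hx A h h'
  have hproper : ∀ u v, S.R u v → a u = a v → (I u).card = (I v).card → idx (I u) = idx (I v) →
      (S.d u v : ZMod p) = 0 := by
    intro u v huv hauv hIuv hidx
    set r : ZMod p := (S.d u v : ZMod p) with hr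
    have hinj : Function.Injective (fun x : ZMod p => x - r) := sub_left_injective
    have hmove : ∀ A, ChainRes S p u A → A.card = a u → r ∈ A ∧ ChainRes S p v (A.image (fun x => x - r)) := by
      intro A h h'
      have hs := ChainRes.step u v A h huv
      rw [← hr] at hs
      have hc := hle v _ hs
      have h0 : (0 : ZMod p) ∈ A.image (fun x => x - r) := by
        by_contra hcon
        rw [Finset.card_insert_of_notMem hcon, Finset.card_image_of_injective _ hinj] at hc
        omega
      rw [Finset.insert_eq_of_mem h0] at hs
      obtain ⟨x, hx, hx'⟩ := Finset.mem_image.1 h0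
      have : x = r := sub_eq_zero.1 hx'
      exact ⟨this ▸ hx, hs⟩
    have hrI : r ∈ I u := by
      simp only [I, Finset.mem_filter, Finset.mem_univ, true_and]
      exact fun A h h' => (hmove A h h').1
    have hsub : I v ⊆ (I u).image (fun x => x - r) := by
      intro x hx
      rw [Finset.mem_image]
      refine ⟨x + r, ?_, by ring⟩
      simp only [I, Finset.mem_filter, Finset.mem_univ, true_and] at hx ⊢
      intro A h h'
      have := hx _ (hmove A h h').2 (by rw [Finset.card_image_of_injective _ hinj, h', hauv])
      obtain ⟨y, hy, rfl⟩ := Finset.mem_image.1 this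
      simpa using hy
    have heq : I v = (I u).image (fun x => x - r) :=
      Finset.eq_of_subset_of_card_le hsub (by rw [Finset.card_image_of_injective _ hinj, hIuv])
    apply idx_inj hp (I := I u) ((hIa u).trans (haM u) |>.trans_lt hM) (hI0 u) hrI
    rw [← heq, hidx]
  let col : V → Finset ℕ := fun v => {idx (I v), (I v).card, a v + 1}
  have hlt1 : ∀ v, idx (I v) < (I v).card := fun v => idx_lt (hI0 v)
  have hlt2 : ∀ v, (I v).card < a v + 1 := fun v => Nat.lt_succ_of_le (hIa v)
  have hcol : ∀ v, col v ∈ Finset.powersetCard 3 (Finset.range (M + 2)) := by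
    intro v
    rw [Finset.mem_powersetCard]
    have h1 := hlt1 v
    have h2 := hlt2 v
    have h3 := haM v
    constructor
    · intro x hx
      simp only [col, Finset.mem_insert, Finset.mem_singleton] at hx
      rw [Finset.mem_range]
      omega
    · simp only [col]
      rw [Finset.card_eq_three]
      exact ⟨_, _, _, by omega, by omega, by omega, rfl⟩
  have hR : ∀ u v, S.R u v → T p n (S.d u v : ZMod p) → col u ≠ col v := by
    intro u v huv hT heq
    obtain ⟨e1, e2, e3⟩ := triple_inj (hlt1 u) (hlt2 u) (hlt1 v) (hlt2 v) heq
    exact T_ne_zero hnp.le hT (hproper u v huv (by omega) e2 e1)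
  have C : (S.graph p n).Coloring (Finset.powersetCard 3 (Finset.range (M + 2))) :=
    Coloring.mk (fun v => ⟨col v, hcol v⟩) (by
      intro u v huv heq
      have heq' : col u = col v := Subtype.ext_iff.1 heq
      rcases huv with h | h
      · exact hR u v h.1 h.2 heq'
      · exact hR v u h.1 h.2 heq'.symm)
  have := C.colorable
  rwa [Fintype.card_coe, Finset.card_powersetCard, Finset.card_range] at this

lemma colorable_of_clique {V : Type} (S : Sys V) {p n m : ℕ} (hp : p.Prime) (hnp : 2 * n < p)
    (hp3 : p < 3 * n) (hm1 : 1 ≤ m) (hmn : m < n)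
    (hm : ∀ K : Finset V, (S.graph p n).IsClique (K : Set V) → K.card ≤ m) :
    (S.graph p n).Colorable ((3 * m + 1).choose 3) := by
  have key : ∀ (v : V) (A : Finset (ZMod p)), ChainRes S p v A → A.card * n ≤ p * m :=
    fun v A h => h.card_mul_le hp (by omega) hm
  by_cases h3 : 3 * m - 1 < p
  · have := colorable_of S (n := n) (M := 3 * m - 1) hp (by omega) h3 (by
      intro v A h
      have h1 := key v A h
      have h2 : A.card < 3 * m := by
        by_contra hcon
        push Not at hcon
        nlinarith
      omega)
    rwa [show 3 * m - 1 + 2 = 3 * m + 1 by omega] at this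
  · have h0 := hp.two_le
    have := colorable_of S (n := n) (M := p - 1) hp (by omega) (by omega) (by
      intro v A h
      have h1 := key v A h
      have h2 : A.card < p := by
        by_contra hcon
        push Not at hcon
        nlinarith
      omega)
    exact this.mono (Nat.choose_le_choose 3 (by omega))

/-! ### exact chromatic number -/

lemma exists_induce_exact {V : Type} [Fintype V] (G : SimpleGraph V) (k : ℕ)
    (h : ¬ G.Colorable k) : ∃ s : Set V, (G.induce s).chromaticNumber = ((k + 1 : ℕ) : ℕ∞) := by
  let P : Finset V → Prop := fun s => ¬ (G.induce (s : Set V)).Colorable k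
  have hP : P Finset.univ := by
    intro hc
    apply h
    obtain ⟨c⟩ := hc
    exact ⟨Coloring.mk (fun v => c ⟨v, by simp⟩) (fun {u v} huv =>
      c.valid (show (G.induce _).Adj ⟨u, _⟩ ⟨v, _⟩ from huv))⟩
  obtain ⟨s, hs⟩ := exists_minimal_of_wellFoundedLT P ⟨_, hP⟩
  refine ⟨(s : Set V), ?_⟩
  have hs1 : ¬ (G.induce (s : Set V)).Colorable k := hs.1
  have hne : s.Nonempty := by
    by_contra hcon
    rw [Finset.not_nonempty_iff_eq_empty] at hcon
    subst hcon
    apply hs1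
    exact ⟨Coloring.mk (fun v => absurd v.2 (by simp)) (fun {u v} _ => absurd u.2 (by simp))⟩
  obtain ⟨v, hv⟩ := hne
  have hcol : (G.induce ((s.erase v : Finset V) : Set V)).Colorable k := by
    by_contra hcon
    have := hs.2 (y := s.erase v) hcon (Finset.erase_subset _ _) hv
    simp at this
  obtain ⟨c⟩ := hcol
  have C : (G.induce (s : Set V)).Coloring (Option (Fin k)) :=
    Coloring.mk (fun u => if hu : u.1 = v then none else
      some (c ⟨u.1, by
        have := u.2
        simp only [Finset.mem_coe] at this
        simp [hu, this]⟩)) (by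
      intro u w huw
      have huw' : G.Adj u.1 w.1 := huw
      by_cases hu : u.1 = v
      · have hw : w.1 ≠ v := by
          intro hw
          exact huw'.ne (hu.trans hw.symm)
        simp [hu, hw]
      · by_cases hw : w.1 = v
        · simp [hu, hw]
        · simp only [hu, hw, dif_neg, not_false_eq_true, ne_eq, Option.some.injEq]
          exact c.valid (show (G.induce _).Adj ⟨u.1, _⟩ ⟨w.1, _⟩ from huw'))
  have hk1 : (G.induce (s : Set V)).Colorable (k + 1) := by
    have := C.colorable
    simpa using this
  apply le_antisymm
  · exact chromaticNumber_le_iff_colorable.2 hk1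
  · by_contra hcon
    push Not at hcon
    apply hs1
    rw [← chromaticNumber_le_iff_colorable]
    exact Order.le_of_lt_add_one (by exact_mod_cast hcon)


/-! ### Assembly -/

lemma card_le_cliqNum {V : Type} [Fintype V] (G : SimpleGraph V) (K : Finset V)
    (hK : G.IsClique (K : Set V)) : K.card ≤ cliqNum G := by
  unfold cliqNum
  apply le_csSup
  · refine ⟨Fintype.card V, ?_⟩
    rintro n ⟨s, hs⟩
    rw [← hs.card_eq]
    exact Finset.card_le_univ s
  · exact ⟨K, ⟨hK, rfl⟩⟩

lemma cliqNum_le {V : Type} [Fintype V] (G : SimpleGraph V) (n : ℕ)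
    (h : ∀ K : Finset V, G.IsClique (K : Set V) → K.card ≤ n) : cliqNum G ≤ n := by
  unfold cliqNum
  apply csSup_le
  · exact ⟨0, ∅, by simp⟩
  · rintro k ⟨s, hs⟩
    rw [← hs.card_eq]
    exact h s hs.isClique

lemma edgeless_bound {f : ℕ → ℕ} (hmono : Monotone f) (hf1 : f 1 = 1) {V : Type} [Fintype V]
    (H : SimpleGraph V) (hH : ∀ u v, ¬ H.Adj u v) : H.Colorable (f (cliqNum H)) := by
  rcases isEmpty_or_nonempty V with hV | ⟨⟨v⟩⟩
  · exact ⟨Coloring.mk (fun v => (hV.false v).elim) (fun {v} => (hV.false v).elim)⟩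
  · have h1 : 1 ≤ cliqNum H := by
      have := card_le_cliqNum H {v} (by simp)
      simpa using this
    have h2 : 1 ≤ f (cliqNum H) := hf1 ▸ hmono h1
    exact ⟨Coloring.mk (fun _ => ⟨0, h2⟩) (fun {u v} h => (hH u v h).elim)⟩

lemma graph_comap {V W : Type} (S : Sys W) (p n : ℕ) (e : V → W) (H : SimpleGraph V)
    (h : ∀ u v, (S.graph p n).Adj (e u) (e v) ↔ H.Adj u v) : (S.comap e).graph p n = H := by
  ext u v
  rw [← h]
  exact Iff.rfl

lemma exists_piece {f : ℕ → ℕ} (hmono : Monotone f)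
    (hf1 : f 1 = 1) (hfge : ∀ n : ℕ, 2 ≤ n → (3 * n + 1).choose 3 ≤ f n) (n : ℕ) (hn : 1 ≤ n) :
    ∃ (m : ℕ) (G : SimpleGraph (Fin m)), G.chromaticNumber = (f n : ℕ∞) ∧ cliqNum G ≤ n ∧
      ∀ (V : Type) [Fintype V] (H : SimpleGraph V), Nonempty (H ↪g G) →
        H.chromaticNumber ≤ (f (cliqNum H) : ℕ∞) := by
  rcases hn.eq_or_lt with rfl | hn2
  · refine ⟨1, ⊥, ?_, ?_, ?_⟩
    · rw [hf1, Nat.cast_one]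
      exact chromaticNumber_bot
    · apply cliqNum_le
      intro K _
      simpa using Finset.card_le_univ K
    · rintro V _ H ⟨e⟩
      refine (edgeless_bound hmono hf1 H ?_).chromaticNumber_le
      intro u v h
      exact (e.map_adj_iff.2 h)
  · obtain ⟨p, hp, hp2, hp3⟩ := exists_prime_two_three n hn2
    obtain ⟨W, _, S, hS⟩ := exists_sys (f n - 1)
    have hfn : 1 ≤ f n := hf1 ▸ hmono hn
    have hG : ¬ (S.graph p n).Colorable (f n - 1) := fun h =>
      hS (h.mono_left (cover_le_graph S p n hn2))
    obtain ⟨s, hs⟩ := exists_induce_exact (S.graph p n) (f n - 1) hG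
    rw [Nat.sub_add_cancel hfn] at hs
    let eq : s ≃ Fin (Fintype.card s) := Fintype.equivFin s
    let i : Fin (Fintype.card s) → W := fun x => (eq.symm x : W)
    let G := (S.comap i).graph p n
    have iso : G ≃g (S.graph p n).induce s := ⟨eq.symm, Iff.rfl⟩
    have hχ : G.chromaticNumber = (f n : ℕ∞) := by
      rw [← hs]
      apply le_antisymm
      · exact chromaticNumber_le_of_forall_imp fun k hk => hk.of_hom iso.toHom
      · exact chromaticNumber_le_of_forall_imp fun k hk => hk.of_hom iso.symm.toHom
    refine ⟨_, G, hχ, cliqNum_le _ _ fun K hK => clique_card_le _ hp hn hp2 K hK, ?_⟩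
    rintro V _ H ⟨e⟩
    by_cases hE : ∀ u v, ¬ H.Adj u v
    · exact (edgeless_bound hmono hf1 H hE).chromaticNumber_le
    push Not at hE
    obtain ⟨u, v, huv⟩ := hE
    have h2 : 2 ≤ cliqNum H := by
      have := card_le_cliqNum H {u, v} (by
        simp [huv])
      rwa [Finset.card_pair huv.ne] at this
    rcases le_or_gt n (cliqNum H) with hle | hlt
    · calc H.chromaticNumber ≤ G.chromaticNumber :=
            chromaticNumber_le_of_forall_imp fun k hk => hk.of_hom e.toHom
        _ = (f n : ℕ∞) := hχ
        _ ≤ _ := by exact_mod_cast hmono hle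
    · have hH := graph_comap (S.comap i) p n e H (fun u v => e.map_adj_iff)
      have hc := colorable_of_clique ((S.comap i).comap e) hp hp2 hp3 (m := cliqNum H)
        (by omega) hlt (by rw [hH]; exact card_le_cliqNum H)
      rw [hH] at hc
      exact (hc.mono (hfge _ h2)).chromaticNumber_le

end BDW

/-- Briański–Davies–Walczak: every admissible function `f` is the optimal `χ`-bounding
function of some hereditary class. -/
theorem arbitrary_optimal_chi_bounding_function (f : ℕ → ℕ) (hmono : Monotone f)
    (hf1 : f 1 = 1) (hfge : ∀ n : ℕ, 2 ≤ n → (3 * n + 1).choose 3 ≤ f n) :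
    ∃ F : GraphClass, Hereditary F ∧
      (∀ (V : Type) [Fintype V] (G : SimpleGraph V),
        F V G → G.chromaticNumber ≤ (f (cliqNum G) : ℕ∞)) ∧
      (∀ n : ℕ, 1 ≤ n → ∃ (m : ℕ) (G : SimpleGraph (Fin m)),
        F (Fin m) G ∧ cliqNum G ≤ n ∧ G.chromaticNumber = (f n : ℕ∞)) := by
  choose m G hχ hω hb using BDW.exists_piece hmono hf1 hfge
  refine ⟨fun V _ H => ∃ (n : ℕ) (hn : 1 ≤ n), Nonempty (H ↪g G n hn), ⟨?_, ?_⟩, ?_, ?_⟩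
  · rintro V W _ _ A B ⟨e⟩ ⟨n, hn, ⟨i⟩⟩
    exact ⟨n, hn, ⟨e.symm.toEmbedding.trans i⟩⟩
  · rintro V _ A s _ ⟨n, hn, ⟨i⟩⟩
    exact ⟨n, hn, ⟨(SimpleGraph.Embedding.induce s).trans i⟩⟩
  · rintro V _ A ⟨n, hn, h⟩
    exact hb n hn V A h
  · intro n hn
    exact ⟨m n hn, G n hn, ⟨n, hn, ⟨SimpleGraph.Embedding.refl⟩⟩, hω n hn, hχ n hn⟩
end
end

section
/- There exists a hereditary class F of finite simple graphs such that F is not χ-bounded (there is no function g : ℕ → ℕ with χ(G) ≤ g(ω(G)) for all G ∈ F), yet every triangle-free graph in F has chromatic number at most 4. -/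
open SimpleGraph
open scoped Classical

noncomputable section

/-- A partial order whose related pairs carry a residue mod 3, additive along chains. -/
structure LabelledOrder {V : Type} (R : V → V → ZMod 3 → Prop) : Prop where
  refl : ∀ u, R u u 0
  trans : ∀ u v w a b, R u v a → R v w b → R u w (a + b)
  uniq : ∀ u v a b, R u v a → R u v b → a = b
  antisymm : ∀ u v a b, R u v a → R v u b → u = v

/-- `G` joins exactly the related pairs with nonzero label. -/
def Represents {V : Type} (R : V → V → ZMod 3 → Prop) (G : SimpleGraph V) : Prop :=
  LabelledOrder R ∧ ∀ u v, G.Adj u v ↔ ∃ a, a ≠ 0 ∧ (R u v a ∨ R v u a)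

/-- The class of all representable graphs. -/
def theClass : GraphClass := fun V _ G => ∃ R : V → V → ZMod 3 → Prop, Represents R G

/-- Pullback along an embedding. -/
theorem Represents.comap {V W : Type} {R : V → V → ZMod 3 → Prop} {G : SimpleGraph V}
    (h : Represents R G) {H : SimpleGraph W} (f : H ↪g G) :
    Represents (fun u v a => R (f u) (f v) a) H := by
  refine ⟨⟨fun u => h.1.refl _, fun u v w a b => h.1.trans _ _ _ a b,
    fun u v a b => h.1.uniq _ _ a b, fun u v a b h1 h2 => f.injective (h.1.antisymm _ _ a b h1 h2)⟩,
    fun u v => ?_⟩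
  rw [← f.map_adj_iff, h.2]

/-- Cliques have at most three vertices. -/
theorem Represents.clique_card_le {V : Type} {R : V → V → ZMod 3 → Prop} {G : SimpleGraph V}
    (h : Represents R G) (s : Finset V) (hs : G.IsClique s) : s.card ≤ 3 := by
  rcases s.eq_empty_or_nonempty with rfl | hne
  · simp
  let P : PartialOrder V :=
    { le := fun u v => ∃ a, R u v a
      le_refl := fun u => ⟨0, h.1.refl u⟩
      le_trans := fun u v w ⟨a, ha⟩ ⟨b, hb⟩ => ⟨a + b, h.1.trans _ _ _ _ _ ha hb⟩
      le_antisymm := fun u v ⟨a, ha⟩ ⟨b, hb⟩ => h.1.antisymm _ _ _ _ ha hb }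
  obtain ⟨m, hm⟩ := s.exists_minimal hne
  have hle : ∀ v ∈ s, ∃ a, R m v a := by
    intro v hv
    by_cases e : m = v
    · exact e ▸ ⟨0, h.1.refl _⟩
    · obtain ⟨a, -, ha | ha⟩ := (h.2 m v).1 (hs hm.1 hv e)
      · exact ⟨a, ha⟩
      · exact hm.2 hv ⟨a, ha⟩
  choose! l hl using hle
  have hinj : Set.InjOn l s := by
    intro u hu v hv e
    by_contra hne
    obtain ⟨a, ha0, ha | ha⟩ := (h.2 u v).1 (hs hu hv hne)
    · have := h.1.uniq _ _ _ _ (h.1.trans _ _ _ _ _ (hl u hu) ha) (hl v hv)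
      rw [e] at this
      exact ha0 (by simpa using this)
    · have := h.1.uniq _ _ _ _ (h.1.trans _ _ _ _ _ (hl v hv) ha) (hl u hu)
      rw [e] at this
      exact ha0 (by simpa using this)
  have := Finset.card_le_card_of_injOn (t := Finset.univ) l (by simp) hinj
  simpa [ZMod.card] using this

/-- Triangle-free representable graphs are 4-colorable. -/
theorem Represents.colorable_four {V : Type} {R : V → V → ZMod 3 → Prop} {G : SimpleGraph V}
    (h : Represents R G) (ht : G.CliqueFree 3) : G.Colorable 4 := by
  have key : ∀ a : ZMod 3, a ≠ 0 → ∀ w u v, R w u a → R u v a → False := by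
    intro a ha w u v h1 h2
    have h3 := h.1.trans _ _ _ _ _ h1 h2
    have haa : a + a ≠ 0 := (by decide : ∀ x : ZMod 3, x ≠ 0 → x + x ≠ 0) a ha
    refine ht {w, u, v} (is3Clique_triple_iff.2 ⟨?_, ?_, ?_⟩)
    · exact (h.2 _ _).2 ⟨a, ha, Or.inl h1⟩
    · exact (h.2 _ _).2 ⟨a + a, haa, Or.inl h3⟩
    · exact (h.2 _ _).2 ⟨a, ha, Or.inl h2⟩
  have key2 : ∀ a : ZMod 3, a ≠ 0 → ∀ u v, R u v a → ((∃ w, R w u a) ↔ (∃ w, R w v a)) → False := by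
    intro a ha u v h1 h2
    obtain ⟨w, hw⟩ := h2.2 ⟨u, h1⟩
    exact key a ha w u v hw h1
  have h12 : ∀ a : ZMod 3, a ≠ 0 → a = 1 ∨ a = 2 := by decide
  let c : V → Bool × Bool := fun v => (decide (∃ w, R w v 1), decide (∃ w, R w v 2))
  have aux : ∀ u v a, a ≠ 0 → R u v a → c u ≠ c v := by
    intro u v a ha hr e
    simp only [c, Prod.mk.injEq, decide_eq_decide] at e
    rcases h12 a ha with rfl | rfl
    · exact key2 1 ha u v hr e.1
    · exact key2 2 ha u v hr e.2
  have C : G.Coloring (Bool × Bool) := Coloring.mk c (by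
    intro u v huv
    obtain ⟨a, ha, hr | hr⟩ := (h.2 u v).1 huv
    · exact aux u v a ha hr
    · exact (aux v u a ha hr).symm)
  simpa using C.colorable

/-- The labelled order of the Zykov-type step. -/
def stepRel {V : Type} (n : ℕ) (R : V → V → ZMod 3 → Prop) :
    (Fin n × V) ⊕ (Fin n → V) → (Fin n × V) ⊕ (Fin n → V) → ZMod 3 → Prop
  | Sum.inl (i, u), Sum.inl (j, v), a => i = j ∧ R u v a
  | Sum.inl (i, u), Sum.inr f, a => R u (f i) (a - 1)
  | Sum.inr _, Sum.inl _, _ => False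
  | Sum.inr f, Sum.inr g, a => f = g ∧ a = 0

theorem stepRel_labelled {V : Type} (n : ℕ) {R : V → V → ZMod 3 → Prop} (h : LabelledOrder R) :
    LabelledOrder (stepRel n R) := by
  constructor
  · rintro (⟨i, u⟩ | f)
    · exact ⟨rfl, h.refl u⟩
    · exact ⟨rfl, rfl⟩
  · rintro (⟨i, u⟩ | f) (⟨j, v⟩ | g) (⟨k, w⟩ | e) a b h1 h2 <;> simp only [stepRel] at h1 h2 ⊢
    · exact ⟨h1.1.trans h2.1, h.trans _ _ _ _ _ h1.2 h2.2⟩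
    · obtain ⟨rfl, h1⟩ := h1
      rw [add_sub_assoc]
      exact h.trans _ _ _ _ _ h1 h2
    · obtain ⟨rfl, rfl⟩ := h2
      simpa using h1
    · obtain ⟨rfl, rfl⟩ := h1
      obtain ⟨rfl, rfl⟩ := h2
      simp
  · rintro (⟨i, u⟩ | f) (⟨j, v⟩ | g) a b h1 h2 <;> simp only [stepRel] at h1 h2
    · exact h.uniq _ _ _ _ h1.2 h2.2
    · exact sub_left_injective (h.uniq _ _ _ _ h1 h2)
    · rw [h1.2, h2.2]
  · rintro (⟨i, u⟩ | f) (⟨j, v⟩ | g) a b h1 h2 <;> simp only [stepRel] at h1 h2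
    · rw [h1.1, h.antisymm _ _ _ _ h1.2 h2.2]
    · rw [h1.1]

/-- The graph of a labelled order. -/
def relGraph {V : Type} {R : V → V → ZMod 3 → Prop} (h : LabelledOrder R) : SimpleGraph V where
  Adj u v := ∃ a, a ≠ 0 ∧ (R u v a ∨ R v u a)
  symm := ⟨fun _ _ ⟨a, ha, hr⟩ => ⟨a, ha, hr.symm⟩⟩
  loopless := ⟨fun u ⟨a, ha, hr⟩ => ha (h.uniq u u _ _ (hr.elim id id) (h.refl u))⟩

theorem exists_not_colorable (n : ℕ) : ∃ (V : Type) (_ : Fintype V) (R : V → V → ZMod 3 → Prop)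
    (h : LabelledOrder R), ¬ (relGraph h).Colorable n := by
  induction n with
  | zero =>
    refine ⟨Unit, inferInstance, fun _ _ a => a = 0, ⟨by simp, by simp, by simp, by simp⟩, ?_⟩
    rintro ⟨c⟩
    exact (c ()).elim0
  | succ n ih =>
    obtain ⟨V, _, R, h, hc⟩ := ih
    refine ⟨_, inferInstance, stepRel (n + 1) R, stepRel_labelled _ h, ?_⟩
    rintro ⟨c⟩
    have hex : ∀ i : Fin (n + 1), ∃ v : V, c (Sum.inl (i, v)) = i := by
      intro i
      by_contra hno
      push Not at hno
      apply hc
      have C : (relGraph h).Coloring {j : Fin (n + 1) // j ≠ i} :=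
        Coloring.mk (fun v => ⟨c (Sum.inl (i, v)), hno v⟩) (by
          rintro u v ⟨a, ha, hr⟩ e
          have e' := congrArg Subtype.val e
          refine c.valid (v := Sum.inl (i, u)) (w := Sum.inl (i, v)) ⟨a, ha, ?_⟩ e'
          simpa [stepRel] using hr)
      simpa [Fintype.card_subtype_compl] using C.colorable
    choose f hf using hex
    refine c.valid (v := Sum.inl (c (Sum.inr f), f (c (Sum.inr f)))) (w := Sum.inr f)
      ⟨1, by decide, Or.inl ?_⟩ (hf _)
    simpa [stepRel] using h.refl _

/-- Carbonero–Hompe–Moore–Spirkl: a hereditary class which is not `χ`-bounded although all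
its triangle-free members are `4`-chromatic. -/
theorem not_chi_bounded_triangle_free_four :
    ∃ F : GraphClass, Hereditary F ∧
      (¬ ∃ g : ℕ → ℕ, ∀ (V : Type) [Fintype V] (G : SimpleGraph V),
          F V G → G.chromaticNumber ≤ (g (cliqNum G) : ℕ∞)) ∧
      (∀ (V : Type) [Fintype V] (G : SimpleGraph V),
          F V G → G.CliqueFree 3 → G.chromaticNumber ≤ (4 : ℕ∞)) := by
  refine ⟨theClass, ⟨?_, ?_⟩, ?_, ?_⟩
  · rintro V W _ _ G H ⟨e⟩ ⟨R, hR⟩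
    exact ⟨_, hR.comap e.symm.toEmbedding⟩
  · rintro V _ G s - ⟨R, hR⟩
    exact ⟨_, hR.comap (Embedding.induce s)⟩
  · rintro ⟨g, hg⟩
    obtain ⟨V, _, R, h, hc⟩ := exists_not_colorable (g 0 + g 1 + g 2 + g 3)
    have hrep : Represents R (relGraph h) := ⟨h, fun _ _ => Iff.rfl⟩
    have h1 := hg V (relGraph h) ⟨R, hrep⟩
    rw [chromaticNumber_le_iff_colorable] at h1
    have h3 : cliqNum (relGraph h) ≤ 3 := by
      refine csSup_le ⟨0, ∅, by simp⟩ ?_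
      rintro n ⟨s, hs⟩
      rw [← hs.card_eq]
      exact hrep.clique_card_le s hs.isClique
    refine hc (h1.mono ?_)
    generalize cliqNum (relGraph h) = k at h3
    interval_cases k <;> omega
  · rintro V _ G ⟨R, hR⟩ ht
    exact chromaticNumber_le_iff_colorable.2 (hR.colorable_four ht)
end
end
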